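/- arXiv:1708.02442 — 2 statements merged into one kernel-verified Lean document; each statement's English description precedes it below -/
import Mathlib

section
/- Let K be an infinite field, s, m, n positive integers with n ≤ m, and A = [f_ij] an m×n matrix with entries f_ij ∈ ⟨x_1,…,x_s⟩·K[x_1,…,x_s]. Fix an integer N ≥ 1. For a tuple a = (a_ijk) ∈ K^{mns} let B_a = [g_ij] be the m×n matrix with g_ij = Σ_{k=1}^s a_ijk·x_k^N. Then there is a nonempty Zariski-open subset U ⊆ K^{mns} such that for all a ∈ U and every t ∈ {1,…,n}, the height of the determinantal ideal I_t(A + B_a) in K[x_1,…,x_s] equals min{s, (m−t+1)(n−t+1)}. -/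
/-- A subset of `ι → K` is Zariski open if it is the complement of the common zero
locus of a set of polynomials. -/
def ZariskiOpen {K : Type*} [CommRing K] {ι : Type*} (U : Set (ι → K)) : Prop :=
  ∃ S : Set (MvPolynomial ι K), U = { a | ∃ p ∈ S, MvPolynomial.eval a p ≠ 0 }

/-- `detIdeal t M` is the ideal `I_t(M)` generated by all `t × t` minors of `M`. -/
noncomputable def detIdeal {A : Type*} [CommRing A] {m n : ℕ} (t : ℕ)
    (M : Matrix (Fin m) (Fin n) A) : Ideal A :=
  Ideal.span { d | ∃ (f : Fin t → Fin m) (g : Fin t → Fin n), d = (M.submatrix f g).det }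

/-- The height of an ideal: the infimum of the heights of the primes containing it. -/
noncomputable def idealHeight {A : Type*} [CommRing A] (I : Ideal A) : ℕ∞ :=
  ⨅ (p : PrimeSpectrum A) (_ : I ≤ p.asIdeal), Order.height p

namespace GenPert

/-- Coefficients in the Laplace expansion of a bordered minor along its first row. -/
noncomputable def bw {R : Type*} [CommRing R] {m n r : ℕ} (M : Matrix (Fin m) (Fin n) R)
    (f : Fin r → Fin m) (g : Fin r → Fin n) (j : Fin n) (l : Fin r) : R :=
  (-1) ^ ((l : ℕ) + 1) *
    (M.submatrix f ((Fin.cons j g : Fin (r + 1) → Fin n) ∘ (Fin.succAbove l.succ))).det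

lemma det_bordered {R : Type*} [CommRing R] {m n r : ℕ} (M : Matrix (Fin m) (Fin n) R)
    (f : Fin r → Fin m) (g : Fin r → Fin n) (i : Fin m) (j : Fin n) :
    (M.submatrix (Fin.cons i f : Fin (r + 1) → Fin m) (Fin.cons j g : Fin (r + 1) → Fin n)).det
      = M i j * (M.submatrix f g).det + ∑ l, M i (g l) * bw M f g j l := by
  rw [Matrix.det_succ_row_zero, Fin.sum_univ_succ]
  congr 1
  · simp [Matrix.submatrix_submatrix, Function.comp_def]
  · refine Finset.sum_congr rfl fun l _ => ?_
    simp only [bw, Matrix.submatrix_apply, Fin.cons_zero, Fin.cons_succ, Fin.val_succ,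
      Matrix.submatrix_submatrix]
    have : (Fin.cons i f : Fin (r + 1) → Fin m) ∘ Fin.succ = f := by
      ext x; simp
    rw [this]; ring

lemma det_mul_thin {L : Type*} [Field L] {r : ℕ} (A : Matrix (Fin (r + 1)) (Fin r) L)
    (B : Matrix (Fin r) (Fin (r + 1)) L) : (A * B).det = 0 := by
  by_contra h
  have h1 := Matrix.rank_of_det_ne_zero h
  have h2 := Matrix.rank_mul_le_left A B
  have h3 := Matrix.rank_le_width A
  simp at h1
  omega

lemma map_minor {R R' : Type*} [CommRing R] [CommRing R'] (φ : R →+* R') {m n t : ℕ}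
    (M : Matrix (Fin m) (Fin n) R) (f : Fin t → Fin m) (g : Fin t → Fin n) :
    φ ((M.submatrix f g).det) = ((M.map φ).submatrix f g).det := by
  rw [RingHom.map_det]; rfl

lemma minor_mem {R : Type*} [CommRing R] {m n t : ℕ}
    (M : Matrix (Fin m) (Fin n) R) (f : Fin t → Fin m) (g : Fin t → Fin n) :
    (M.submatrix f g).det ∈ detIdeal t M := Ideal.subset_span ⟨f, g, rfl⟩

lemma detIdeal_le {R : Type*} [CommRing R] {m n t : ℕ}
    {M : Matrix (Fin m) (Fin n) R} {I : Ideal R} (h : ∀ (f : Fin t → Fin m) (g : Fin t → Fin n),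
    (M.submatrix f g).det ∈ I) : detIdeal t M ≤ I := by
  rw [detIdeal, Ideal.span_le]
  rintro _ ⟨f, g, rfl⟩
  exact h f g

lemma solve_aux {L : Type*} [Field L] {z D S : L} (hD : D ≠ 0) (h : z * D + S = 0) :
    z = S * (-1 / D) := by
  field_simp
  linear_combination h

/-- If all bordered minors of a nonzero minor vanish modulo a prime, all larger minors do. -/
lemma detIdeal_le_of_bordered {R : Type*} [CommRing R] {m n r : ℕ}
    (M : Matrix (Fin m) (Fin n) R) (Q : Ideal R) [Q.IsPrime]
    (f : Fin r → Fin m) (g : Fin r → Fin n) (hδ : (M.submatrix f g).det ∉ Q)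
    (hb : ∀ i j, (M.submatrix (Fin.cons i f : Fin (r + 1) → Fin m)
      (Fin.cons j g : Fin (r + 1) → Fin n)).det ∈ Q) :
    detIdeal (r + 1) M ≤ Q := by
  let L := FractionRing (R ⧸ Q)
  let φ : R →+* L := (algebraMap (R ⧸ Q) L).comp (Ideal.Quotient.mk Q)
  have hφ : ∀ x, φ x = 0 ↔ x ∈ Q := by
    intro x
    simp [φ, L, Ideal.Quotient.eq_zero_iff_mem]
  apply detIdeal_le
  intro f' g'
  rw [← hφ, map_minor]
  set Z := M.map φ with hZ
  have hδ' : (Z.submatrix f g).det ≠ 0 := by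
    rw [hZ, ← map_minor]; exact fun h => hδ ((hφ _).1 h)
  have hZij : ∀ i j, Z i j = ∑ l, Z i (g l) * (-(bw Z f g j l) / (Z.submatrix f g).det) := by
    intro i j
    have h := (hφ _).2 (hb i j)
    rw [map_minor, ← hZ, det_bordered] at h
    have e : ∑ l, Z i (g l) * (-(bw Z f g j l) / (Z.submatrix f g).det) =
        (∑ l, Z i (g l) * bw Z f g j l) * (-1 / (Z.submatrix f g).det) := by
      rw [Finset.sum_mul]
      refine Finset.sum_congr rfl fun l _ => ?_
      ring
    rw [e]
    exact solve_aux hδ' h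
  have : Z.submatrix f' g' = (Matrix.of fun a l => Z (f' a) (g l)) *
      (Matrix.of fun l b => -(bw Z f g (g' b) l) / (Z.submatrix f g).det) := by
    ext a b
    rw [Matrix.mul_apply, Matrix.submatrix_apply, hZij]
    rfl
  rw [this, det_mul_thin]

open Polynomial in
lemma height_le_map_C {R : Type*} [CommRing R] (P : Ideal R) [hP : P.IsPrime] :
    P.height ≤ (P.map (C : R →+* R[X])).height := by
  let F : PrimeSpectrum R → PrimeSpectrum R[X] := fun p =>
    ⟨p.asIdeal.map C, Ideal.isPrime_map_C_of_isPrime⟩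
  have hle : ∀ a b : PrimeSpectrum R, F a ≤ F b → a ≤ b := by
    intro a b h x hx
    have h1 : C x ∈ b.asIdeal.map (C : R →+* R[X]) := h (Ideal.mem_map_of_mem C hx)
    simpa using Ideal.mem_map_C_iff.1 h1 0
  have hF : StrictMono F := by
    intro a b hab
    exact lt_of_le_not_ge (Ideal.map_mono hab.le) (fun h => absurd (hle _ _ h) (not_le_of_gt hab))
  have := Order.height_le_height_apply_of_strictMono F hF ⟨P, hP⟩
  rw [← PrimeSpectrum.height_eq_orderHeight, ← PrimeSpectrum.height_eq_orderHeight] at this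
  exact this

open Polynomial in
lemma height_comap_le {R : Type*} [CommRing R] (P : Ideal R[X]) [P.IsPrime] :
    (P.comap C).height ≤ P.height :=
  (height_le_map_C _).trans (Ideal.height_mono Ideal.map_comap_le)

open Polynomial in
lemma height_comap_add_one_le {R : Type*} [CommRing R] (P : Ideal R[X]) [P.IsPrime]
    (h : (P.comap C).map (C : R →+* R[X]) ≠ P) :
    (P.comap C).height + 1 ≤ P.height := by
  have hlt : (P.comap C).map (C : R →+* R[X]) < P := lt_of_le_of_ne Ideal.map_comap_le h
  have : ((P.comap C).map (C : R →+* R[X])).IsPrime := Ideal.isPrime_map_C_of_isPrime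
  exact le_trans (by gcongr; exact height_le_map_C _)
    (Ideal.height_add_one_le_of_lt_of_isPrime hlt)

/-- A perturbation of one entry by a new variable. -/
noncomputable def pert {R : Type*} [CommRing R] {m n : ℕ} (M : Matrix (Fin m) (Fin n) R)
    (i₀ : Fin m) (j₀ : Fin n) : Matrix (Fin m) (Fin n) (Polynomial R) :=
  Matrix.of fun i j => Polynomial.C (M i j) + if i = i₀ ∧ j = j₀ then Polynomial.X else 0

lemma pert_eval {R : Type*} [CommRing R] {m n : ℕ} (M : Matrix (Fin m) (Fin n) R)
    (i₀ : Fin m) (j₀ : Fin n) : (pert M i₀ j₀).map (Polynomial.evalRingHom 0) = M := by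
  ext i j
  simp only [pert, Matrix.map_apply, Matrix.of_apply, Polynomial.coe_evalRingHom]
  split_ifs <;> simp

/-- If all `t`-minors lie in `P`, then all `(t+1)`-minors of the perturbation lie in `P[X]`. -/
lemma pert_minor_mem {R : Type*} [CommRing R] {m n t : ℕ} (M : Matrix (Fin m) (Fin n) R)
    (i₀ : Fin m) (j₀ : Fin n) (P : Ideal R) (hP : detIdeal t M ≤ P) :
    detIdeal (t + 1) (pert M i₀ j₀) ≤ P.map (Polynomial.C) := by
  apply detIdeal_le
  intro f g
  by_cases hf : Function.Injective f
  · have : ∃ a, ∀ a', a' ≠ a → f a' ≠ i₀ := by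
      by_cases h : ∃ a, f a = i₀
      · obtain ⟨a, ha⟩ := h
        exact ⟨a, fun a' h1 h2 => h1 (hf (h2.trans ha.symm))⟩
      · exact ⟨0, fun a' _ h2 => h ⟨a', h2⟩⟩
    obtain ⟨a, ha⟩ := this
    rw [Matrix.det_succ_row _ a]
    refine Ideal.sum_mem _ fun b _ => Ideal.mul_mem_left _ _ ?_
    have : ((pert M i₀ j₀).submatrix f g).submatrix a.succAbove b.succAbove =
        (M.map Polynomial.C).submatrix (f ∘ a.succAbove) (g ∘ b.succAbove) := by
      ext1 x y
      have := ha _ (Fin.succAbove_ne a x)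
      simp [pert, this]
    rw [this, ← map_minor]
    exact Ideal.mem_map_of_mem _ (hP (minor_mem _ _ _))
  · simp only [Function.Injective, not_forall] at hf
    obtain ⟨x, y, hxy, hne⟩ := hf
    rw [Matrix.det_zero_of_row_eq hne]
    · simp
    · ext1 b
      simp [hxy]

/-- The key step: `P[X]` stays minimal over the determinantal ideal of the perturbation. -/
lemma pert_minimal {R : Type*} [CommRing R] [IsNoetherianRing R] {m n t : ℕ}
    (M : Matrix (Fin m) (Fin n) R) (i₀ : Fin m) (j₀ : Fin n) (P : Ideal R)
    (hP : detIdeal t M ≤ P) (hmin : P ∈ (detIdeal (t + 1) M).minimalPrimes) :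
    P.map Polynomial.C ∈ (detIdeal (t + 1) (pert M i₀ j₀)).minimalPrimes := by
  have hPp : P.IsPrime := hmin.1.1
  have hPX : (P.map (Polynomial.C : R →+* Polynomial R)).IsPrime :=
    Ideal.isPrime_map_C_of_isPrime
  refine ⟨⟨hPX, pert_minor_mem M i₀ j₀ P hP⟩, ?_⟩
  rintro Q ⟨hQ, hQle⟩ hQP
  let ε : Polynomial R →+* R := Polynomial.evalRingHom 0
  let PP : Ideal (Polynomial R) := P.comap ε
  have hPPp : PP.IsPrime := Ideal.comap_isPrime ε P
  have hle : P.map Polynomial.C ≤ PP := by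
    rw [Ideal.map_le_iff_le_comap]
    intro x hx
    simpa [PP, ε] using hx
  have hXPP : Polynomial.X ∈ PP := by simp [PP, ε]
  have hXn : (Polynomial.X : Polynomial R) ∉ P.map Polynomial.C := by
    intro h
    have := Ideal.mem_map_C_iff.1 h 1
    rw [Polynomial.coeff_X_one] at this
    exact hPp.ne_top ((Ideal.eq_top_iff_one _).2 this)
  have hlt : P.map Polynomial.C < PP := lt_of_le_of_ne hle (fun h => hXn (h ▸ hXPP))
  have hPPmin : PP ∈ (Q ⊔ Ideal.span {Polynomial.X}).minimalPrimes := by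
    refine ⟨⟨hPPp, sup_le (hQP.trans hle) ?_⟩, ?_⟩
    · rw [Ideal.span_le]; simpa using hXPP
    · rintro N ⟨hN, hNle⟩ hNP
      have hXN : Polynomial.X ∈ N := hNle (Ideal.mem_sup_right (Ideal.subset_span rfl))
      have hdiff : ∀ p : Polynomial R, p - Polynomial.C (ε p) ∈ N := by
        intro p
        refine N.mem_of_dvd ?_ hXN
        rw [Polynomial.X_dvd_iff]
        simp [ε, Polynomial.coeff_zero_eq_eval_zero]
      have hN' : (N.comap Polynomial.C).IsPrime := Ideal.comap_isPrime _ N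
      have h1 : detIdeal (t + 1) M ≤ N.comap Polynomial.C := by
        apply detIdeal_le
        intro f g
        have h2 := hNle (Ideal.mem_sup_left (hQle (minor_mem (pert M i₀ j₀) f g)))
        have h3 := N.sub_mem h2 (hdiff (((pert M i₀ j₀).submatrix f g).det))
        rw [sub_sub_cancel, map_minor ε, pert_eval] at h3
        exact h3
      have h4 : N.comap Polynomial.C ≤ P := by
        intro x hx
        have := hNP hx
        simpa [PP, ε] using this
      have h5 := hmin.2 ⟨hN', h1⟩ h4
      intro p hp
      have h6 : Polynomial.C (ε p) ∈ N := h5 hp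
      simpa using N.add_mem (hdiff p) h6
  have hht := Ideal.map_height_le_one_of_mem_minimalPrimes hPPmin
  by_contra hcon
  have hQlt : Q < P.map Polynomial.C := lt_of_le_not_ge hQP hcon
  let π := Ideal.Quotient.mk Q
  have hker : ∀ I : Ideal (Polynomial R), Q ≤ I → (I.map π).comap π = I := by
    intro I hI
    rw [Ideal.comap_map_of_surjective _ Ideal.Quotient.mk_surjective]
    refine sup_eq_left.2 (le_trans (le_of_eq ?_) hI)
    exact Ideal.mk_ker
  have hp1 : ((P.map Polynomial.C).map π).IsPrime :=
    Ideal.map_isPrime_of_surjective Ideal.Quotient.mk_surjective (Ideal.mk_ker.trans_le hQP)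
  have hp2 : (PP.map π).IsPrime :=
    Ideal.map_isPrime_of_surjective Ideal.Quotient.mk_surjective
      (Ideal.mk_ker.trans_le (hQP.trans hle))
  have hlt1 : (P.map Polynomial.C).map π < PP.map π := by
    refine lt_of_le_of_ne (Ideal.map_mono hle) fun h => hlt.ne ?_
    rw [← hker _ hQP, h, hker _ (hQP.trans hle)]
  have hlt0 : (⊥ : Ideal (Polynomial R ⧸ Q)) < (P.map Polynomial.C).map π := by
    refine bot_lt_iff_ne_bot.2 fun h => hQlt.ne ?_
    rw [← hker _ hQP, h]
    exact Ideal.mk_ker.symm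
  have hb : (⊥ : Ideal (Polynomial R ⧸ Q)).IsPrime := Ideal.isPrime_bot
  have e1 := Ideal.height_add_one_le_of_lt_of_isPrime hlt0
  have e2 := Ideal.height_add_one_le_of_lt_of_isPrime hlt1
  have e3 : (1 : ℕ∞) + 1 ≤ 1 := by
    calc (1 : ℕ∞) + 1 ≤ ((P.map Polynomial.C).map π).height + 1 := by
          gcongr; exact le_trans le_add_self e1
      _ ≤ _ := e2
      _ ≤ 1 := hht
  exact absurd e3 (by decide)

lemma minor_injective {R : Type*} [CommRing R] {m n r : ℕ} {M : Matrix (Fin m) (Fin n) R}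
    {f : Fin r → Fin m} {g : Fin r → Fin n} (h : (M.submatrix f g).det ≠ 0) :
    Function.Injective f ∧ Function.Injective g := by
  constructor
  · intro x y hxy
    by_contra hne
    exact h (Matrix.det_zero_of_row_eq hne (by ext1 b; simp [hxy]))
  · intro x y hxy
    by_contra hne
    exact h (Matrix.det_zero_of_column_eq hne (by intro b; simp [hxy]))

lemma card_compl_range {r m : ℕ} {f : Fin r → Fin m} (hf : Function.Injective f) :
    (Finset.univ.filter fun i => i ∉ Set.range f).card = m - r := by
  classical
  have : (Finset.univ.filter fun i => i ∉ Set.range f) = (Finset.univ.image f)ᶜ := by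
    ext i; simp
  rw [this, Finset.card_compl, Finset.card_image_of_injective _ hf]; simp

lemma exists_not_range {r m : ℕ} (f : Fin r → Fin m) (h : r < m) : ∃ i, i ∉ Set.range f := by
  by_contra hc
  push Not at hc
  have := Fintype.card_le_of_surjective f hc
  simp at this; omega

/-- The Eagon-Northcott height bound, with an auxiliary non-vanishing minor. -/
lemma eagon_northcott_aux {m n : ℕ} (d : ℕ) : ∀ {R : Type*} [CommRing R] [IsNoetherianRing R]
    (r t : ℕ) (M : Matrix (Fin m) (Fin n) R) (P : Ideal R) (f : Fin r → Fin m) (g : Fin r → Fin n),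
    r + d = t → t < m → t < n → (M.submatrix f g).det ∉ P →
    P ∈ (detIdeal (t + 1) M).minimalPrimes → P.height ≤ ((m - t) * (n - t) : ℕ) := by
  induction d with
  | zero =>
    intro R _ _ r t M P f g hrt htm htn hδ hmin
    obtain rfl : r = t := by omega
    have hPp : P.IsPrime := hmin.1.1
    have hinj := minor_injective (M := M) (f := f) (g := g) (fun h => hδ (h ▸ P.zero_mem))
    classical
    let J : Finset R := ((Finset.univ.filter fun i => i ∉ Set.range f) ×ˢ
      (Finset.univ.filter fun j => j ∉ Set.range g)).image fun p =>
      (M.submatrix (Fin.cons p.1 f : Fin (r + 1) → Fin m)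
        (Fin.cons p.2 g : Fin (r + 1) → Fin n)).det
    have hJ : J.card ≤ (m - r) * (n - r) := by
      refine Finset.card_image_le.trans ?_
      rw [Finset.card_product, card_compl_range hinj.1, card_compl_range hinj.2]
    refine le_trans (Ideal.height_le_card_of_mem_minimalPrimes_span_finset (s := J) ?_)
      (by exact_mod_cast hJ)
    refine ⟨⟨hPp, ?_⟩, ?_⟩
    · rw [Ideal.span_le]
      intro x hx
      simp only [J, Finset.coe_image, Set.mem_image] at hx
      obtain ⟨p, -, rfl⟩ := hx
      exact hmin.1.2 (minor_mem _ _ _)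
    · rintro Q ⟨hQ, hQle⟩ hQP
      refine hmin.2 ⟨hQ, ?_⟩ hQP
      refine detIdeal_le_of_bordered M Q f g (fun h => hδ (hQP h)) fun i j => ?_
      by_cases hi : i ∈ Set.range f
      · obtain ⟨a, rfl⟩ := hi
        rw [Matrix.det_zero_of_row_eq (i := 0) (j := a.succ) (Fin.succ_ne_zero a).symm]
        · exact Q.zero_mem
        · ext1 b; simp
      by_cases hj : j ∈ Set.range g
      · obtain ⟨a, rfl⟩ := hj
        rw [Matrix.det_zero_of_column_eq (i := 0) (j := a.succ) (Fin.succ_ne_zero a).symm]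
        · exact Q.zero_mem
        · intro b; simp
      refine hQle (Ideal.subset_span ?_)
      simp only [J, Finset.coe_image, Set.mem_image]
      exact ⟨(i, j), by simp_all, rfl⟩
  | succ d ih =>
    intro R _ _ r t M P f g hrt htm htn hδ hmin
    have hPp : P.IsPrime := hmin.1.1
    by_cases hbig : ∃ (f' : Fin (r + 1) → Fin m) (g' : Fin (r + 1) → Fin n),
        (M.submatrix f' g').det ∉ P
    · obtain ⟨f', g', h'⟩ := hbig
      exact ih (r + 1) t M P f' g' (by omega) htm htn h' hmin
    push Not at hbig
    have hle : ∀ k, detIdeal (r + 1 + k) M ≤ P := by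
      intro k
      induction k with
      | zero => exact detIdeal_le hbig
      | succ k ihk =>
        apply detIdeal_le
        intro f' g'
        rw [Matrix.det_succ_row_zero]
        refine Ideal.sum_mem _ fun b _ => Ideal.mul_mem_left _ _ ?_
        rw [Matrix.submatrix_submatrix]
        exact ihk (minor_mem _ _ _)
    have hlet : detIdeal t M ≤ P := by
      have := hle d
      rwa [show r + 1 + d = t by omega] at this
    obtain ⟨i₀, hi⟩ := exists_not_range f (by omega)
    obtain ⟨j₀, hj⟩ := exists_not_range g (by omega)
    refine (height_le_map_C P).trans ?_
    refine ih (r + 1) t (pert M i₀ j₀) _ (Fin.cons i₀ f) (Fin.cons j₀ g) (by omega) htm htn ?_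
      (pert_minimal M i₀ j₀ P hlet hmin)
    rw [det_bordered]
    have hsub : ∀ f' : Fin r → Fin m, (∀ x, f' x ≠ i₀) → ∀ g' : Fin r → Fin n,
        ((pert M i₀ j₀).submatrix f' g') = (M.map Polynomial.C).submatrix f' g' := by
      intro f' hf' g'
      ext1 x y
      simp [pert, hf' x]
    have hfi : ∀ x, f x ≠ i₀ := fun x h => hi ⟨x, h⟩
    have hgj : ∀ x, g x ≠ j₀ := fun x h => hj ⟨x, h⟩
    intro hmem
    have h1 := Ideal.mem_map_C_iff.1 hmem 1
    have hbw : ∀ l, bw (pert M i₀ j₀) f g j₀ l = Polynomial.C (bw M f g j₀ l) := by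
      intro l
      rw [bw, hsub f hfi, bw, map_mul, map_minor]
      simp
    have hent : ∀ l, pert M i₀ j₀ i₀ (g l) = Polynomial.C (M i₀ (g l)) := by
      intro l; simp [pert, hgj l]
    have h00 : pert M i₀ j₀ i₀ j₀ = Polynomial.C (M i₀ j₀) + Polynomial.X := by simp [pert]
    rw [hsub f hfi g, ← map_minor, h00] at h1
    simp_rw [hbw, hent, ← map_mul] at h1
    rw [← map_sum] at h1
    simp [add_mul, Polynomial.coeff_C] at h1
    exact hδ h1

lemma eagon_northcott {m n t : ℕ} {R : Type*} [CommRing R] [IsNoetherianRing R]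
    (M : Matrix (Fin m) (Fin n) R) (P : Ideal R) (htm : t < m) (htn : t < n)
    (hmin : P ∈ (detIdeal (t + 1) M).minimalPrimes) : P.height ≤ ((m - t) * (n - t) : ℕ) := by
  refine eagon_northcott_aux t 0 t M P Fin.elim0 Fin.elim0 (by omega) htm htn ?_ hmin
  rw [Matrix.det_isEmpty]
  exact fun h => hmin.1.1.ne_top ((Ideal.eq_top_iff_one _).2 h)

end GenPert

namespace GenPert
open MvPolynomial

lemma height_lower_fin {B : Type*} [CommRing B] (δ : B) : ∀ (k : ℕ) (P : Ideal (MvPolynomial (Fin k) B))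
    (_ : P.IsPrime) (b : Fin k → B), C δ ∉ P → (∀ i, C δ * X i + C (b i) ∈ P) →
    (k : ℕ∞) ≤ P.height := by
  intro k
  induction k with
  | zero => intros; simp
  | succ k ih =>
    intro P hP b hδ hb
    let e := (finSuccEquiv B k).toRingEquiv
    let P' : Ideal (Polynomial (MvPolynomial (Fin k) B)) := P.comap e.symm
    have hP' : P'.IsPrime := Ideal.comap_isPrime _ _
    have hht : P'.height = P.height := RingEquiv.height_comap e.symm P
    have hmem : ∀ x, x ∈ P ↔ e x ∈ P' := by
      intro x; simp [P', Ideal.mem_comap]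
    have heC : ∀ c : B, e (C c) = Polynomial.C (C c) := by
      intro c
      have := (finSuccEquiv B k).commutes c
      exact this
    have he0 : e (X 0) = Polynomial.X := finSuccEquiv_X_zero
    have heS : ∀ j : Fin k, e (X j.succ) = Polynomial.C (X j) := fun j => finSuccEquiv_X_succ
    let q := P'.comap Polynomial.C
    have hq : q.IsPrime := Ideal.comap_isPrime _ _
    have hδq : C δ ∉ q := by
      rw [Ideal.mem_comap, ← heC, ← hmem]; exact hδ
    have h1 := ih q hq (fun j => b j.succ) hδq (by
      intro i
      rw [Ideal.mem_comap, map_add, map_mul, ← heC, ← heC, ← heS, ← map_mul, ← map_add, ← hmem]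
      exact hb _)
    have h2 : q.map Polynomial.C ≠ P' := by
      intro h
      have h3 := (hmem _).1 (hb 0)
      rw [← h, map_add, map_mul, heC, heC, he0, Ideal.mem_map_C_iff] at h3
      have h4 := h3 1
      simp [Polynomial.coeff_C] at h4
      exact hδq h4
    have h3 := height_comap_add_one_le P' h2
    rw [← hht]
    push_cast
    exact le_trans (by gcongr) h3

/-- Splitting the variables into those outside `S` and those in `S`. -/
noncomputable def splitE (K : Type*) [CommRing K] {σ : Type*} (S : Set σ) :
    MvPolynomial σ K ≃ₐ[K] MvPolynomial ↥Sᶜ (MvPolynomial S K) :=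
  open Classical in
  (renameEquiv K ((Equiv.sumComm _ _).trans (Equiv.Set.sumCompl S)).symm).trans
    (sumAlgEquiv K ↥Sᶜ S)

lemma splitE_X_compl (K : Type*) [CommRing K] {σ : Type*} (S : Set σ) (w : ↥Sᶜ) :
    splitE K S (X w.1) = X w := by
  classical
  have : (Equiv.Set.sumCompl S).symm w.1 = Sum.inr w := by
    rw [Equiv.symm_apply_eq]; simp
  simp [splitE, this]

lemma splitE_rename (K : Type*) [CommRing K] {σ : Type*} (S : Set σ) (b : MvPolynomial S K) :
    splitE K S (rename (↑) b) = C b := by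
  classical
  have : ((splitE K S).toAlgHom.comp (rename ((↑) : S → σ))) =
      IsScalarTower.toAlgHom K (MvPolynomial S K) (MvPolynomial ↥Sᶜ (MvPolynomial S K)) := by
    ext1 w
    have : (Equiv.Set.sumCompl S).symm w.1 = Sum.inl w := by
      rw [Equiv.symm_apply_eq]; simp
    simp [splitE, this, MvPolynomial.algebraMap_eq]
  exact DFunLike.congr_fun this b

lemma height_lower {K : Type*} [CommRing K] {σ : Type*} [Finite σ] (S : Set σ)
    (P : Ideal (MvPolynomial σ K)) [P.IsPrime] (δ : MvPolynomial σ K) (hδS : δ ∈ supported K S)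
    (hδ : δ ∉ P) (hb : ∀ w ∉ S, ∃ b ∈ supported K S, δ * X w + b ∈ P) :
    ((Sᶜ).ncard : ℕ∞) ≤ P.height := by
  rw [supported_eq_range_rename] at hδS
  obtain ⟨δ', rfl⟩ := hδS
  have hb' : ∀ w : ↥Sᶜ, ∃ b : MvPolynomial S K, rename (↑) δ' * X w.1 + rename (↑) b ∈ P := by
    intro w
    obtain ⟨b, hbS, h⟩ := hb w.1 w.2
    rw [supported_eq_range_rename] at hbS
    obtain ⟨b', rfl⟩ := hbS
    exact ⟨b', h⟩
  choose b hb' using hb'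
  let k := (Sᶜ).ncard
  let ε : ↥Sᶜ ≃ Fin k := Finite.equivFinOfCardEq (Nat.card_coe_set_eq _)
  let E := ((splitE K S).toRingEquiv).trans (renameEquiv (MvPolynomial S K) ε).toRingEquiv
  let P' := P.comap E.symm
  have hP' : P'.IsPrime := Ideal.comap_isPrime _ _
  have hht : P'.height = P.height := RingEquiv.height_comap E.symm P
  have hmem : ∀ x, x ∈ P ↔ E x ∈ P' := by
    intro x; simp [P', Ideal.mem_comap]
  have hEr : ∀ b : MvPolynomial S K, E (rename (↑) b) = C b := by
    intro b
    change (renameEquiv (MvPolynomial S K) ε) (splitE K S (rename (↑) b)) = _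
    rw [splitE_rename]; simp
  have hEX : ∀ w : ↥Sᶜ, E (X w.1) = X (ε w) := by
    intro b
    change (renameEquiv (MvPolynomial S K) ε) (splitE K S (X b.1)) = _
    rw [splitE_X_compl]; simp
  rw [← hht]
  refine height_lower_fin δ' k P' hP' (fun i => b (ε.symm i)) ?_ ?_
  · rw [← hEr, ← hmem]; exact hδ
  · intro i
    have := (hmem _).1 (hb' (ε.symm i))
    rwa [map_add, map_mul, hEr, hEr, hEX, Equiv.apply_symm_apply] at this

lemma height_upper {K : Type*} [CommRing K] [IsDomain K] {σ : Type*} [Finite σ] (S : Set σ)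
    (P : Ideal (MvPolynomial σ K)) [P.IsPrime]
    (h : ∀ f ∈ P, f ∈ supported K S → f = 0) :
    P.height ≤ ((Sᶜ).ncard : ℕ∞) := by
  let E := (splitE K S).toRingEquiv
  let P' := P.comap E.symm
  have hP' : P'.IsPrime := Ideal.comap_isPrime _ _
  have hht : P'.height = P.height := RingEquiv.height_comap E.symm P
  have hmem : ∀ x, x ∈ P ↔ E x ∈ P' := by
    intro x; simp [P', Ideal.mem_comap]
  have hEr : ∀ b : MvPolynomial S K, E (rename (↑) b) = C b := splitE_rename K S
  let D := MvPolynomial S K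
  let L := FractionRing D
  let A := MvPolynomial ↥Sᶜ L
  letI : Algebra (MvPolynomial ↥Sᶜ D) A := MvPolynomial.algebraMvPolynomial
  let Ms : Submonoid (MvPolynomial ↥Sᶜ D) := (nonZeroDivisors D).map (C (σ := ↥Sᶜ))
  haveI : IsLocalization Ms A := MvPolynomial.isLocalization (nonZeroDivisors D) L
  have hdisj : Disjoint (Ms : Set (MvPolynomial ↥Sᶜ D)) (P' : Set _) := by
    rw [Set.disjoint_left]
    rintro _ ⟨d, hd, rfl⟩ hdP
    have h1 : rename (↑) d ∈ P := by rw [hmem, hEr]; exact hdP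
    have h2 := h _ h1 (by rw [supported_eq_range_rename]; exact ⟨d, rfl⟩)
    have h3 : d = 0 := rename_injective _ Subtype.val_injective (by simpa using h2)
    exact nonZeroDivisors.ne_zero hd h3
  have h1 := IsLocalization.height_map_of_disjoint (S := A) Ms P' hdisj
  have hprime : (P'.map (algebraMap _ A)).IsPrime :=
    IsLocalization.isPrime_of_isPrime_disjoint Ms A P' hP' hdisj
  have h2 := Ideal.height_le_ringKrullDim_of_isPrime (I := P'.map (algebraMap _ A))
  rw [h1, hht, MvPolynomial.ringKrullDim_of_isNoetherianRing, ringKrullDim_eq_zero_of_field,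
    zero_add, Nat.card_coe_set_eq] at h2
  exact_mod_cast h2

/-- Noether-type statement: a prime has a large set of algebraically independent coordinates. -/
lemma exists_indep {K : Type*} [Field K] : ∀ (s : ℕ) (P : Ideal (MvPolynomial (Fin s) K))
    (_ : P.IsPrime), ∃ T : Finset (Fin s), (∀ f ∈ P, f ∈ supported K (T : Set (Fin s)) → f = 0) ∧
      (s : ℕ∞) ≤ T.card + P.height := by
  classical
  intro s
  induction s with
  | zero =>
    intro P hP
    refine ⟨∅, ?_, by simp⟩
    intro f hf hfs
    simp only [Finset.coe_empty, supported_empty, Algebra.mem_bot] at hfs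
    obtain ⟨c, rfl⟩ := hfs
    by_contra hc
    have : IsUnit (algebraMap K (MvPolynomial (Fin 0) K) c) :=
      (IsUnit.mk0 c (fun h => hc (by simp [h]))).map _
    exact hP.ne_top (Ideal.eq_top_of_isUnit_mem _ hf this)
  | succ s ih =>
    intro P hP
    let e := (finSuccEquiv K s).toRingEquiv
    let P' : Ideal (Polynomial (MvPolynomial (Fin s) K)) := P.comap e.symm
    have hP' : P'.IsPrime := Ideal.comap_isPrime _ _
    have hht : P'.height = P.height := RingEquiv.height_comap e.symm P
    have hmem : ∀ x, x ∈ P ↔ e x ∈ P' := by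
      intro x; simp [P', Ideal.mem_comap]
    have heC : ∀ c : K, e (C c) = Polynomial.C (C c) := by
      intro c
      have := (finSuccEquiv K s).commutes c
      exact this
    have he0 : e (X 0) = Polynomial.X := finSuccEquiv_X_zero
    have heS : ∀ j : Fin s, e (X j.succ) = Polynomial.C (X j) := fun j => finSuccEquiv_X_succ
    let q := P'.comap Polynomial.C
    have hq : q.IsPrime := Ideal.comap_isPrime _ _
    obtain ⟨T, hT, hTc⟩ := ih q hq
    have hcoef : ∀ f ∈ supported K (insert 0 (Fin.succ '' (T : Set (Fin s)))), ∀ i,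
        (e f).coeff i ∈ supported K (T : Set (Fin s)) := by
      intro f hf
      refine Algebra.adjoin_induction (p := fun f _ => ∀ i,
        (e f).coeff i ∈ supported K (T : Set (Fin s))) ?_ ?_ ?_ ?_ hf
      · rintro _ ⟨x, hx, rfl⟩ i
        rcases hx with rfl | ⟨y, hy, rfl⟩
        · rw [he0, Polynomial.coeff_X]; split_ifs
          · exact Subalgebra.one_mem _
          · exact Subalgebra.zero_mem _
        · rw [heS, Polynomial.coeff_C]; split_ifs
          · exact X_mem_supported.2 hy
          · exact Subalgebra.zero_mem _
      · intro c i
        rw [MvPolynomial.algebraMap_eq, heC, Polynomial.coeff_C]; split_ifs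
        · exact Subalgebra.algebraMap_mem _ c
        · exact Subalgebra.zero_mem _
      · intro x y _ _ hx hy i
        rw [map_add, Polynomial.coeff_add]
        exact Subalgebra.add_mem _ (hx i) (hy i)
      · intro x y _ _ hx hy i
        rw [map_mul, Polynomial.coeff_mul]
        exact Subalgebra.sum_mem _ fun p _ => Subalgebra.mul_mem _ (hx _) (hy _)
    by_cases h : q.map Polynomial.C = P'
    · refine ⟨insert 0 (T.image Fin.succ), ?_, ?_⟩
      · intro f hf hfs
        apply e.injective
        rw [map_zero]
        ext1 i
        rw [hmem, ← h, Ideal.mem_map_C_iff] at hf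
        exact hT _ (hf i) (hcoef f (by simpa using hfs) i)
      · rw [Finset.card_insert_of_notMem (by simp),
          Finset.card_image_of_injective _ (Fin.succ_injective s), ← hht]
        have h3 := height_comap_le P'
        push_cast
        calc (s : ℕ∞) + 1 ≤ (T.card + q.height) + 1 := by gcongr
          _ = T.card + 1 + q.height := by ring
          _ ≤ _ := by gcongr
    · refine ⟨T.image Fin.succ, ?_, ?_⟩
      · intro f hf hfs
        rw [Finset.coe_image] at hfs
        have h0 : ∃ f', f = rename Fin.succ f' ∧ True := by
          have : f ∈ (rename (R := K) (Fin.succ : Fin s → Fin (s + 1))).range := by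
            refine (Algebra.adjoin_le ?_ : supported K _ ≤ _) hfs
            rintro _ ⟨_, ⟨y, hy, rfl⟩, rfl⟩
            exact ⟨X y, by simp⟩
          obtain ⟨f', rfl⟩ := this
          exact ⟨f', rfl, trivial⟩
        obtain ⟨f', rfl, -⟩ := h0
        have hef : e (rename Fin.succ f') = Polynomial.C f' := by
          have : ((finSuccEquiv K s).toAlgHom.comp (rename Fin.succ)) =
              IsScalarTower.toAlgHom K (MvPolynomial (Fin s) K)
                (Polynomial (MvPolynomial (Fin s) K)) := by
            ext1 w
            simp [finSuccEquiv_X_succ, Polynomial.algebraMap_eq]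
          exact DFunLike.congr_fun this f'
        have h1 := hcoef _ (supported_mono (Set.subset_insert _ _) hfs) 0
        rw [hef, Polynomial.coeff_C_zero] at h1
        have h2 : f' ∈ q := by
          rw [Ideal.mem_comap, ← hef, ← hmem]; exact hf
        rw [hT f' h2 h1, map_zero]
      · rw [Finset.card_image_of_injective _ (Fin.succ_injective s), ← hht]
        have h3 := height_comap_add_one_le P' h
        push_cast
        calc (s : ℕ∞) + 1 ≤ (T.card + q.height) + 1 := by gcongr
          _ = T.card + (q.height + 1) := by ring
          _ ≤ _ := by gcongr

end GenPert

namespace GenPert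
open MvPolynomial

lemma det_mem_subalgebra {K R : Type*} [CommRing K] [CommRing R] [Algebra K R]
    (H : Subalgebra K R) {r : ℕ} (M : Matrix (Fin r) (Fin r) R) (h : ∀ i j, M i j ∈ H) :
    M.det ∈ H := by
  have : M.det = H.val.toRingHom (Matrix.det (Matrix.of fun i j => (⟨M i j, h i j⟩ : H))) := by
    rw [RingHom.map_det]; rfl
  rw [this]
  exact Subtype.prop _

/-- The generic perturbation matrix. -/
noncomputable def Mgen {K : Type*} [CommRing K] {s m n : ℕ} (N : ℕ)
    (A : Matrix (Fin m) (Fin n) (MvPolynomial (Fin s) K)) :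
    Matrix (Fin m) (Fin n) (MvPolynomial (Fin s ⊕ (Fin m × Fin n × Fin s)) K) :=
  Matrix.of fun i j => rename Sum.inl (A i j) +
    ∑ k : Fin s, X (Sum.inr (i, j, k)) * X (Sum.inl k) ^ N

lemma X_mem_supp {K : Type*} [CommRing K] {σ : Type*} {S : Set σ} {w : σ} (h : w ∈ S) :
    (X w : MvPolynomial σ K) ∈ supported K S :=
  Algebra.subset_adjoin ⟨w, h, rfl⟩

lemma rename_mem_supp {K : Type*} [CommRing K] {σ τ : Type*} {S : Set σ} {g : τ → σ}
    (h : ∀ x, g x ∈ S) (p : MvPolynomial τ K) : rename g p ∈ supported K S := by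
  induction p using MvPolynomial.induction_on with
  | C a => rw [rename_C]; exact Subalgebra.algebraMap_mem _ a
  | add p q hp hq => rw [map_add]; exact add_mem hp hq
  | mul_X p i hp => rw [map_mul, rename_X]; exact mul_mem hp (X_mem_supp (h i))

lemma exists_max_minor {R : Type*} [CommRing R] {m n : ℕ} (M : Matrix (Fin m) (Fin n) R)
    (P : Ideal R) (hP : P ≠ ⊤) : ∀ t : ℕ, detIdeal t M ≤ P →
    ∃ r < t, (∃ (f : Fin r → Fin m) (g : Fin r → Fin n), (M.submatrix f g).det ∉ P) ∧
      ∀ (f : Fin (r + 1) → Fin m) (g : Fin (r + 1) → Fin n), (M.submatrix f g).det ∈ P := by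
  intro t
  induction t with
  | zero =>
    intro h
    have := h (minor_mem M Fin.elim0 Fin.elim0)
    rw [Matrix.det_isEmpty] at this
    exact absurd ((Ideal.eq_top_iff_one _).2 this) hP
  | succ t ih =>
    intro h
    by_cases h' : detIdeal t M ≤ P
    · obtain ⟨r, hr, h2⟩ := ih h'
      exact ⟨r, by omega, h2⟩
    · refine ⟨t, by omega, ?_, fun f g => h (minor_mem M f g)⟩
      by_contra hc
      push Not at hc
      exact h' (detIdeal_le hc)

lemma generic_lower {K : Type*} [Field K] {s m n : ℕ} (N : ℕ)
    (A : Matrix (Fin m) (Fin n) (MvPolynomial (Fin s) K)) (t : ℕ) (htn : t ≤ n) (hnm : n ≤ m)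
    (P : Ideal (MvPolynomial (Fin s ⊕ (Fin m × Fin n × Fin s)) K)) (hP : P.IsPrime)
    (hdet : detIdeal t (Mgen N A) ≤ P) (k : Fin s) (hk : X (Sum.inl k) ∉ P) :
    (((m - t + 1) * (n - t + 1) : ℕ) : ℕ∞) ≤ P.height := by
  classical
  obtain ⟨r, hr, ⟨f, g, hfg⟩, hall⟩ := exists_max_minor _ P hP.ne_top t hdet
  obtain ⟨hf, hg⟩ := minor_injective (fun h0 => hfg (by rw [h0]; exact P.zero_mem))
  let W : Finset (Fin s ⊕ (Fin m × Fin n × Fin s)) :=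
    ((Finset.univ.filter fun i => i ∉ Set.range f) ×ˢ
      (Finset.univ.filter fun i => i ∉ Set.range g)).image fun p => Sum.inr (p.1, p.2, k)
  have hWm : ∀ w, w ∈ W ↔ ∃ i j, i ∉ Set.range f ∧ j ∉ Set.range g ∧ Sum.inr (i, j, k) = w := by
    intro w
    simp only [W, Finset.mem_image, Finset.mem_product, Finset.mem_filter, Finset.mem_univ,
      true_and, Prod.exists, and_assoc]
  have hWc : W.card = (m - r) * (n - r) := by
    rw [Finset.card_image_of_injective, Finset.card_product, card_compl_range hf,
      card_compl_range hg]
    rintro ⟨a, b⟩ ⟨c, d⟩ h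
    simpa using h
  have hinl : ∀ x : Fin s, (Sum.inl x : Fin s ⊕ (Fin m × Fin n × Fin s)) ∈ ((W : Set _)ᶜ) := by
    intro x hx
    obtain ⟨i, j, -, -, h⟩ := (hWm _).1 hx
    cases h
  have hent : ∀ i j, (i ∈ Set.range f ∨ j ∈ Set.range g) →
      Mgen N A i j ∈ supported K ((W : Set _)ᶜ) := by
    intro i j hij
    refine add_mem (rename_mem_supp hinl _) (sum_mem fun x _ => mul_mem (X_mem_supp ?_)
      (pow_mem (X_mem_supp (hinl x)) _))
    intro hx
    obtain ⟨i', j', h1, h2, h⟩ := (hWm _).1 hx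
    simp only [Sum.inr.injEq, Prod.mk.injEq] at h
    obtain ⟨rfl, rfl, rfl⟩ := h
    tauto
  have hδ0 : ((Mgen N A).submatrix f g).det ∈ supported K ((W : Set _)ᶜ) :=
    det_mem_subalgebra _ _ fun i j => hent _ _ (Or.inl ⟨i, rfl⟩)
  have key := height_lower ((W : Set _)ᶜ) P
    (((Mgen N A).submatrix f g).det * X (Sum.inl k) ^ N)
    (mul_mem hδ0 (pow_mem (X_mem_supp (hinl k)) _))
    (fun h => (hP.mem_or_mem h).elim hfg fun h => hk (hP.mem_of_pow_mem _ h)) ?_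
  · rw [compl_compl, Set.ncard_coe_finset, hWc] at key
    refine le_trans ?_ key
    exact_mod_cast Nat.mul_le_mul (by omega) (by omega)
  · intro w hw
    rw [Set.notMem_compl_iff, Finset.mem_coe, hWm] at hw
    obtain ⟨i, j, hi, hj, rfl⟩ := hw
    have hΔ := hall (Fin.cons i f) (Fin.cons j g)
    rw [det_bordered] at hΔ
    refine ⟨(rename Sum.inl (A i j) + ∑ x ∈ Finset.univ.erase k,
      X (Sum.inr (i, j, x)) * X (Sum.inl x) ^ N) * ((Mgen N A).submatrix f g).det +
        ∑ l, Mgen N A i (g l) * bw (Mgen N A) f g j l, ?_, ?_⟩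
    · refine add_mem (mul_mem (add_mem (rename_mem_supp hinl _) (sum_mem fun x hx =>
        mul_mem (X_mem_supp ?_) (pow_mem (X_mem_supp (hinl x)) _))) hδ0)
        (sum_mem fun l _ => mul_mem (hent _ _ (Or.inr ⟨l, rfl⟩)) ?_)
      · intro hx'
        obtain ⟨i', j', h1, h2, h⟩ := (hWm _).1 hx'
        simp only [Sum.inr.injEq, Prod.mk.injEq] at h
        exact (Finset.mem_erase.1 hx).1 h.2.2.symm
      · exact mul_mem (pow_mem (neg_mem (one_mem _)) _)
          (det_mem_subalgebra _ _ fun i j => hent _ _ (Or.inl ⟨i, rfl⟩))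
    · convert hΔ using 1
      rw [← add_assoc]
      congr 1
      have : Mgen N A i j = rename Sum.inl (A i j) + ∑ x ∈ Finset.univ.erase k,
          X (Sum.inr (i, j, x)) * X (Sum.inl x) ^ N +
            X (Sum.inr (i, j, k)) * X (Sum.inl k) ^ N := by
        rw [add_assoc, Finset.sum_erase_add _ _ (Finset.mem_univ k)]; rfl
      rw [this]; ring

lemma certificate {K : Type*} [Field K] {s m n : ℕ} (N : ℕ)
    (A : Matrix (Fin m) (Fin n) (MvPolynomial (Fin s) K)) (t : ℕ) (htn : t ≤ n) (hnm : n ≤ m)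
    (T : Finset (Fin s)) (hT : s < T.card + min s ((m - t + 1) * (n - t + 1))) :
    ∃ G : MvPolynomial (Fin s ⊕ (Fin m × Fin n × Fin s)) K, G ≠ 0 ∧ G ∈ detIdeal t (Mgen N A) ∧
      G ∈ supported K (Sum.inl '' (T : Set (Fin s)) ∪ Set.range Sum.inr) := by
  classical
  by_contra hc
  push Not at hc
  set V : Set (Fin s ⊕ (Fin m × Fin n × Fin s)) :=
    Sum.inl '' (T : Set (Fin s)) ∪ Set.range Sum.inr with hV
  let Q : Submonoid (MvPolynomial (Fin s ⊕ (Fin m × Fin n × Fin s)) K) :=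
    (supported K V).toSubmonoid ⊓ nonZeroDivisors _
  have hQ : ∀ x, x ∈ Q ↔ x ∈ supported K V ∧ x ≠ 0 := by
    intro x
    simp only [Q, Submonoid.mem_inf, mem_nonZeroDivisors_iff_ne_zero]
    rfl
  have hdis : Disjoint (detIdeal t (Mgen N A) : Set _)
      (Q : Set (MvPolynomial (Fin s ⊕ (Fin m × Fin n × Fin s)) K)) := by
    rw [Set.disjoint_left]
    intro x hx hx'
    obtain ⟨h1, h2⟩ := (hQ x).1 hx'
    exact hc x h2 hx h1
  obtain ⟨P, hP, hle, hPd⟩ := Ideal.exists_le_prime_disjoint _ _ hdis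
  have hup := height_upper V P (fun f hf hfs => by
    by_contra h0
    exact Set.disjoint_left.1 hPd hf ((hQ f).2 ⟨hfs, h0⟩))
  have hVc : Vᶜ = ((Tᶜ.image Sum.inl : Finset (Fin s ⊕ (Fin m × Fin n × Fin s))) : Set _) := by
    ext w
    rcases w with w | w <;> simp [hV]
  rw [hVc, Set.ncard_coe_finset, Finset.card_image_of_injective _ Sum.inl_injective,
    Finset.card_compl, Fintype.card_fin] at hup
  have hTs : T.card ≤ s := by simpa using T.card_le_univ
  have hne : T.Nonempty := by
    rw [← Finset.card_pos]; omega
  obtain ⟨k, hk⟩ := hne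
  have hlow := generic_lower N A t htn hnm P hP hle k (fun h => by
    refine Set.disjoint_left.1 hPd h ((hQ _).2 ⟨X_mem_supp (Or.inl ⟨k, hk, rfl⟩), X_ne_zero _⟩))
  have := hlow.trans hup
  have : (m - t + 1) * (n - t + 1) ≤ s - T.card := by exact_mod_cast this
  have h3 := min_le_right s ((m - t + 1) * (n - t + 1))
  omega

/-- Specialization of the parameters. -/
noncomputable def sp {K : Type*} [CommRing K] {s : ℕ} {ι : Type*} (a : ι → K) :
    MvPolynomial (Fin s ⊕ ι) K →ₐ[K] MvPolynomial (Fin s) K :=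
  aeval (Sum.elim X fun i => C (a i))

lemma sp_eq {K : Type*} [CommRing K] {s : ℕ} {ι : Type*} (a : ι → K)
    (G : MvPolynomial (Fin s ⊕ ι) K) :
    sp a G = map (eval a) (sumAlgEquiv K (Fin s) ι G) := by
  induction G using MvPolynomial.induction_on with
  | C c => simp [sp]
  | add p q hp hq => simp [hp, hq]
  | mul_X p i hp =>
    rw [map_mul, hp, map_mul, map_mul]
    congr 1
    rcases i with i | i <;> simp [sp]

lemma exists_coeff {K : Type*} [CommRing K] {s : ℕ} {ι : Type*}
    (G : MvPolynomial (Fin s ⊕ ι) K) (hG : G ≠ 0) :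
    ∃ F : MvPolynomial ι K, F ≠ 0 ∧ ∀ a, eval a F ≠ 0 → sp a G ≠ 0 := by
  have : sumAlgEquiv K (Fin s) ι G ≠ 0 := by simpa using hG
  obtain ⟨d, hd⟩ := MvPolynomial.ne_zero_iff.1 this
  refine ⟨_, hd, fun a ha h0 => ha ?_⟩
  rw [sp_eq] at h0
  rw [← coeff_map, h0, coeff_zero]

lemma sp_supp {K : Type*} [CommRing K] {s : ℕ} {ι : Type*} (a : ι → K) (T : Set (Fin s))
    (G : MvPolynomial (Fin s ⊕ ι) K) (hG : G ∈ supported K (Sum.inl '' T ∪ Set.range Sum.inr)) :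
    sp a G ∈ supported K T := by
  have : supported K (Sum.inl '' T ∪ Set.range Sum.inr) ≤ (supported K T).comap (sp a) := by
    refine Algebra.adjoin_le ?_
    rintro _ ⟨w, (⟨x, hx, rfl⟩ | ⟨x, rfl⟩), rfl⟩
    · simpa [sp] using X_mem_supp hx
    · simpa [sp] using Subalgebra.algebraMap_mem (supported K T) (a x)
  exact this hG

/-- The perturbed matrix. -/
noncomputable def Ma {K : Type*} [CommRing K] {s m n : ℕ} (N : ℕ)
    (A : Matrix (Fin m) (Fin n) (MvPolynomial (Fin s) K)) (a : Fin m × Fin n × Fin s → K) :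
    Matrix (Fin m) (Fin n) (MvPolynomial (Fin s) K) :=
  A + Matrix.of fun i j => ∑ k : Fin s, C (a (i, j, k)) * X k ^ N

lemma sp_detIdeal {K : Type*} [CommRing K] {s m n : ℕ} (N : ℕ)
    (A : Matrix (Fin m) (Fin n) (MvPolynomial (Fin s) K)) (a : Fin m × Fin n × Fin s → K) (t : ℕ)
    (G : MvPolynomial (Fin s ⊕ (Fin m × Fin n × Fin s)) K) (hG : G ∈ detIdeal t (Mgen N A)) :
    sp a G ∈ detIdeal t (Ma N A a) := by
  have hM : (Mgen N A).map (sp a).toRingHom = Ma N A a := by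
    ext1 i j
    have h : sp a (rename Sum.inl (A i j)) = A i j := by
      unfold sp
      rw [aeval_rename]
      exact aeval_X_left_apply (A i j)
    simp only [Mgen, Ma, Matrix.map_apply, Matrix.of_apply, Matrix.add_apply]
    change sp a _ = _
    rw [map_add, h]
    simp [sp]
  have : detIdeal t (Mgen N A) ≤ (detIdeal t (Ma N A a)).comap (sp a).toRingHom := by
    refine detIdeal_le fun f g => ?_
    rw [Ideal.mem_comap, map_minor, hM]
    exact minor_mem _ _ _
  exact this hG

lemma lower_bound {K : Type*} [Field K] {s m n : ℕ} (N : ℕ)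
    (A : Matrix (Fin m) (Fin n) (MvPolynomial (Fin s) K)) (a : Fin m × Fin n × Fin s → K) (t : ℕ)
    (h : ∀ T : Finset (Fin s), s < T.card + min s ((m - t + 1) * (n - t + 1)) →
      ∃ G : MvPolynomial (Fin s) K, G ≠ 0 ∧ G ∈ detIdeal t (Ma N A a) ∧
        G ∈ supported K (T : Set (Fin s))) :
    ((min s ((m - t + 1) * (n - t + 1)) : ℕ) : ℕ∞) ≤ idealHeight (detIdeal t (Ma N A a)) := by
  refine le_iInf₂ fun p hp => ?_
  rw [← PrimeSpectrum.height_eq_orderHeight]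
  by_contra hlt
  push Not at hlt
  obtain ⟨T, hT1, hT2⟩ := exists_indep s p.asIdeal p.isPrime
  lift p.asIdeal.height to ℕ using hlt.ne_top with c hc
  have h1 : c < min s ((m - t + 1) * (n - t + 1)) := by exact_mod_cast hlt
  have h2 : s ≤ T.card + c := by exact_mod_cast hT2
  obtain ⟨G, hG0, hG1, hG2⟩ := h T (by omega)
  exact hG0 (hT1 G (hp hG1) hG2)

lemma upper_bound {K : Type*} [Field K] {s m n : ℕ} (N : ℕ) (hN : 1 ≤ N)
    (A : Matrix (Fin m) (Fin n) (MvPolynomial (Fin s) K))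
    (hA : ∀ i j, A i j ∈ Ideal.span (Set.range (X : Fin s → MvPolynomial (Fin s) K)))
    (a : Fin m × Fin n × Fin s → K) (t : ℕ) (ht : 1 ≤ t) (htn : t ≤ n) (hnm : n ≤ m) :
    idealHeight (detIdeal t (Ma N A a)) ≤ ((min s ((m - t + 1) * (n - t + 1)) : ℕ) : ℕ∞) := by
  obtain ⟨t, rfl⟩ : ∃ u, t = u + 1 := ⟨t - 1, by omega⟩
  let 𝔪 : Ideal (MvPolynomial (Fin s) K) := RingHom.ker (constantCoeff (R := K) (σ := Fin s))
  have hm : 𝔪.IsPrime := RingHom.ker_isPrime _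
  have hspan : Ideal.span (Set.range (X : Fin s → MvPolynomial (Fin s) K)) ≤ 𝔪 := by
    rw [Ideal.span_le]
    rintro _ ⟨i, rfl⟩
    simp [𝔪, RingHom.mem_ker]
  have hent : ∀ i j, Ma N A a i j ∈ 𝔪 := by
    intro i j
    refine 𝔪.add_mem (hspan (hA i j)) ?_
    rw [Matrix.of_apply]
    refine 𝔪.sum_mem fun k _ => 𝔪.mul_mem_left _ ?_
    exact Ideal.pow_mem_of_mem _ (hspan (Ideal.subset_span ⟨k, rfl⟩)) _ (by omega)
  have hle : detIdeal (t + 1) (Ma N A a) ≤ 𝔪 := by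
    refine detIdeal_le fun f g => ?_
    rw [Matrix.det_succ_row_zero]
    exact 𝔪.sum_mem fun k _ => 𝔪.mul_mem_right _ (𝔪.mul_mem_left _ (hent _ _))
  have hbd : ∀ P : Ideal (MvPolynomial (Fin s) K), P.IsPrime → detIdeal (t + 1) (Ma N A a) ≤ P →
      idealHeight (detIdeal (t + 1) (Ma N A a)) ≤ P.height := by
    intro P hP hPle
    have := PrimeSpectrum.height_eq_orderHeight (⟨P, hP⟩ : PrimeSpectrum _)
    change P.height = _ at this
    rw [this]
    exact iInf₂_le (⟨P, hP⟩ : PrimeSpectrum (MvPolynomial (Fin s) K)) hPle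
  have h1 : idealHeight (detIdeal (t + 1) (Ma N A a)) ≤ (s : ℕ∞) := by
    refine (hbd 𝔪 hm hle).trans ?_
    have := height_upper (∅ : Set (Fin s)) 𝔪 (fun f hf hs => by
      rw [supported_empty, Algebra.mem_bot] at hs
      obtain ⟨c, rfl⟩ := hs
      have hc : constantCoeff (algebraMap K (MvPolynomial (Fin s) K) c) = 0 := hf
      rw [MvPolynomial.algebraMap_eq, constantCoeff_C] at hc
      rw [hc, map_zero])
    simpa [Set.ncard_univ] using this
  have h2 : idealHeight (detIdeal (t + 1) (Ma N A a)) ≤ ((m - t) * (n - t) : ℕ) := by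
    obtain ⟨P, hP, hPm⟩ := Ideal.exists_minimalPrimes_le hle
    exact (hbd P hP.1.1 hP.1.2).trans
      (eagon_northcott _ P (by omega) (by omega) hP)
  rw [show m - (t + 1) + 1 = m - t by omega, show n - (t + 1) + 1 = n - t by omega]
  rcases min_choice s ((m - t) * (n - t)) with h | h <;> rw [h] <;> assumption

end GenPert

/-- For an `m × n` matrix `A` over `K[x_1,…,x_s]` (`n ≤ m`) with entries in
`⟨x_1,…,x_s⟩`, and the generic perturbation `B_a` with entries `∑_k a_{ijk} x_k^N`,
for generic `a` the determinantal ideals `I_t(A + B_a)` have the expected height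
`min {s, (m−t+1)(n−t+1)}` for all `t = 1, …, n`. -/
theorem height_detIdeal_generic_perturbation
    {K : Type*} [Field K] [Infinite K] {s m n : ℕ}
    (hs : 0 < s) (hm : 0 < m) (hn : 0 < n) (hnm : n ≤ m) (N : ℕ) (hN : 1 ≤ N)
    (A : Matrix (Fin m) (Fin n) (MvPolynomial (Fin s) K))
    (hA : ∀ i j, A i j ∈ Ideal.span (Set.range (MvPolynomial.X : Fin s → MvPolynomial (Fin s) K))) :
    ∃ U : Set (Fin m × Fin n × Fin s → K), ZariskiOpen U ∧ U.Nonempty ∧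
      ∀ a ∈ U, ∀ t : ℕ, 1 ≤ t → t ≤ n →
        idealHeight (detIdeal t (A + Matrix.of fun i j =>
            ∑ k : Fin s, MvPolynomial.C (a (i, j, k)) * MvPolynomial.X k ^ N))
          = (min s ((m - t + 1) * (n - t + 1)) : ℕ∞) := by
  classical
  have hF : ∀ (t : ℕ) (T : Finset (Fin s)), ∃ F : MvPolynomial (Fin m × Fin n × Fin s) K, F ≠ 0 ∧
      (t ≤ n → s < T.card + min s ((m - t + 1) * (n - t + 1)) → ∀ a, MvPolynomial.eval a F ≠ 0 →
        ∃ G : MvPolynomial (Fin s) K, G ≠ 0 ∧ G ∈ detIdeal t (GenPert.Ma N A a) ∧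
          G ∈ MvPolynomial.supported K (T : Set (Fin s))) := by
    intro t T
    by_cases h : t ≤ n ∧ s < T.card + min s ((m - t + 1) * (n - t + 1))
    · obtain ⟨G, hG0, hG1, hG2⟩ := GenPert.certificate N A t h.1 hnm T h.2
      obtain ⟨F, hF0, hF1⟩ := GenPert.exists_coeff G hG0
      exact ⟨F, hF0, fun _ _ a ha => ⟨GenPert.sp a G, hF1 a ha, GenPert.sp_detIdeal N A a t G hG1,
        GenPert.sp_supp a _ G hG2⟩⟩
    · exact ⟨1, one_ne_zero, fun h1 h2 => absurd ⟨h1, h2⟩ h⟩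
  choose F hF0 hF1 using hF
  let D : MvPolynomial (Fin m × Fin n × Fin s) K :=
    ∏ t ∈ Finset.Icc 1 n, ∏ T : Finset (Fin s), F t T
  have hD : D ≠ 0 := Finset.prod_ne_zero_iff.2 fun t _ => Finset.prod_ne_zero_iff.2 fun T _ =>
    hF0 t T
  refine ⟨{a | MvPolynomial.eval a D ≠ 0}, ⟨{D}, by simp⟩, ?_, ?_⟩
  · by_contra hne
    rw [Set.not_nonempty_iff_eq_empty, Set.eq_empty_iff_forall_notMem] at hne
    refine hD (MvPolynomial.funext fun a => ?_)
    simpa using hne a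
  · intro a ha t ht htn
    have hcast : (min s ((m - t + 1) * (n - t + 1)) : ℕ∞) =
        ((min s ((m - t + 1) * (n - t + 1)) : ℕ) : ℕ∞) := by
      push_cast [ENat.natCast_sub]
      rfl
    rw [hcast]
    refine le_antisymm (GenPert.upper_bound N hN A hA a t ht htn hnm)
      (GenPert.lower_bound N A a t fun T hT => hF1 t T htn hT a ?_)
    intro h0
    refine ha ?_
    simp only [D, map_prod]
    exact Finset.prod_eq_zero (Finset.mem_Icc.2 ⟨ht, htn⟩)
      (Finset.prod_eq_zero (Finset.mem_univ T) h0)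
end

section
/- Let K be an infinite field, s, m, n positive integers with n ≤ m, and A = [f_ij] an m×n matrix with entries f_ij ∈ ⟨x_1,…,x_s⟩·K[x_1,…,x_s]. Fix an integer N ≥ 1 and for a = (a_ijk) ∈ K^{mns} let B_a = [g_ij] with g_ij = Σ_{k=1}^s a_ijk·x_k^N. Then for generic a ∈ K^{mns} and every t ∈ {1,…,n} with (m−t+1)(n−t+1) < s, the quotient ring K[x_1,…,x_s]/I_t(A + B_a) is Cohen–Macaulay. -/
/-- The depth of a local ring: the supremum of the lengths of regular sequences
contained in the maximal ideal. -/
noncomputable def localDepth (A : Type*) [CommRing A] [IsLocalRing A] : ℕ∞ :=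
  ⨆ (rs : List A) (_ : ∀ r ∈ rs, r ∈ IsLocalRing.maximalIdeal A)
    (_ : RingTheory.Sequence.IsRegular A rs), (rs.length : ℕ∞)

/-- A commutative ring is Cohen–Macaulay if for every maximal ideal the localization
has depth equal to its Krull dimension. -/
def IsCohenMacaulayRing (A : Type*) [CommRing A] : Prop :=
  ∀ (p : Ideal A) (hp : p.IsMaximal),
    haveI : p.IsPrime := hp.isPrime
    (localDepth (Localization.AtPrime p) : WithBot ℕ∞) = ringKrullDim (Localization.AtPrime p)

namespace DetCM
open CategoryTheory CategoryTheory.Abelian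

universe u

/-- `Dep 𝔐 d M`: the groups `Ext^i(R/𝔐, M)` vanish for `i < d`. -/
def Dep {R : Type u} [CommRing R] (𝔐 : Ideal R) (d : ℕ) (M : Type u) [AddCommGroup M]
    [Module R M] : Prop :=
  ∀ i < d, Subsingleton (Ext (ModuleCat.of R (R ⧸ 𝔐)) (ModuleCat.of R M) i)

section
variable {R : Type u} [CommRing R] {𝔐 : Ideal R}
variable {M M₁ M₂ M₃ : Type u} [AddCommGroup M] [Module R M] [AddCommGroup M₁] [Module R M₁]
  [AddCommGroup M₂] [Module R M₂] [AddCommGroup M₃] [Module R M₃]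

theorem Dep.mono {d e : ℕ} (h : Dep 𝔐 d M) (hed : e ≤ d) : Dep 𝔐 e M :=
  fun i hi => h i (hi.trans_le hed)

theorem dep_ses {d : ℕ} (f : M₁ →ₗ[R] M₂) (g : M₂ →ₗ[R] M₃)
    (hf : Function.Injective f) (hfg : Function.Exact f g) (hg : Function.Surjective g)
    (h₂ : Dep 𝔐 (d + 1) M₂) (h₃ : Dep 𝔐 d M₃) : Dep 𝔐 (d + 1) M₁ := by
  intro i hi
  let S : ShortComplex (ModuleCat.{u} R) :=
    ModuleCat.shortComplexOfCompEqZero f g hfg.linearMap_comp_eq_zero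
  have hS : S.ShortExact := ModuleCat.shortComplex_shortExact S hfg hf hg
  have hm : Mono S.f := hS.mono_f
  refine subsingleton_of_forall_eq 0 fun x => ?_
  have := h₂ i hi
  have hx : x.comp (Ext.mk₀ S.f) (add_zero i) = 0 := @Subsingleton.elim _ this _ _
  rcases i with _ | i
  · apply Ext.postcomp_mk₀_injective_of_mono _ S.f
    exact @Subsingleton.elim _ this _ _
  · obtain ⟨y, hy⟩ := Ext.covariant_sequence_exact₁ _ hS x hx rfl
    have h3 := h₃ i (by omega)
    have : y = 0 := @Subsingleton.elim _ h3 _ _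
    rw [← hy, this]; simp

theorem dep_mid {d : ℕ} (f : M₁ →ₗ[R] M₂) (g : M₂ →ₗ[R] M₃)
    (hf : Function.Injective f) (hfg : Function.Exact f g) (hg : Function.Surjective g)
    (h₁ : Dep 𝔐 d M₁) (h₃ : Dep 𝔐 d M₃) : Dep 𝔐 d M₂ := by
  intro i hi
  let S : ShortComplex (ModuleCat.{u} R) :=
    ModuleCat.shortComplexOfCompEqZero f g hfg.linearMap_comp_eq_zero
  have hS : S.ShortExact := ModuleCat.shortComplex_shortExact S hfg hf hg
  refine subsingleton_of_forall_eq 0 fun x => ?_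
  have h3 := h₃ i hi
  obtain ⟨y, hy⟩ := Ext.covariant_sequence_exact₂ _ hS x (@Subsingleton.elim _ h3 _ _)
  have h1 := h₁ i hi
  have : y = 0 := @Subsingleton.elim _ h1 _ _
  rw [← hy, this]; simp

theorem dep_equiv {d : ℕ} (e : M₁ ≃ₗ[R] M₂) (h : Dep 𝔐 d M₁) : Dep 𝔐 d M₂ := by
  intro i hi
  refine subsingleton_of_forall_eq 0 fun x => ?_
  have h1 := h i hi
  have hy : x.comp (Ext.mk₀ (ModuleCat.ofHom (e.symm : M₂ →ₗ[R] M₁))) (add_zero i) = 0 :=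
    @Subsingleton.elim _ h1 _ _
  have h2 : x = (x.comp (Ext.mk₀ (ModuleCat.ofHom (e.symm : M₂ →ₗ[R] M₁))) (add_zero i)).comp
      (Ext.mk₀ (ModuleCat.ofHom (e : M₁ →ₗ[R] M₂))) (add_zero i) := by
    have h3 : ModuleCat.ofHom (e.symm : M₂ →ₗ[R] M₁) ≫ ModuleCat.ofHom (e : M₁ →ₗ[R] M₂) =
      𝟙 (ModuleCat.of R M₂) := by ext y; simp
    rw [Ext.comp_assoc_of_third_deg_zero, Ext.mk₀_comp_mk₀, h3, Ext.comp_mk₀_id]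
  rw [h2, hy]; simp

theorem dep_smul {d : ℕ} {x : R} (hx : x ∈ 𝔐) (hreg : IsSMulRegular M x) (g : M →ₗ[R] M₃)
    (hfg : Function.Exact (LinearMap.lsmul R M x) g) (hg : Function.Surjective g)
    (h₃ : Dep 𝔐 d M₃) : Dep 𝔐 (d + 1) M := by
  intro i hi
  let S : ShortComplex (ModuleCat.{u} R) :=
    ModuleCat.shortComplexOfCompEqZero (LinearMap.lsmul R M x) g hfg.linearMap_comp_eq_zero
  have hS : S.ShortExact := ModuleCat.shortComplex_shortExact S hfg hreg hg
  have hm : Mono S.f := hS.mono_f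
  have hSf : S.f = x • 𝟙 (ModuleCat.of R M) := rfl
  refine subsingleton_of_forall_eq 0 fun y => ?_
  have hann : x ∈ Module.annihilator R (R ⧸ 𝔐) := by rwa [Ideal.annihilator_quotient]
  have hy : y.comp (Ext.mk₀ S.f) (add_zero i) = 0 := by
    have := congrArg (fun φ => φ.hom y) (Ext.postcomp_smul_id_eq_zero_of_mem_annihilator
      (M := ModuleCat.of R M) (N := ModuleCat.of R (R ⧸ 𝔐)) hann i)
    exact this
  rcases i with _ | i
  · apply Ext.postcomp_mk₀_injective_of_mono _ S.f
    rw [map_zero]; exact hy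
  · obtain ⟨y', hy'⟩ := Ext.covariant_sequence_exact₁ _ hS y hy rfl
    have h3 := h₃ i (by omega)
    have : y' = 0 := @Subsingleton.elim _ h3 _ _
    rw [← hy', this]; simp

/-- quotient by one more element -/
theorem dep_quot_sup_span {d : ℕ} {I : Ideal R} {x : R} (hx : x ∈ 𝔐)
    (hreg : ∀ f, x * f ∈ I → f ∈ I) (h : Dep 𝔐 d (R ⧸ (I ⊔ Ideal.span {x}))) :
    Dep 𝔐 (d + 1) (R ⧸ I) := by
  have hle : I ≤ I ⊔ Ideal.span {x} := le_sup_left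
  refine dep_smul (x := x) hx ?_ (Submodule.factor hle) ?_ (Submodule.factor_surjective hle) h
  · refine isSMulRegular_iff_right_eq_zero_of_smul.2 ?_
    intro f
    obtain ⟨f, rfl⟩ := Ideal.Quotient.mk_surjective f
    intro hf
    rw [Algebra.smul_def, Ideal.Quotient.algebraMap_eq, ← map_mul,
      Ideal.Quotient.eq_zero_iff_mem] at hf
    exact Ideal.Quotient.eq_zero_iff_mem.2 (hreg f hf)
  · intro y
    obtain ⟨f, rfl⟩ := Ideal.Quotient.mk_surjective y
    have h1 : (Submodule.factor hle) (Ideal.Quotient.mk I f) = 0 ↔ f ∈ I ⊔ Ideal.span {x} := by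
      rw [← Ideal.Quotient.eq_zero_iff_mem]; rfl
    rw [h1, Submodule.mem_sup]
    constructor
    · rintro ⟨i, hi, j, hj, hij⟩
      obtain ⟨c, rfl⟩ := Ideal.mem_span_singleton'.1 hj
      refine ⟨Ideal.Quotient.mk I c, ?_⟩
      rw [LinearMap.lsmul_apply, Algebra.smul_def, Ideal.Quotient.algebraMap_eq, ← map_mul,
        Ideal.Quotient.eq]
      have : x * c - f = -i := by linear_combination hij
      rw [this]; exact I.neg_mem hi
    · rintro ⟨y, hy⟩
      obtain ⟨c, rfl⟩ := Ideal.Quotient.mk_surjective y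
      rw [LinearMap.lsmul_apply, Algebra.smul_def, Ideal.Quotient.algebraMap_eq, ← map_mul,
        Ideal.Quotient.eq] at hy
      exact ⟨f - x * c, by simpa using I.neg_mem hy, x * c,
        Ideal.mul_mem_right _ _ (Ideal.mem_span_singleton_self x), by ring⟩

theorem dep_inf {d : ℕ} {I J : Ideal R} (hI : Dep 𝔐 (d + 1) (R ⧸ I)) (hJ : Dep 𝔐 (d + 1) (R ⧸ J))
    (hIJ : Dep 𝔐 d (R ⧸ (I ⊔ J))) : Dep 𝔐 (d + 1) (R ⧸ (I ⊓ J)) := by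
  have hprod : Dep 𝔐 (d + 1) ((R ⧸ I) × (R ⧸ J)) := 
    dep_mid (LinearMap.inl R _ _) (LinearMap.snd R _ _) LinearMap.inl_injective
      Function.Exact.inl_snd LinearMap.snd_surjective hI hJ
  let f : (R ⧸ (I ⊓ J)) →ₗ[R] (R ⧸ I) × (R ⧸ J) :=
    (Submodule.factor (inf_le_left : I ⊓ J ≤ I)).prod (Submodule.factor (inf_le_right : I ⊓ J ≤ J))
  let g : (R ⧸ I) × (R ⧸ J) →ₗ[R] (R ⧸ (I ⊔ J)) :=
    (Submodule.factor (le_sup_left : I ≤ I ⊔ J)).comp (LinearMap.fst R _ _) -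
    (Submodule.factor (le_sup_right : J ≤ I ⊔ J)).comp (LinearMap.snd R _ _)
  have hfa : ∀ a, f (Ideal.Quotient.mk _ a) = (Ideal.Quotient.mk _ a, Ideal.Quotient.mk _ a) :=
    fun _ => rfl
  have hga : ∀ a b, g (Ideal.Quotient.mk _ a, Ideal.Quotient.mk _ b) =
    Ideal.Quotient.mk _ (a - b) := fun _ _ => rfl
  refine dep_ses f g ?_ ?_ ?_ hprod hIJ
  · rw [injective_iff_map_eq_zero]
    intro y
    obtain ⟨a, rfl⟩ := Ideal.Quotient.mk_surjective y
    rw [hfa]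
    intro h
    rw [Prod.mk_eq_zero, Ideal.Quotient.eq_zero_iff_mem, Ideal.Quotient.eq_zero_iff_mem] at h
    exact Ideal.Quotient.eq_zero_iff_mem.2 h
  · rintro ⟨y, z⟩
    obtain ⟨a, rfl⟩ := Ideal.Quotient.mk_surjective y
    obtain ⟨b, rfl⟩ := Ideal.Quotient.mk_surjective z
    rw [hga, Ideal.Quotient.eq_zero_iff_mem, Submodule.mem_sup]
    constructor
    · rintro ⟨i, hi, j, hj, hij⟩
      refine ⟨Ideal.Quotient.mk _ (a - i), ?_⟩
      rw [hfa, Prod.mk.injEq, Ideal.Quotient.eq, Ideal.Quotient.eq]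
      refine ⟨by simpa using hi, ?_⟩
      have : a - i - b = j := by linear_combination -hij
      rwa [this]
    · rintro ⟨y, hy⟩
      obtain ⟨c, rfl⟩ := Ideal.Quotient.mk_surjective y
      rw [hfa, Prod.mk.injEq, Ideal.Quotient.eq, Ideal.Quotient.eq] at hy
      exact ⟨a - c, by simpa using I.neg_mem hy.1, c - b, hy.2, by ring⟩
  · intro y
    obtain ⟨a, rfl⟩ := Ideal.Quotient.mk_surjective y
    exact ⟨(Ideal.Quotient.mk _ a, Ideal.Quotient.mk _ 0), by rw [hga, sub_zero]⟩

theorem exists_regular_of_dep [IsNoetherianRing R] {d : ℕ} [Module.Finite R M]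
    (hlt : 𝔐 • (⊤ : Submodule R M) < ⊤) (h : Dep 𝔐 d M) :
    ∃ rs : List R, rs.length = d ∧ (∀ r ∈ rs, r ∈ 𝔐) ∧ RingTheory.Sequence.IsRegular M rs := by
  refine ModuleCat.exists_isRegular_of_exists_subsingleton_ext 𝔐 d (ModuleCat.of R M) hlt
    (ModuleCat.of R (R ⧸ 𝔐)) ?_ h
  rw [Module.support_eq_zeroLocus, Ideal.annihilator_quotient]

theorem dep_of_regular [IsNoetherianRing R] [Module.Finite R M]
    (hlt : 𝔐 • (⊤ : Submodule R M) < ⊤) (rs : List R) (hmem : ∀ r ∈ rs, r ∈ 𝔐)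
    (hreg : RingTheory.Sequence.IsRegular M rs) : Dep 𝔐 rs.length M := by
  refine ModuleCat.subsingleton_ext_of_exists_isRegular 𝔐 (ModuleCat.of R (R ⧸ 𝔐)) ?_
    (ModuleCat.of R M) hlt rs hmem hreg
  rw [Module.support_eq_zeroLocus, Ideal.annihilator_quotient]
end
end DetCM

namespace DetCM
open MvPolynomial

section linalg
variable {F : Type*} [Field F] {m c : ℕ}

/-- span of the columns with index `< j` -/
def colSpan (B : Matrix (Fin m) (Fin c) F) (j : ℕ) : Submodule F (Fin m → F) :=
  Submodule.span F (B.col '' {k | k.val < j})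

theorem colSpan_mono (B : Matrix (Fin m) (Fin c) F) {j k : ℕ} (h : j ≤ k) :
    colSpan B j ≤ colSpan B k :=
  Submodule.span_mono (Set.image_mono fun _ hx => lt_of_lt_of_le hx h)

theorem col_mem_colSpan (B : Matrix (Fin m) (Fin c) F) {j : ℕ} {k : Fin c} (h : k.val < j) :
    B.col k ∈ colSpan B j :=
  Submodule.subset_span ⟨k, h, rfl⟩

theorem minor_eq_zero_of_finrank {B : Matrix (Fin m) (Fin c) F} {j r : ℕ}
    (h : Module.finrank F (colSpan B j) ≤ r) (f : Fin (r + 1) → Fin m) (g : Fin (r + 1) → Fin c)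
    (hg : ∀ k, (g k).val < j) : (B.submatrix f g).det = 0 := by
  by_contra hne
  have hli : LinearIndependent F (B.submatrix f g).col :=
    Matrix.linearIndependent_cols_of_det_ne_zero hne
  have h2 : LinearIndependent F (fun k => B.col (g k)) := by
    refine LinearIndependent.of_comp (LinearMap.funLeft F F f) ?_
    exact hli
  have h3 : LinearIndependent F (fun k => (⟨B.col (g k), col_mem_colSpan B (hg k)⟩ : colSpan B j)) := by
    refine LinearIndependent.of_comp (colSpan B j).subtype ?_
    exact h2
  have := h3.fintype_card_le_finrank
  simp at this
  omega

theorem exists_minor_of_rank {r : ℕ} (B : Matrix (Fin m) (Fin r) F) (h : LinearIndependent F B.col) :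
    ∃ f : Fin r → Fin m, (B.submatrix f id).det ≠ 0 := by
  have h1 : B.rank = r := by
    rw [Matrix.rank_eq_finrank_span_cols, finrank_span_eq_card h]; simp
  rw [Matrix.rank_eq_finrank_span_row] at h1
  obtain ⟨f, hf1, hf2, hf3⟩ := Submodule.exists_fun_fin_finrank_span_eq F (Set.range B.row)
  choose q hq using hf1
  refine ⟨q ∘ Fin.cast h1.symm, ?_⟩
  have h5 := hf3.comp (Fin.cast h1.symm) (Fin.cast_injective _)
  have h6 : f ∘ Fin.cast h1.symm = (B.submatrix (q ∘ Fin.cast h1.symm) id).row := by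
    ext i j
    exact congrFun (hq _).symm j
  rw [h6] at h5
  rw [Matrix.linearIndependent_rows_iff_isUnit, Matrix.isUnit_iff_isUnit_det] at h5
  exact h5.ne_zero

theorem finrank_le_of_minor {B : Matrix (Fin m) (Fin c) F} {j r : ℕ}
    (h : ∀ (f : Fin (r + 1) → Fin m) (g : Fin (r + 1) → Fin c),
      (∀ k, (g k).val < j) → (B.submatrix f g).det = 0) :
    Module.finrank F (colSpan B j) ≤ r := by
  by_contra! hlt
  obtain ⟨f, hf1, hf2, hf3⟩ := Submodule.exists_fun_fin_finrank_span_eq F (B.col '' {k | k.val < j})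
  change r < Module.finrank F (colSpan B j) at hlt
  let e : Fin (r+1) → Fin (Module.finrank F (Submodule.span F (B.col '' {k | k.val < j}))) :=
    Fin.castLE hlt
  choose g hg1 hg2 using hf1
  have h4 : LinearIndependent F (B.submatrix id (g ∘ e)).col := by
    have := hf3.comp e (Fin.castLE_injective _)
    have h6 : f ∘ e = (B.submatrix id (g ∘ e)).col := by
      ext i k
      exact congrFun (hg2 (e i)).symm k
    rw [h6] at this
    exact this
  obtain ⟨q, hq⟩ := exists_minor_of_rank _ h4
  apply hq
  simpa using h q (g ∘ e) (fun k => hg1 _)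

theorem finrank_colSpan_le_iff {B : Matrix (Fin m) (Fin c) F} {j r : ℕ} :
    Module.finrank F (colSpan B j) ≤ r ↔ ∀ (f : Fin (r + 1) → Fin m) (g : Fin (r + 1) → Fin c),
      (∀ k, (g k).val < j) → (B.submatrix f g).det = 0 :=
  ⟨minor_eq_zero_of_finrank, finrank_le_of_minor⟩
end linalg

section ideals
variable {A : Type*} [CommRing A] {m c : ℕ}

/-- generic matrix -/
noncomputable def genM (A : Type*) [CommRing A] (m c : ℕ) :
    Matrix (Fin m) (Fin c) (MvPolynomial (Fin m × Fin c) A) :=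
  Matrix.of fun i j => X (i, j)

def rowSet (A : Type*) [CommRing A] (m c : ℕ) (i0 n : ℕ) : Set (MvPolynomial (Fin m × Fin c) A) :=
  {p | ∃ (i : Fin m) (j : Fin c), (i.val < i0 ∨ (i.val = i0 ∧ j.val < n)) ∧ p = X (i, j)}

def minorSet (A : Type*) [CommRing A] (m c : ℕ) (ρ : ℕ → ℕ) :
    Set (MvPolynomial (Fin m × Fin c) A) :=
  {p | ∃ (j : ℕ) (f : Fin (ρ j + 1) → Fin m) (g : Fin (ρ j + 1) → Fin c), (∀ k, (g k).val < j) ∧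
    p = ((genM A m c).submatrix f g).det}

noncomputable def Id (A : Type*) [CommRing A] (m c : ℕ) (i0 n : ℕ) (ρ : ℕ → ℕ) :
    Ideal (MvPolynomial (Fin m × Fin c) A) :=
  Ideal.span (rowSet A m c i0 n ∪ minorSet A m c ρ)

structure Good {F : Type*} [Field F] (i0 n : ℕ) (ρ : ℕ → ℕ) (B : Matrix (Fin m) (Fin c) F) : Prop where
  row : ∀ (i : Fin m) (j : Fin c), (i.val < i0 ∨ (i.val = i0 ∧ j.val < n)) → B i j = 0
  rk : ∀ j, Module.finrank F (colSpan B j) ≤ ρ j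

theorem kills_iff {F : Type*} [Field F] (i0 n : ℕ) (ρ : ℕ → ℕ) 
    (φ : MvPolynomial (Fin m × Fin c) A →+* F) :
    Id A m c i0 n ρ ≤ RingHom.ker φ ↔ 
      Good i0 n ρ (Matrix.of fun (i : Fin m) (j : Fin c) => φ (X (i, j))) := by
  have key : ∀ {k : ℕ} (f : Fin k → Fin m) (g : Fin k → Fin c), 
      φ (((genM A m c).submatrix f g).det) = 
        ((Matrix.of fun (i : Fin m) (j : Fin c) => φ (X (i, j))).submatrix f g).det := by
    intro k f g
    rw [RingHom.map_det]
    rfl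
  rw [Id, Ideal.span_le]
  constructor
  · intro h
    refine ⟨fun i j hij => h (Or.inl ⟨i, j, hij, rfl⟩), fun j => finrank_le_of_minor ?_⟩
    intro f g hg
    rw [← key]
    exact h (Or.inr ⟨j, f, g, hg, rfl⟩)
  · rintro ⟨h1, h2⟩ p (⟨i, j, hij, rfl⟩ | ⟨j, f, g, hg, rfl⟩)
    · exact h1 i j hij
    · change φ _ = 0
      rw [key]
      exact minor_eq_zero_of_finrank (h2 j) f g hg
end ideals

section nzd
variable {A : Type*} [CommRing A] {m c : ℕ} {F : Type*} [Field F] 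

/-- evaluation at a matrix -/
noncomputable def evM (α : A →+* F) (B : Matrix (Fin m) (Fin c) F) :
    MvPolynomial (Fin m × Fin c) A →+* F :=
  eval₂Hom α (fun p => B p.1 p.2)

theorem evM_kills (α : A →+* F) (B : Matrix (Fin m) (Fin c) F) {i0 n : ℕ} {ρ : ℕ → ℕ} :
    Id A m c i0 n ρ ≤ RingHom.ker (evM α B) ↔ Good i0 n ρ B := by
  rw [kills_iff]
  have : (Matrix.of fun (i : Fin m) (j : Fin c) => evM α B (X (i, j))) = B := by
    ext i j; simp [evM]
  rw [this]

theorem evM_closure [Infinite F] (α : A →+* F) (B E : Matrix (Fin m) (Fin c) F)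
    (f : MvPolynomial (Fin m × Fin c) A) (l0 : F)
    (h : ∀ l : F, l ≠ l0 → evM α (B + l • E) f = 0) : evM α B f = 0 := by
  let Φ : MvPolynomial (Fin m × Fin c) A →+* Polynomial F :=
    eval₂Hom (Polynomial.C.comp α) 
      (fun p => Polynomial.C (B p.1 p.2) + Polynomial.X * Polynomial.C (E p.1 p.2))
  have hΦ : ∀ l, (Φ f).eval l = evM α (B + l • E) f := by
    intro l
    have : (Polynomial.evalRingHom l).comp Φ = evM α (B + l • E) := by
      apply MvPolynomial.ringHom_ext
      · intro a; simp [Φ, evM]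
      · intro p; simp [Φ, evM]; ring
    rw [← this]; rfl
  have h0 : Φ f = 0 := by
    apply Polynomial.eq_zero_of_infinite_isRoot
    refine Set.Infinite.mono (s := {l0}ᶜ) ?_ (Set.Finite.infinite_compl (Set.finite_singleton l0))
    intro l hl
    change (Φ f).eval l = 0
    rw [hΦ]; exact h l hl
  have := hΦ 0
  rw [h0] at this
  simpa using this.symm

structure Adm (ρ : ℕ → ℕ) : Prop where
  zero : ρ 0 = 0
  mono : ∀ j, ρ j ≤ ρ (j + 1)
  step : ∀ j, ρ (j + 1) ≤ ρ j + 1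

theorem Adm.monotone {ρ : ℕ → ℕ} (h : Adm ρ) : Monotone ρ := monotone_nat_of_le_succ h.mono

theorem nzd_point1 [Infinite F] (α : A →+* F) {i0 n : ℕ} (hi0 : i0 < m) (hn : n < c) {ρ : ℕ → ℕ}
    (f : MvPolynomial (Fin m × Fin c) A)
    (hf : ∀ B : Matrix (Fin m) (Fin c) F, Good i0 n ρ B → B ⟨i0, hi0⟩ ⟨n, hn⟩ ≠ 0 → evM α B f = 0)
    (B : Matrix (Fin m) (Fin c) F) (hB : Good i0 n ρ B) (hout : B.col ⟨n, hn⟩ ∉ colSpan B n) :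
    evM α B f = 0 := by
  obtain ⟨φ, hφ1, hφ2⟩ := Submodule.exists_le_ker_of_notMem hout
  let E : Matrix (Fin m) (Fin c) F := Matrix.of fun i j => 
    (Pi.single ⟨i0, hi0⟩ (φ (B.col j)) : Fin m → F) i
  refine evM_closure α B E f (- B ⟨i0, hi0⟩ ⟨n, hn⟩ / φ (B.col ⟨n, hn⟩)) fun l hl => hf _ ⟨?_, ?_⟩ ?_
  · intro i j hij
    rcases hij with h | ⟨h, h'⟩
    · have : i ≠ ⟨i0, hi0⟩ := by rintro rfl; simp at h
      simp [E, this, hB.row i j (Or.inl h)]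
    · have h1 : φ (B.col j) = 0 := hφ2 (col_mem_colSpan B h')
      simp [E, h1, hB.row i j (Or.inr ⟨h, h'⟩)]
  · intro j
    let T : (Fin m → F) →ₗ[F] (Fin m → F) := LinearMap.id + 
      l • (LinearMap.single F (fun _ => F) ⟨i0, hi0⟩) ∘ₗ φ
    have hT : colSpan (B + l • E) j = (colSpan B j).map T := by
      rw [colSpan, colSpan, Submodule.map_span, ← Set.image_comp]
      congr 1
    rw [hT]
    exact (Submodule.finrank_map_le _ _).trans (hB.rk j)
  · intro h0
    apply hl
    rw [eq_div_iff hφ1]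
    simp [E] at h0
    linear_combination h0

end nzd
end DetCM

namespace DetCM
open MvPolynomial
section nzd
variable {A : Type*} [CommRing A] {m c : ℕ} {F : Type*} [Field F] 

/-- add a vector to one column -/
def colE (m : ℕ) {c : ℕ} (n : Fin c) (v : Fin m → F) : Matrix (Fin m) (Fin c) F :=
  Matrix.of fun i j => if j = n then v i else 0

theorem col_colE_ne (B : Matrix (Fin m) (Fin c) F) (n : Fin c) (v : Fin m → F) (l : F) {k : Fin c}
    (hk : k ≠ n) : (B + l • colE m n v).col k = B.col k := by
  ext i; simp [colE, hk]

theorem col_colE_eq (B : Matrix (Fin m) (Fin c) F) (n : Fin c) (v : Fin m → F) (l : F) :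
    (B + l • colE m n v).col n = B.col n + l • v := by
  ext i; simp [colE]

theorem colSpan_colE (B : Matrix (Fin m) (Fin c) F) (n : Fin c) (v : Fin m → F) (l : F) {j : ℕ}
    (hj : j ≤ n.val) : colSpan (B + l • colE m n v) j = colSpan B j := by
  rw [colSpan, colSpan]
  congr 1
  apply Set.image_congr
  intro k hk
  apply col_colE_ne
  rintro rfl
  simp at hk; omega

theorem good_colE {B : Matrix (Fin m) (Fin c) F} {i0 : ℕ} {n : Fin c} {ρ : ℕ → ℕ} 
    (hB : Good i0 n ρ B) (v : Fin m → F) (l : F) (hv : ∀ i : Fin m, i.val < i0 → v i = 0)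
    (hrk : ∀ j, n.val < j → Module.finrank F (colSpan (B + l • colE m n v) j) ≤ ρ j) :
    Good i0 n ρ (B + l • colE m n v) := by
  refine ⟨fun i j hij => ?_, fun j => ?_⟩
  · rcases hij with h | ⟨h, h'⟩
    · simp [colE, hv i h, hB.row i j (Or.inl h)]
    · have : j ≠ n := by rintro rfl; omega
      simp [colE, this, hB.row i j (Or.inr ⟨h, h'⟩)]
  · by_cases hj : j ≤ n.val
    · rw [colSpan_colE _ _ _ _ hj]; exact hB.rk j
    · exact hrk j (by omega)

theorem colSpan_colE_le (B : Matrix (Fin m) (Fin c) F) (n : Fin c) (v : Fin m → F) (l : F) {j : ℕ}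
    (S : Submodule F (Fin m → F)) (h1 : colSpan B j ≤ S) (h2 : v ∈ S) (hj : n.val < j) :
    colSpan (B + l • colE m n v) j ≤ S := by
  rw [colSpan, Submodule.span_le]
  rintro _ ⟨k, hk, rfl⟩
  by_cases hkn : k = n
  · subst hkn
    rw [col_colE_eq]
    exact S.add_mem (h1 (col_mem_colSpan B hj)) (S.smul_mem _ h2)
  · rw [col_colE_ne _ _ _ _ hkn]
    exact h1 (col_mem_colSpan B hk)

theorem finrank_sup_span_le (S : Submodule F (Fin m → F)) (v : Fin m → F) :
    Module.finrank F (S ⊔ Submodule.span F {v} : Submodule F (Fin m → F)) ≤ 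
      Module.finrank F S + 1 := by
  have h1 := Submodule.finrank_add_le_finrank_add_finrank S (Submodule.span F {v})
  have h2 := finrank_span_le_card (R := F) ({v} : Set (Fin m → F))
  simp at h2
  omega

/-- vectors vanishing in the first `i0` coordinates -/
def lowSub (F : Type*) [Field F] (m i0 : ℕ) : Submodule F (Fin m → F) :=
  Submodule.span F ((fun i => (Pi.single i (1 : F) : Fin m → F)) '' {i | i0 ≤ i.val})

theorem finrank_lowSub (i0 : ℕ) : Module.finrank F (lowSub F m i0) ≤ m - i0 := by
  rw [lowSub]
  have : ((fun i => (Pi.single i (1 : F) : Fin m → F)) '' {i | i0 ≤ i.val}) = 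
    Set.range (fun k : Fin (m - i0) => 
      (Pi.single (⟨i0 + k.val, by omega⟩ : Fin m) (1 : F) : Fin m → F)) := by
    ext v; constructor
    · rintro ⟨i, hi, rfl⟩
      simp at hi
      refine ⟨⟨i.val - i0, by omega⟩, ?_⟩
      simp [Nat.add_sub_cancel' hi]
    · rintro ⟨k, rfl⟩
      exact ⟨_, by simp, rfl⟩
  rw [this]
  refine (finrank_range_le_card _).trans (by simp)

theorem mem_lowSub {i0 : ℕ} {v : Fin m → F} (h : ∀ i : Fin m, i.val < i0 → v i = 0) :
    v ∈ lowSub F m i0 := by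
  rw [pi_eq_sum_univ' v]
  refine Submodule.sum_mem _ fun i _ => ?_
  by_cases hi : i.val < i0
  · simp [h i hi]
  · refine Submodule.smul_mem _ _ (Submodule.subset_span ⟨i, ?_, ?_⟩)
    · simpa using hi
    · ext k; simp [Pi.single_apply, eq_comm]

theorem nzd_point [Infinite F] (α : A →+* F) {i0 n : ℕ} (hi0 : i0 < m) (hn : n < c) {ρ : ℕ → ℕ}
    (hρ : Adm ρ) (hst : ρ (n + 1) = ρ n + 1 ∨ m - i0 ≤ ρ n)
    (f : MvPolynomial (Fin m × Fin c) A)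
    (hf : ∀ B : Matrix (Fin m) (Fin c) F, Good i0 n ρ B → B ⟨i0, hi0⟩ ⟨n, hn⟩ ≠ 0 → evM α B f = 0)
    (B : Matrix (Fin m) (Fin c) F) (hB : Good i0 n ρ B) :
    evM α B f = 0 := by
  classical
  by_cases hout : B.col ⟨n, hn⟩ ∈ colSpan B n
  swap
  · exact nzd_point1 α hi0 hn f hf B hB hout
  by_cases hex : ρ (n + 1) = ρ n + 1 ∧ ∃ k : ℕ, ∃ hk : k < c, n < k ∧ B.col ⟨k, hk⟩ ∉ colSpan B n
  · obtain ⟨hp, hex⟩ := hex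
    obtain ⟨hk, hnk, hkout⟩ := Nat.find_spec hex
    have hmin := fun {q} => Nat.find_min (m := q) hex
    set k := Nat.find hex
    refine evM_closure α B (colE m ⟨n, hn⟩ (B.col ⟨k, hk⟩)) f 0 fun l hl => ?_
    refine nzd_point1 α hi0 hn f hf _ (good_colE (n := ⟨n, hn⟩) hB _ _ 
      (fun i hi => hB.row i _ (Or.inl hi)) ?_) ?_
    · intro j hj
      simp at hj
      by_cases hjk : j ≤ k
      · have : colSpan B j ≤ colSpan B n := by
          rw [colSpan, Submodule.span_le]
          rintro _ ⟨q, hq, rfl⟩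
          simp at hq
          rcases lt_trichotomy q.val n with h | h | h
          · exact col_mem_colSpan B h
          · have : q = ⟨n, hn⟩ := Fin.ext h
            rw [this]; exact hout
          · by_contra hcon
            exact hmin (q := q.val) (by omega) ⟨q.2, h, hcon⟩
        have h2 := colSpan_colE_le B ⟨n, hn⟩ (B.col ⟨k, hk⟩) l 
          (colSpan B n ⊔ Submodule.span F {B.col ⟨k, hk⟩}) (this.trans le_sup_left)
          (Submodule.mem_sup_right (Submodule.mem_span_singleton_self _)) hj
        have h3 := Submodule.finrank_mono h2
        have h4 := finrank_sup_span_le (colSpan B n) (B.col ⟨k, hk⟩)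
        have h5 := hB.rk n
        have h6 := hρ.monotone (show n + 1 ≤ j from hj)
        omega
      · have h2 := colSpan_colE_le B ⟨n, hn⟩ (B.col ⟨k, hk⟩) l (colSpan B j) le_rfl
          (col_mem_colSpan B (by simp; omega)) hj
        exact (Submodule.finrank_mono h2).trans (hB.rk j)
    · rw [colSpan_colE _ _ _ _ (le_refl n), col_colE_eq]
      intro h
      apply hkout
      have := (colSpan B n).sub_mem h hout
      rw [add_sub_cancel_left] at this
      exact ((colSpan B n).smul_mem_iff hl).1 this
  · refine evM_closure α B (colE m ⟨n, hn⟩ (Pi.single ⟨i0, hi0⟩ 1)) f (- B ⟨i0, hi0⟩ ⟨n, hn⟩) 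
      fun l hl => ?_
    have hv : ∀ i : Fin m, i.val < i0 → (Pi.single ⟨i0, hi0⟩ (1 : F) : Fin m → F) i = 0 := by
      intro i hi
      have : i ≠ ⟨i0, hi0⟩ := by rintro rfl; simp at hi
      simp [this]
    refine hf _ (good_colE (n := ⟨n, hn⟩) hB _ _ hv ?_) ?_
    · intro j hj
      simp at hj
      rcases hst with hst | hst
      · have : colSpan B j ≤ colSpan B n := by
          rw [colSpan, Submodule.span_le]
          rintro _ ⟨q, hq, rfl⟩
          simp at hq
          rcases lt_trichotomy q.val n with h | h | h
          · exact col_mem_colSpan B h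
          · have : q = ⟨n, hn⟩ := Fin.ext h
            rw [this]; exact hout
          · by_contra hcon
            exact hex ⟨hst, q.val, q.2, h, hcon⟩
        have h2 := colSpan_colE_le B ⟨n, hn⟩ (Pi.single ⟨i0, hi0⟩ 1) l 
          (colSpan B n ⊔ Submodule.span F {Pi.single ⟨i0, hi0⟩ 1}) (this.trans le_sup_left)
          (Submodule.mem_sup_right (Submodule.mem_span_singleton_self _)) hj
        have h3 := Submodule.finrank_mono h2
        have h4 := finrank_sup_span_le (colSpan B n) (Pi.single ⟨i0, hi0⟩ 1)
        have h5 := hB.rk n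
        have h6 := hρ.monotone (show n + 1 ≤ j from hj)
        omega
      · have h2 := colSpan_colE_le B ⟨n, hn⟩ (Pi.single ⟨i0, hi0⟩ 1) l (j := j) (lowSub F m i0) ?_
          (mem_lowSub hv) hj
        · have h3 := Submodule.finrank_mono h2
          have h4 := finrank_lowSub (F := F) (m := m) i0
          have h6 := hρ.monotone hj.le
          omega
        · rw [colSpan, Submodule.span_le]
          rintro _ ⟨q, hq, rfl⟩
          exact mem_lowSub fun i hi => hB.row i q (Or.inl hi)
    · intro h0
      apply hl
      simp [colE] at h0
      linear_combination h0

theorem nzd_rad {K : Type*} [Field K] [Infinite K] [Algebra K A] 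
    {i0 n : ℕ} (hi0 : i0 < m) (hn : n < c) {ρ : ℕ → ℕ}
    (hρ : Adm ρ) (hst : ρ (n + 1) = ρ n + 1 ∨ m - i0 ≤ ρ n)
    (f : MvPolynomial (Fin m × Fin c) A)
    (hf : X (⟨i0, hi0⟩, ⟨n, hn⟩) * f ∈ (Id A m c i0 n ρ).radical) :
    f ∈ (Id A m c i0 n ρ).radical := by
  rw [Ideal.radical_eq_sInf, Submodule.mem_sInf]
  rintro Q ⟨hQ, hQp⟩
  let R := MvPolynomial (Fin m × Fin c) A
  let F := FractionRing (R ⧸ Q)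
  let φ : R →+* F := (algebraMap (R ⧸ Q) F).comp (Ideal.Quotient.mk Q)
  have hker : RingHom.ker φ = Q := by
    ext x
    simp [φ, RingHom.mem_ker, Ideal.Quotient.eq_zero_iff_mem]
  let α : A →+* F := φ.comp C
  have : Infinite F := Infinite.of_injective (α.comp (algebraMap K A)) (RingHom.injective _)
  let B : Matrix (Fin m) (Fin c) F := Matrix.of fun i j => φ (X (i, j))
  have hφ : φ = evM α B := by
    apply MvPolynomial.ringHom_ext
    · intro a; simp [evM, α]
    · intro p; simp [evM, B]
  have hB : Good i0 n ρ B := by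
    rw [← evM_kills α B, ← hφ, hker]; exact hQ
  have := nzd_point α hi0 hn hρ hst f ?_ B hB
  · rw [← hφ] at this
    rw [← hker]; exact this
  · intro B' hB' hne
    rw [← evM_kills α B'] at hB'
    have h1 : (Id A m c i0 n ρ).radical ≤ RingHom.ker (evM α B') := 
      (RingHom.ker_isPrime (evM α B')).isRadical.radical_le_iff.2 hB'
    have h2 := h1 hf
    rw [RingHom.mem_ker, map_mul] at h2
    refine (mul_eq_zero.1 h2).resolve_left ?_
    simpa [evM] using hne
end nzd
end DetCM

namespace DetCM
open MvPolynomial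

section ideals
variable {A : Type*} [CommRing A] {m c : ℕ}

theorem laplace_mem {R : Type*} [CommRing R] {m c : ℕ} (M : Matrix (Fin m) (Fin c) R) (J : Ideal R)
    (P : Fin c → Prop) (r : ℕ) (h : ∀ (f : Fin r → Fin m) (g : Fin r → Fin c), (∀ k, P (g k)) → 
      (M.submatrix f g).det ∈ J) (k : ℕ) (hk : r ≤ k) :
    ∀ (f : Fin k → Fin m) (g : Fin k → Fin c), (∀ k, P (g k)) → (M.submatrix f g).det ∈ J := by
  induction k, hk using Nat.le_induction with
  | base => exact h
  | succ k hk ih =>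
    intro f g hg
    rw [Matrix.det_succ_row_zero]
    refine Ideal.sum_mem _ fun j _ => Ideal.mul_mem_left _ _ ?_
    rw [Matrix.submatrix_submatrix]
    exact ih _ _ fun k => hg _

theorem X_mem_Id {i0 n : ℕ} {ρ : ℕ → ℕ} (i : Fin m) (j : Fin c)
    (h : i.val < i0 ∨ (i.val = i0 ∧ j.val < n)) : X (i, j) ∈ Id A m c i0 n ρ :=
  Ideal.subset_span (Or.inl ⟨i, j, h, rfl⟩)

theorem minor_mem_Id {i0 n : ℕ} {ρ : ℕ → ℕ} (j k : ℕ) (hk : ρ j + 1 ≤ k) (f : Fin k → Fin m)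
    (g : Fin k → Fin c) (hg : ∀ q, (g q).val < j) :
    ((genM A m c).submatrix f g).det ∈ Id A m c i0 n ρ := by
  refine laplace_mem _ _ (fun q => q.val < j) (ρ j + 1) ?_ k hk f g hg
  intro f g hg
  exact Ideal.subset_span (Or.inr ⟨j, f, g, hg, rfl⟩)

theorem Id_mono {i0 n i1 n1 : ℕ} {ρ ρ' : ℕ → ℕ} 
    (h : ∀ (i : Fin m) (j : Fin c), (i.val < i0 ∨ (i.val = i0 ∧ j.val < n)) → 
      X (i, j) ∈ Id A m c i1 n1 ρ') (hρ : ∀ j, ρ' j ≤ ρ j) :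
    Id A m c i0 n ρ ≤ Id A m c i1 n1 ρ' := by
  rw [Id, Ideal.span_le]
  rintro p (⟨i, j, hij, rfl⟩ | ⟨j, f, g, hg, rfl⟩)
  · exact h i j hij
  · exact minor_mem_Id j _ (by have := hρ j; omega) f g hg

theorem Id_mono_n {i0 n n' : ℕ} {ρ ρ' : ℕ → ℕ} (hn : n ≤ n') (hρ : ∀ j, ρ' j ≤ ρ j) :
    Id A m c i0 n ρ ≤ Id A m c i0 n' ρ' :=
  Id_mono (fun i j h => X_mem_Id i j (by omega)) hρ

theorem Id_sup {i0 n n' : ℕ} {ρ ρ' : ℕ → ℕ} (hn : n ≤ n') (hρ : ∀ j, ρ' j ≤ ρ j) :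
    Id A m c i0 n ρ' ⊔ Id A m c i0 n' ρ = Id A m c i0 n' ρ' := by
  apply le_antisymm
  · exact sup_le (Id_mono_n hn fun _ => le_rfl) (Id_mono_n le_rfl hρ)
  · conv_lhs => rw [Id]
    rw [Ideal.span_le]
    rintro p (⟨i, j, hij, rfl⟩ | ⟨j, f, g, hg, rfl⟩)
    · exact Ideal.mem_sup_right (X_mem_Id i j hij)
    · exact Ideal.mem_sup_left (minor_mem_Id j _ le_rfl f g hg)

theorem Id_succ {i0 n : ℕ} (hi0 : i0 < m) (hn : n < c) (ρ : ℕ → ℕ) :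
    Id A m c i0 (n + 1) ρ = Id A m c i0 n ρ ⊔ Ideal.span {X (⟨i0, hi0⟩, ⟨n, hn⟩)} := by
  apply le_antisymm
  · conv_lhs => rw [Id]
    rw [Ideal.span_le]
    rintro p (⟨i, j, hij, rfl⟩ | ⟨j, f, g, hg, rfl⟩)
    · by_cases h : i.val = i0 ∧ j.val = n
      · obtain ⟨h1, h2⟩ := h
        subst h1; subst h2
        exact Ideal.mem_sup_right (Ideal.mem_span_singleton_self _)
      · exact Ideal.mem_sup_left (X_mem_Id i j (by omega))
    · exact Ideal.mem_sup_left (minor_mem_Id j _ le_rfl f g hg)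
  · refine sup_le (Id_mono_n (by omega) fun _ => le_rfl) ?_
    rw [Ideal.span_singleton_le_iff_mem]
    exact X_mem_Id _ _ (by simp)

theorem Id_end {i0 n : ℕ} (hn : c ≤ n) (ρ : ℕ → ℕ) :
    Id A m c i0 n ρ = Id A m c (i0 + 1) 0 ρ := by
  apply le_antisymm
  · exact Id_mono (fun i j h => X_mem_Id i j (by omega)) fun _ => le_rfl
  · exact Id_mono (fun i j h => X_mem_Id i j (by omega)) fun _ => le_rfl

theorem Id_zero_jump {i0 n n' : ℕ} (hn : n ≤ n') {ρ : ℕ → ℕ} (hρ : ρ n' = 0) :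
    Id A m c i0 n ρ = Id A m c i0 n' ρ := by
  apply le_antisymm (Id_mono_n hn fun _ => le_rfl)
  refine Id_mono (fun i j h => ?_) fun _ => le_rfl
  by_cases h' : i.val < i0 ∨ (i.val = i0 ∧ j.val < n)
  · exact X_mem_Id i j h'
  · have := minor_mem_Id (A := A) (m := m) (c := c) (i0 := i0) (n := n) (ρ := ρ) n' 1 (by omega) (fun _ => i) (fun _ => j) (fun _ => by omega)
    simpa [genM] using this

theorem Id_bot {i0 n : ℕ} (hi0 : m ≤ i0) (ρ : ℕ → ℕ) :
    Id A m c i0 n ρ = RingHom.ker (constantCoeff (σ := Fin m × Fin c) (R := A)) := by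
  apply le_antisymm
  · rw [Id, Ideal.span_le]
    rintro p (⟨i, j, hij, rfl⟩ | ⟨j, f, g, hg, rfl⟩)
    · simp
    · change constantCoeff _ = 0
      rw [RingHom.map_det, Matrix.det_succ_row_zero]
      refine Finset.sum_eq_zero fun k _ => ?_
      simp [genM]
  · intro p hp
    rw [← MvPolynomial.support_sum_monomial_coeff p]
    refine Ideal.sum_mem _ fun v hv => ?_
    have hv0 : v ≠ 0 := by
      rintro rfl
      rw [mem_support_iff] at hv
      exact hv (by simpa [constantCoeff_eq] using hp)
    obtain ⟨q, hq⟩ := Finsupp.ne_iff.1 hv0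
    have h1 : (X q : MvPolynomial (Fin m × Fin c) A) ∣ monomial v (coeff v p) := by
      rw [X_dvd_monomial]; right; simpa using hq
    exact Ideal.mem_of_dvd _ h1 (X_mem_Id q.1 q.2 (by omega))

theorem mul_mem_Id {i0 n j : ℕ} (hi0 : i0 < m) (hj : j < c) (hnj : n ≤ j) {ρ ρ' : ℕ → ℕ}
    (hρj : ρ (j + 1) = ρ n)
    (hρ : ∀ k, ρ' k = ρ k ∨ (k ≤ n ∧ ρ' k + 1 = ρ k ∧ ρ k = ρ n)) 
    {y : MvPolynomial (Fin m × Fin c) A} (hy : y ∈ Id A m c i0 n ρ') :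
    X (⟨i0, hi0⟩, ⟨j, hj⟩) * y ∈ Id A m c i0 n ρ := by
  rw [mul_comm, ← smul_eq_mul, ← Submodule.mem_colon_singleton]
  revert y
  change Id A m c i0 n ρ' ≤ _
  conv_lhs => rw [Id]
  rw [Ideal.span_le]
  rintro p (⟨i, j', hij, rfl⟩ | ⟨k, f, g, hg, rfl⟩)
  · rw [SetLike.mem_coe, Submodule.mem_colon_singleton, smul_eq_mul]
    exact Ideal.mul_mem_right _ _ (X_mem_Id i j' hij)
  · rw [SetLike.mem_coe, Submodule.mem_colon_singleton, smul_eq_mul]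
    rcases hρ k with h | ⟨hkn, h1, h2⟩
    · exact Ideal.mul_mem_right _ _ (minor_mem_Id k _ (by omega) f g hg)
    · have hm := minor_mem_Id (A := A) (i0 := i0) (n := n) (ρ := ρ) (j + 1) (ρ' k + 1 + 1) 
        (by omega) (Fin.cons ⟨i0, hi0⟩ f : Fin _ → Fin m) (Fin.cons ⟨j, hj⟩ g : Fin _ → Fin c) (by
          intro q
          refine Fin.cases (by simp) (fun q => ?_) q
          simp; have := hg q; omega)
      rw [Matrix.det_succ_row_zero, Fin.sum_univ_succ] at hm
      rw [Ideal.add_mem_iff_left] at hm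
      · have : ((genM A m c).submatrix (Fin.cons ⟨i0, hi0⟩ f : Fin _ → Fin m) 
          (Fin.cons ⟨j, hj⟩ g : Fin _ → Fin c)).submatrix Fin.succ (Fin.succAbove 0)
            = (genM A m c).submatrix f g := by
          ext a b; simp
        rw [this] at hm
        simpa [genM, mul_comm] using hm
      · refine Ideal.sum_mem _ fun q _ => Ideal.mul_mem_right _ _ (Ideal.mul_mem_left _ _ ?_)
        simp only [Matrix.submatrix_apply, Fin.cons_zero, Fin.cons_succ, genM, Matrix.of_apply]
        exact X_mem_Id _ _ (by right; have := hg q; simp; omega)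
end ideals

section rad
variable {A : Type*} [CommRing A] {m c : ℕ}
attribute [local instance] MvPolynomial.gradedAlgebra

theorem Id_homog (i0 n : ℕ) (ρ : ℕ → ℕ) : 
    (Id A m c i0 n ρ).IsHomogeneous (homogeneousSubmodule (Fin m × Fin c) A) := by
  apply Ideal.homogeneous_span
  rintro p (⟨i, j, hij, rfl⟩ | ⟨k, f, g, hg, rfl⟩)
  · exact ⟨1, isHomogeneous_X _ _⟩
  · refine ⟨ρ k + 1, ?_⟩
    rw [Matrix.det_apply]
    refine Submodule.sum_mem _ fun σ _ => ?_
    refine Submodule.smul_of_tower_mem _ _ ?_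
    have := IsHomogeneous.prod (R := A) (Finset.univ : Finset (Fin (ρ k + 1))) 
      (fun i => (genM A m c).submatrix f g (σ i) i) (fun _ => 1) (fun i _ => isHomogeneous_X _ _)
    simpa using this

theorem hc_X_mul_zero {σ : Type*} (p : σ) (g : MvPolynomial σ A) :
    homogeneousComponent 0 (X p * g) = 0 := by
  classical
  simp [coeff_X_mul']

theorem hc_X_mul_succ {σ : Type*} (p : σ) (g : MvPolynomial σ A) (d : ℕ) :
    homogeneousComponent (d + 1) (X p * g) = X p * homogeneousComponent d g := by
  classical
  ext v
  rw [coeff_homogeneousComponent, coeff_X_mul', coeff_X_mul', coeff_homogeneousComponent]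
  by_cases hp : p ∈ v.support
  · have : v.degree = (v - Finsupp.single p 1).degree + 1 := by
      have h1 : v = (v - Finsupp.single p 1) + Finsupp.single p 1 := by
        ext q
        by_cases hq : q = p
        · subst hq
          simp at hp ⊢; omega
        · simp [Ne.symm hq]
      conv_lhs => rw [h1]
      simp
    simp [hp, this]
  · simp [hp]

theorem rad_step {σ : Type*} (I : Ideal (MvPolynomial σ A)) 
    (hI : I.IsHomogeneous (homogeneousSubmodule σ A)) (p : σ)
    (h1 : (I ⊔ Ideal.span {X p}).IsRadical) (h2 : ∀ f, X p * f ∈ I.radical → f ∈ I.radical) :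
    I.IsRadical := by
  have hr : I.radical.IsHomogeneous (homogeneousSubmodule σ A) := hI.radical
  have key : ∀ d, ∀ f ∈ I.radical, homogeneousComponent d f = f → f ∈ I := by
    intro d
    induction d with
    | zero =>
      intro f hf hd
      have : f ∈ I ⊔ Ideal.span {X p} := h1 (Ideal.radical_mono le_sup_left hf)
      obtain ⟨i, hi, y, hy, rfl⟩ := Submodule.mem_sup.1 this
      obtain ⟨g, rfl⟩ := Ideal.mem_span_singleton.1 hy
      rw [← hd, map_add, hc_X_mul_zero, add_zero]
      exact homogeneousComponent_mem_of_mem hI hi _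
    | succ d ih =>
      intro f hf hd
      have : f ∈ I ⊔ Ideal.span {X p} := h1 (Ideal.radical_mono le_sup_left hf)
      obtain ⟨i, hi, y, hy, hiy⟩ := Submodule.mem_sup.1 this
      obtain ⟨g, rfl⟩ := Ideal.mem_span_singleton.1 hy
      have h3 : homogeneousComponent (d + 1) i + X p * homogeneousComponent d g = f := by
        rw [← hc_X_mul_succ, ← map_add, hiy, hd]
      have hi' : homogeneousComponent (d + 1) i ∈ I := homogeneousComponent_mem_of_mem hI hi _
      have h4 : X p * homogeneousComponent d g ∈ I.radical := by
        rw [← h3] at hf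
        exact (Ideal.add_mem_iff_right _ (Ideal.le_radical hi')).1 hf
      have h5 := ih _ (h2 _ h4) 
        (homogeneousComponent_eq_self (homogeneousComponent_isHomogeneous d g))
      rw [← h3]
      exact I.add_mem hi' (Ideal.mul_mem_left _ _ h5)
  intro f hf
  rw [mem_iff_homogeneousComponent_mem hI]
  intro d
  exact key d _ (homogeneousComponent_mem_of_mem hr hf d) 
    (homogeneousComponent_eq_self (homogeneousComponent_isHomogeneous d f))

theorem Adm.exists_pivot {ρ : ℕ → ℕ} (h : Adm ρ) (n : ℕ) (hn : ρ n ≠ 0) :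
    ∃ p < n, ρ (p + 1) = ρ p + 1 ∧ ρ (p + 1) = ρ n := by
  induction n with
  | zero => exact absurd h.zero hn
  | succ n ih =>
    by_cases hp : ρ (n + 1) = ρ n + 1
    · exact ⟨n, by omega, hp, rfl⟩
    · have h1 := h.mono n
      have h2 := h.step n
      have h3 : ρ (n + 1) = ρ n := by omega
      obtain ⟨p, hp1, hp2, hp3⟩ := ih (by omega)
      exact ⟨p, by omega, hp2, by omega⟩

/-- the modified rank function -/
def modRk (p n : ℕ) (ρ : ℕ → ℕ) : ℕ → ℕ := fun j => if p < j ∧ j ≤ n then ρ j - 1 else ρ j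

theorem Adm.const {ρ : ℕ → ℕ} (h : Adm ρ) {p n j : ℕ} (h3 : ρ (p + 1) = ρ n) (h1 : p < j) (h2 : j ≤ n) : 
    ρ j = ρ n := by
  have := h.monotone (show p + 1 ≤ j from h1)
  have := h.monotone h2
  omega

theorem Adm.modRk {ρ : ℕ → ℕ} (h : Adm ρ) {p n : ℕ} (hp : ρ (p + 1) = ρ p + 1)
    (h1 : ρ (p + 1) = ρ n) (h2 : ρ (n + 1) = ρ n) : Adm (modRk p n ρ) := by
  refine ⟨by simp [DetCM.modRk, h.zero], fun j => ?_, fun j => ?_⟩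
  all_goals
    have a1 := h.mono j
    have a2 := h.step j
    have a3 := fun q1 q2 => h.const (j := j) h1 q1 q2
    have a4 := fun q1 q2 => h.const (j := j + 1) h1 q1 q2
    simp only [DetCM.modRk]
    by_cases hjp : j = p
    · subst hjp
      split_ifs <;> omega
    by_cases hjn : j = n
    · subst hjn
      split_ifs <;> omega
    split_ifs <;> omega

theorem modRk_cond {ρ : ℕ → ℕ} (h : Adm ρ) {p n : ℕ} (hp : ρ (p + 1) = ρ p + 1)
    (h1 : ρ (p + 1) = ρ n) (k : ℕ) : 
    modRk p n ρ k = ρ k ∨ (k ≤ n ∧ modRk p n ρ k + 1 = ρ k ∧ ρ k = ρ n) := by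
  have a3 := fun q1 q2 => h.const (j := k) h1 q1 q2
  simp only [modRk]
  split_ifs with hk
  · right
    have := a3 hk.1 hk.2
    omega
  · exact Or.inl rfl

theorem modRk_le (ρ : ℕ → ℕ) (p n k : ℕ) : modRk p n ρ k ≤ ρ k := by
  simp only [modRk]; split_ifs <;> omega

theorem Id_isRadical {K : Type*} [Field K] [Infinite K] [Algebra K A] [IsDomain A] 
    (r : ℕ) : ∀ i0 : ℕ, i0 + r = m → ∀ n ρ, Adm ρ → (Id A m c i0 n ρ).IsRadical := by
  induction r with
  | zero =>
    intro i0 hi0 n ρ hρ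
    rw [Id_bot (by omega)]
    exact (RingHom.ker_isPrime _).isRadical
  | succ r ih =>
    intro i0 hi0 n
    have hi0' : i0 < m := by omega
    obtain ⟨k, hk⟩ : ∃ k, c - n = k := ⟨_, rfl⟩
    induction k generalizing n with
    | zero =>
      intro ρ hρ
      rw [Id_end (by omega)]
      exact ih (i0 + 1) (by omega) _ _ hρ
    | succ k ihk =>
      have hn : n < c := by omega
      have hnext := ihk (n + 1) (by omega)
      have hpiv : ∀ ρ, Adm ρ → ρ (n + 1) = ρ n + 1 → (Id A m c i0 n ρ).IsRadical := by
        intro ρ hρ hp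
        refine rad_step _ (Id_homog _ _ _) (⟨i0, hi0'⟩, ⟨n, hn⟩) ?_ 
          (nzd_rad (K := K) hi0' hn hρ (Or.inl hp))
        rw [← Id_succ]
        exact hnext ρ hρ
      intro ρ hρ
      have a1 := hρ.mono n
      have a2 := hρ.step n
      by_cases hp : ρ (n + 1) = ρ n + 1
      · exact hpiv ρ hρ hp
      have hnp : ρ (n + 1) = ρ n := by omega
      by_cases h0 : ρ n = 0
      · rw [Id_zero_jump (n := n) (n' := n + 1) (by omega) (by omega)]
        exact hnext ρ hρ
      obtain ⟨p, hpn, hpp, hpe⟩ := hρ.exists_pivot n h0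
      have hρ' := hρ.modRk hpp hpe hnp
      have hpiv' : modRk p n ρ (n + 1) = modRk p n ρ n + 1 := by
        simp only [modRk]; rw [if_neg (by omega), if_pos (by omega)]; omega
      have hrad' := hpiv _ hρ' hpiv'
      intro f hf
      have h1 : f ∈ Id A m c i0 (n + 1) ρ := 
        hnext ρ hρ (Ideal.radical_mono (Id_mono_n (by omega) fun _ => le_rfl) hf)
      rw [Id_succ hi0' hn] at h1
      obtain ⟨i, hi, y, hy, rfl⟩ := Submodule.mem_sup.1 h1
      obtain ⟨g, rfl⟩ := Ideal.mem_span_singleton.1 hy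
      have h2 := (Ideal.add_mem_iff_right _ (Ideal.le_radical hi)).1 hf
      have h3 := Ideal.radical_mono (Id_mono_n le_rfl (modRk_le ρ p n)) h2
      have h4 := hrad' (nzd_rad (K := K) hi0' hn hρ' (Or.inl hpiv') _ h3)
      exact Ideal.add_mem _ hi (mul_mem_Id hi0' hn le_rfl (by omega) (modRk_cond hρ hpp hpe) h4)
end rad
end DetCM

namespace DetCM
open MvPolynomial
universe u

/-- local dimension weights -/
def wt (r n : ℕ) (ρ : ℕ → ℕ) (j : ℕ) : ℕ :=
  if ρ (j + 1) = ρ j + 1 then (if j < n then r - 1 else r) 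
  else min (ρ j) (if j < n then r - 1 else r)

/-- total dimension -/
def DD (c r n : ℕ) (ρ : ℕ → ℕ) : ℕ := ∑ j ∈ Finset.range c, wt r n ρ j

theorem sum_drop {s : Finset ℕ} {f g : ℕ → ℕ} {a : ℕ} (ha : a ∈ s) (h : f a = g a + 1)
    (h' : ∀ j ∈ s, j ≠ a → f j = g j) : ∑ j ∈ s, f j = ∑ j ∈ s, g j + 1 := by
  rw [← Finset.add_sum_erase s f ha, ← Finset.add_sum_erase s g ha, h,
    Finset.sum_congr rfl (fun j hj => h' j (Finset.mem_of_mem_erase hj) (Finset.ne_of_mem_erase hj))]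
  ring

theorem sum_swap {s : Finset ℕ} {f g : ℕ → ℕ} {a b : ℕ} (ha : a ∈ s) (hb : b ∈ s) (hab : b ≠ a) 
    (h : f a + f b = g a + g b)
    (h' : ∀ j ∈ s, j ≠ a → j ≠ b → f j = g j) : ∑ j ∈ s, f j = ∑ j ∈ s, g j := by
  have hb' : b ∈ s.erase a := Finset.mem_erase.2 ⟨hab, hb⟩
  rw [← Finset.add_sum_erase s f ha, ← Finset.add_sum_erase s g ha, 
    ← Finset.add_sum_erase _ f hb', ← Finset.add_sum_erase _ g hb', ← add_assoc, ← add_assoc, h]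
  congr 1
  refine Finset.sum_congr rfl fun j hj => ?_
  simp only [Finset.mem_erase] at hj
  exact h' j hj.2.2 hj.2.1 hj.1

theorem DD_succ {c r n : ℕ} (hn : n < c) (hr : 1 ≤ r) (ρ : ℕ → ℕ) 
    (h : ρ (n + 1) = ρ n + 1 ∨ r ≤ ρ n) : DD c r n ρ = DD c r (n + 1) ρ + 1 := by
  refine sum_drop (Finset.mem_range.2 hn) ?_ ?_
  · simp only [wt]
    split_ifs <;> omega
  · intro j _ hj
    simp only [wt]
    by_cases h1 : j < n
    · simp [h1, show j < n + 1 by omega]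
    · simp [h1, show ¬ j < n + 1 by omega]

theorem DD_jump {c r n q : ℕ} (hr : 1 ≤ r) (hnq : n ≤ q) (ρ : ℕ → ℕ) 
    (h : ∀ j, n ≤ j → j < q → ρ (j + 1) ≠ ρ j + 1 ∧ ρ j < r) : DD c r n ρ = DD c r q ρ := by
  refine Finset.sum_congr rfl fun j _ => ?_
  simp only [wt]
  have := h j
  split_ifs <;> omega

theorem DD_mod {c r p : ℕ} (hp1 : p + 1 < c) {ρ : ℕ → ℕ} (hp : ρ (p + 1) = ρ p + 1) 
    (hnp : ρ (p + 2) = ρ (p + 1)) (hr : ρ (p + 1) < r) : 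
    DD c r (p + 1) (modRk p (p + 1) ρ) = DD c r (p + 1) ρ := by
  refine sum_swap (a := p) (b := p + 1) (Finset.mem_range.2 (by omega)) (Finset.mem_range.2 hp1)
    (by omega) ?_ ?_
  · simp only [wt, modRk]
    simp [hp, hnp]
    omega
  · intro j _ h1 h2
    have e1 : modRk p (p + 1) ρ (j + 1) = ρ (j + 1) := by
      simp only [modRk]
      rw [if_neg (show ¬ (p < j + 1 ∧ j + 1 ≤ p + 1) by omega)]
    have e2 : modRk p (p + 1) ρ j = ρ j := by
      simp only [modRk]
      rw [if_neg (show ¬ (p < j ∧ j ≤ p + 1) by omega)]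
    simp only [wt, e1, e2]

theorem DD_end {c r : ℕ} (ρ : ℕ → ℕ) : DD c (r + 1) c ρ = DD c r 0 ρ := by
  refine Finset.sum_congr rfl fun j hj => ?_
  rw [Finset.mem_range] at hj
  simp [wt, hj]

theorem DD_zero {c n : ℕ} (ρ : ℕ → ℕ) : DD c 0 n ρ = 0 := by
  refine Finset.sum_eq_zero fun j hj => ?_
  simp [wt]

/-- the next pivot, or the end -/
theorem exists_next (c n : ℕ) (hn : n ≤ c) (P : ℕ → Prop) :
    ∃ q, n ≤ q ∧ q ≤ c ∧ (q = c ∨ P q) ∧ ∀ j, n ≤ j → j < q → ¬ P j := by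
  classical
  have hex : ∃ q, n ≤ q ∧ (q = c ∨ P q) := ⟨c, hn, Or.inl rfl⟩
  refine ⟨Nat.find hex, (Nat.find_spec hex).1, Nat.find_min' hex ⟨hn, Or.inl rfl⟩, 
    (Nat.find_spec hex).2, fun j h1 h2 h3 => Nat.find_min hex h2 ⟨h1, Or.inr h3⟩⟩

theorem Id_dep {A : Type u} [CommRing A] [IsDomain A] {K : Type*} [Field K] [Infinite K] [Algebra K A]
    {m c : ℕ} (𝔐 : Ideal (MvPolynomial (Fin m × Fin c) A)) (hX : ∀ p, X p ∈ 𝔐) (e : ℕ)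
    (he : Dep 𝔐 e (MvPolynomial (Fin m × Fin c) A ⧸ 
      RingHom.ker (constantCoeff (σ := Fin m × Fin c) (R := A)))) (r : ℕ) :
    ∀ i0, i0 + r = m → ∀ ρ, Adm ρ → 
      Dep 𝔐 (e + DD c r 0 ρ) (MvPolynomial (Fin m × Fin c) A ⧸ Id A m c i0 0 ρ) := by
  induction r with
  | zero =>
    intro i0 hi0 ρ hρ
    rw [DD_zero, Id_bot (by omega)]
    exact he
  | succ r ih =>
    intro i0 hi0
    have hi0' : i0 < m := by omega
    have main : ∀ k n, n ≤ c → c - n = k → ∀ ρ, Adm ρ → 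
        (n = c ∨ ρ (n + 1) = ρ n + 1 ∨ r + 1 ≤ ρ n) → 
        Dep 𝔐 (e + DD c (r + 1) n ρ) (MvPolynomial (Fin m × Fin c) A ⧸ Id A m c i0 n ρ) := by
      intro k
      induction k using Nat.strong_induction_on with
      | _ k ihk =>
      intro n hn hk ρ hρ hst
      by_cases hnc : n = c
      · subst hnc
        rw [DD_end, Id_end le_rfl]
        exact ih (i0 + 1) (by omega) ρ hρ
      have hst := hst.resolve_left hnc
      have hn : n < c := by omega
      have hst' : ρ (n + 1) = ρ n + 1 ∨ m - i0 ≤ ρ n := by omega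
      rw [DD_succ hn (by omega) ρ hst, ← add_assoc]
      have hrad := Id_isRadical (A := A) (c := c) (K := K) (r + 1) i0 hi0
      refine dep_quot_sup_span (hX (⟨i0, hi0'⟩, ⟨n, hn⟩)) (fun f hf => 
        hrad n ρ hρ (nzd_rad (K := K) hi0' hn hρ hst' f (Ideal.le_radical hf))) ?_
      rw [← Id_succ]
      by_cases hst2 : n + 1 = c ∨ ρ (n + 1 + 1) = ρ (n + 1) + 1 ∨ r + 1 ≤ ρ (n + 1)
      · exact ihk (c - (n + 1)) (by omega) (n + 1) (by omega) rfl ρ hρ hst2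
      · push Not at hst2
        obtain ⟨h1, h2, h3⟩ := hst2
        have hp : ρ (n + 1) = ρ n + 1 := by
          refine hst.resolve_right fun h => ?_
          have := hρ.mono n
          omega
        have hnp : ρ (n + 2) = ρ (n + 1) := by
          have := hρ.mono (n + 1)
          have := hρ.step (n + 1)
          simp only [add_assoc] at *
          norm_num at *
          omega
        obtain ⟨q, hq1, hq2, hq3, hq4⟩ := exists_next c (n + 1) (by omega) 
          (fun q => ρ (q + 1) = ρ q + 1)
        have hnq : n + 1 < q := by
          rcases hq3 with h | h
          · omega
          · by_contra hcon
            have : q = n + 1 := by omega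
            subst this
            exact h2 h
        have hconst : ∀ j, n + 1 ≤ j → j ≤ q → ρ j = ρ (n + 1) := by
          intro j hj
          induction j, hj using Nat.le_induction with
          | base => intro _; rfl
          | succ j hj ihj =>
            intro hjq
            have a1 := ihj (by omega)
            have a2 := hq4 j hj (by omega)
            have a3 := hρ.mono j
            have a4 := hρ.step j
            omega
        set ρ' := modRk n (n + 1) ρ with hρ'def
        have hρ' : Adm ρ' := hρ.modRk hp rfl hnp
        have hI' := ihk (c - (n + 1)) (by omega) (n + 1) (by omega) rfl ρ' hρ' (by
          right; left
          simp only [hρ'def, modRk]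
          rw [if_neg (by omega), if_pos (by omega), hnp]; omega)
        have hJ := ihk (c - q) (by omega) q (by omega) rfl ρ hρ (by tauto)
        have hS := ihk (c - q) (by omega) q (by omega) rfl ρ' hρ' (by
          rcases hq3 with h | h
          · exact Or.inl h
          · right; left
            simp only [hρ'def, modRk]
            rw [if_neg (by omega), if_neg (by omega)]; exact h)
        have hDJ : DD c (r + 1) (n + 1) ρ = DD c (r + 1) q ρ := by
          refine DD_jump (by omega) (by omega) ρ fun j hj1 hj2 => ⟨hq4 j hj1 hj2, ?_⟩
          have := hconst j hj1 hj2.le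
          omega
        have hDI : DD c (r + 1) (n + 1) ρ' = DD c (r + 1) (n + 1) ρ := 
          DD_mod (by omega) hp hnp (by omega)
        have hDS : DD c (r + 1) (n + 1) ρ' = DD c (r + 1) q ρ' + 1 := by
          rw [DD_succ (n := n + 1) (by omega) (by omega) ρ' (by
            left
            simp only [hρ'def, modRk]
            rw [if_neg (by omega), if_pos (by omega), hnp]; omega)]
          rw [DD_jump (n := n + 1 + 1) (q := q) (by omega) (by omega) ρ' fun j hj1 hj2 => ?_]
          have := hconst j (by omega) hj2.le
          have := hq4 j (by omega) hj2
          simp only [hρ'def, modRk]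
          rw [if_neg (by omega), if_neg (by omega)]
          exact ⟨this, by omega⟩
        have hinf : Id A m c i0 (n + 1) ρ = Id A m c i0 (n + 1) ρ' ⊓ Id A m c i0 q ρ := by
          apply le_antisymm
          · exact le_inf (Id_mono_n le_rfl (modRk_le ρ _ _)) (Id_mono_n (by omega) fun _ => le_rfl)
          · rintro f ⟨hf1, hf2⟩
            refine hrad (n + 1) ρ hρ ⟨2, ?_⟩
            rw [pow_two]
            have hcol : Id A m c i0 q ρ ≤ 
                (Id A m c i0 (n + 1) ρ).colon (Id A m c i0 (n + 1) ρ' : Set _) := by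
              conv_lhs => rw [Id]
              rw [Ideal.span_le]
              rintro x (⟨i, j, hij, rfl⟩ | hx)
              · rw [SetLike.mem_coe, Submodule.mem_colon]
                intro y hy
                rw [smul_eq_mul]
                by_cases hlow : i.val < i0 ∨ (i.val = i0 ∧ j.val < n + 1)
                · exact Ideal.mul_mem_right _ _ (X_mem_Id i j hlow)
                · have hi : i = ⟨i0, hi0'⟩ := Fin.ext (by simp; omega)
                  subst hi
                  refine mul_mem_Id hi0' j.2 (by omega) ?_ (modRk_cond hρ hp rfl) hy
                  exact hconst _ (by omega) (by simp at hij; omega)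
              · rw [SetLike.mem_coe, Submodule.mem_colon]
                intro y hy
                rw [smul_eq_mul]
                exact Ideal.mul_mem_right _ _ (Ideal.subset_span (Or.inr hx))
            exact Submodule.mem_colon.1 (hcol hf2) f hf1
        rw [hinf]
        have hgoal : e + DD c (r + 1) (n + 1) ρ = (e + DD c (r + 1) q ρ') + 1 := by omega
        rw [hgoal]
        refine dep_inf ?_ ?_ ?_
        · rw [← hgoal, ← hDI]; exact hI'
        · rw [← hgoal, hDJ]; exact hJ
        · rw [Id_sup (by omega) (modRk_le ρ _ _)]; exact hS
    intro ρ hρ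
    obtain ⟨q, hq1, hq2, hq3, hq4⟩ := exists_next c 0 (by omega) 
          (fun q => ρ (q + 1) = ρ q + 1)
    have hconst : ∀ j, j ≤ q → ρ j = 0 := by
      intro j
      induction j with
      | zero => intro _; exact hρ.zero
      | succ j ihj =>
        intro hjq
        have a1 := ihj (by omega)
        have a2 := hq4 j (by omega) (by omega)
        have a3 := hρ.mono j
        have a4 := hρ.step j
        omega
    rw [Id_zero_jump hq1 (hconst q le_rfl), DD_jump (q := q) (by omega) hq1]
    · exact main _ q hq2 rfl ρ hρ (by tauto)
    · intro j _ hj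
      exact ⟨hq4 j (by omega) hj, by rw [hconst j hj.le]; omega⟩

end DetCM

namespace DetCM
open MvPolynomial
universe u

theorem adm_min (k : ℕ) : Adm (fun j => min j k) :=
  ⟨by simp, fun j => by omega, fun j => by omega⟩

theorem Id_eq_detIdeal {A : Type*} [CommRing A] {m c t : ℕ} (ht : 1 ≤ t) (htc : t ≤ c) :
    Id A m c 0 0 (fun j => min j (t - 1)) = detIdeal t (genM A m c) := by
  apply le_antisymm
  · rw [Id, Ideal.span_le]
    rintro p (⟨i, j, hij, rfl⟩ | ⟨j, f, g, hg, rfl⟩)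
    · omega
    · by_cases hj : t - 1 ≤ j
      · have key := laplace_mem (genM A m c) (detIdeal t (genM A m c)) (fun _ => True) t 
          (fun f g _ => Ideal.subset_span ⟨f, g, rfl⟩) (min j (t - 1) + 1) (by omega)
        exact key f g fun _ => trivial
      · have : ¬ Function.Injective g := by
          intro hinj
          have hinj' : Function.Injective (fun k => (⟨(g k).val, hg k⟩ : Fin j)) := by
            intro a b hab
            apply hinj
            apply Fin.ext
            simpa using hab
          have := Fintype.card_le_of_injective _ hinj'
          simp only [Fintype.card_fin] at this
          omega
        rw [Function.Injective] at this
        push Not at this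
        obtain ⟨a, b, hab, hne⟩ := this
        rw [Matrix.det_zero_of_column_eq hne (fun k => by simp [hab])]
        exact Ideal.zero_mem _
  · rw [detIdeal, Ideal.span_le]
    rintro _ ⟨f, g, rfl⟩
    exact minor_mem_Id c t (by omega) f g fun q => (g q).2

theorem DD_min {m c t : ℕ} (ht : 1 ≤ t) (htc : t ≤ c) (htm : t ≤ m) :
    DD c m 0 (fun j => min j (t - 1)) + (m - t + 1) * (c - t + 1) = m * c := by
  obtain ⟨k, rfl⟩ : ∃ k, t = k + 1 := ⟨t - 1, by omega⟩
  obtain ⟨a, rfl⟩ : ∃ a, c = k + 1 + a := ⟨c - (k + 1), by omega⟩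
  obtain ⟨b, rfl⟩ : ∃ b, m = k + 1 + b := ⟨m - (k + 1), by omega⟩
  have : DD (k + 1 + a) (k + 1 + b) 0 (fun j => min j (k + 1 - 1)) = 
      k * (k + 1 + b) + (1 + a) * k := by
    rw [DD, add_assoc, Finset.sum_range_add]
    congr 1
    · rw [Finset.sum_congr rfl (g := fun _ => k + 1 + b), Finset.sum_const, Finset.card_range, 
        smul_eq_mul]
      intro j hj
      rw [Finset.mem_range] at hj
      simp only [wt]
      rw [if_pos (by omega), if_neg (by omega)]
    · rw [Finset.sum_congr rfl (g := fun _ => k), Finset.sum_const, Finset.card_range, 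
        smul_eq_mul]
      intro j hj
      simp only [wt]
      rw [if_neg (by omega), if_neg (by omega)]
      omega
  rw [this]
  simp only [Nat.add_sub_cancel_left]
  ring

theorem detIdeal_gen_dep {A : Type u} [CommRing A] [IsDomain A] {K : Type*} [Field K] [Infinite K]
    [Algebra K A] {m c t : ℕ} (ht : 1 ≤ t) (htc : t ≤ c) (htm : t ≤ m) 
    (𝔐 : Ideal (MvPolynomial (Fin m × Fin c) A)) (hX : ∀ p, X p ∈ 𝔐) (e : ℕ)
    (he : Dep 𝔐 e (MvPolynomial (Fin m × Fin c) A ⧸ 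
      RingHom.ker (constantCoeff (σ := Fin m × Fin c) (R := A)))) :
    ∃ d, d + (m - t + 1) * (c - t + 1) = m * c ∧ 
      Dep 𝔐 (e + d) (MvPolynomial (Fin m × Fin c) A ⧸ detIdeal t (genM A m c)) := by
  refine ⟨_, DD_min ht htc htm, ?_⟩
  rw [← Id_eq_detIdeal ht htc]
  exact Id_dep (K := K) 𝔐 hX e he m 0 (by omega) _ (adm_min _)
end DetCM

namespace DetCM
open CategoryTheory CategoryTheory.Abelian
universe u

section
variable {R : Type u} [CommRing R] {𝔐 : Ideal R}
variable {M M₁ M₂ M₃ : Type u} [AddCommGroup M] [Module R M] [AddCommGroup M₁] [Module R M₁]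
  [AddCommGroup M₂] [Module R M₂] [AddCommGroup M₃] [Module R M₃]

theorem dep_down {d : ℕ} (f : M₁ →ₗ[R] M₂) (g : M₂ →ₗ[R] M₃)
    (hf : Function.Injective f) (hfg : Function.Exact f g) (hg : Function.Surjective g)
    (h₁ : Dep 𝔐 (d + 1) M₁) (h₂ : Dep 𝔐 d M₂) : Dep 𝔐 d M₃ := by
  intro i hi
  let S : ShortComplex (ModuleCat.{u} R) :=
    ModuleCat.shortComplexOfCompEqZero f g hfg.linearMap_comp_eq_zero
  have hS : S.ShortExact := ModuleCat.shortComplex_shortExact S hfg hf hg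
  refine subsingleton_of_forall_eq 0 fun x => ?_
  have h1 := h₁ (i + 1) (by omega)
  have hx : x.comp hS.extClass rfl = 0 := @Subsingleton.elim _ h1 _ _
  obtain ⟨y, hy⟩ := Ext.covariant_sequence_exact₃ _ hS x rfl hx
  have h2 := h₂ i hi
  have : y = 0 := @Subsingleton.elim _ h2 _ _
  rw [← hy, this]; simp

theorem dep_quot_down {d : ℕ} {I : Ideal R} {x : R}
    (hreg : ∀ f, x * f ∈ I → f ∈ I) (h : Dep 𝔐 (d + 1) (R ⧸ I)) :
    Dep 𝔐 d (R ⧸ (I ⊔ Ideal.span {x})) := by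
  have hle : I ≤ I ⊔ Ideal.span {x} := le_sup_left
  refine dep_down (LinearMap.lsmul R (R ⧸ I) x) (Submodule.factor hle) ?_ ?_ 
    (Submodule.factor_surjective hle) h (h.mono (by omega))
  · refine isSMulRegular_iff_right_eq_zero_of_smul.2 ?_
    intro f
    obtain ⟨f, rfl⟩ := Ideal.Quotient.mk_surjective f
    intro hf
    rw [Ideal.Quotient.eq_zero_iff_mem]
    apply hreg
    rw [← Ideal.Quotient.eq_zero_iff_mem]
    exact hf
  · intro f
    obtain ⟨f, rfl⟩ := Ideal.Quotient.mk_surjective f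
    change Ideal.Quotient.mk (I ⊔ Ideal.span {x}) f = 0 ↔ _
    rw [Ideal.Quotient.eq_zero_iff_mem]
    constructor
    · intro hf
      obtain ⟨i, hi, y, hy, rfl⟩ := Submodule.mem_sup.1 hf
      obtain ⟨g, rfl⟩ := Ideal.mem_span_singleton.1 hy
      refine ⟨Ideal.Quotient.mk I g, ?_⟩
      change Ideal.Quotient.mk I (x * g) = _
      rw [Ideal.Quotient.mk_eq_mk_iff_sub_mem]
      simpa using I.neg_mem hi
    · rintro ⟨g, hg⟩
      obtain ⟨g, rfl⟩ := Ideal.Quotient.mk_surjective g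
      have : Ideal.Quotient.mk I (x * g) = Ideal.Quotient.mk I f := hg
      rw [Ideal.Quotient.mk_eq_mk_iff_sub_mem] at this
      have h2 : f = - (x * g - f) + x * g := by ring
      rw [h2]
      exact Ideal.add_mem _ (Ideal.mem_sup_left (I.neg_mem this)) 
        (Ideal.mem_sup_right (Ideal.mem_span_singleton.2 ⟨g, rfl⟩))

end

section local_
variable {W : Type u} [CommRing W] [IsLocalRing W] [IsNoetherianRing W]

theorem smul_top_lt {R : Type u} [CommRing R] (𝔐 J : Ideal R) (hM : 𝔐 ≠ ⊤) (hJ : J ≤ 𝔐) : 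
    𝔐 • (⊤ : Submodule R (R ⧸ J)) < ⊤ := by
  rw [lt_top_iff_ne_top]
  intro h
  have h1 : (𝔐 • (⊤ : Submodule R (R ⧸ J))).map (Submodule.factor hJ) = ⊥ := by
    rw [Submodule.map_smul'', eq_bot_iff, Submodule.smul_le]
    intro r hr n hn
    obtain ⟨n, rfl⟩ := Ideal.Quotient.mk_surjective n
    rw [Submodule.mem_bot]
    change Ideal.Quotient.mk 𝔐 (r * n) = 0
    rw [Ideal.Quotient.eq_zero_iff_mem]
    exact Ideal.mul_mem_right _ _ hr
  rw [h, Submodule.map_top, LinearMap.range_eq_top.2 (Submodule.factor_surjective hJ)] at h1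
  have h2 : (Ideal.Quotient.mk 𝔐 1) ∈ (⊤ : Submodule R (R ⧸ 𝔐)) := trivial
  rw [h1, Submodule.mem_bot, Ideal.Quotient.eq_zero_iff_mem] at h2
  exact hM ((Ideal.eq_top_iff_one _).2 h2)

theorem exists_nzd_of_dep {J : Ideal W} (hJ : J ≠ ⊤) {d : ℕ} 
    (h : Dep (IsLocalRing.maximalIdeal W) (d + 1) (W ⧸ J)) :
    ∃ x ∈ IsLocalRing.maximalIdeal W, ∀ f, x * f ∈ J → f ∈ J := by
  obtain ⟨rs, hl, hm, hr⟩ := exists_regular_of_dep (smul_top_lt _ J 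
    (IsLocalRing.maximalIdeal.isMaximal W).ne_top (IsLocalRing.le_maximalIdeal hJ)) h
  rcases rs with _ | ⟨x, rs⟩
  · simp at hl
  · refine ⟨x, hm x (by simp), fun f hf => ?_⟩
    have h1 := ((RingTheory.Sequence.isRegular_cons_iff _ _ _).1 hr).1
    have := isSMulRegular_iff_right_eq_zero_of_smul.1 h1 (Ideal.Quotient.mk J f) 
      (by change Ideal.Quotient.mk J (x * f) = 0; rwa [Ideal.Quotient.eq_zero_iff_mem])
    rwa [Ideal.Quotient.eq_zero_iff_mem] at this

theorem mem_ass_quot {J P : Ideal W} (h : IsAssociatedPrime P (W ⧸ J)) :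
    P.IsPrime ∧ ∃ f, f ∉ J ∧ ∀ a, a ∈ P ↔ a * f ∈ J := by
  refine ⟨h.isPrime, ?_⟩
  obtain ⟨f, hf⟩ := (isAssociatedPrime_iff.1 h).2
  obtain ⟨f, rfl⟩ := Ideal.Quotient.mk_surjective f
  have key : ∀ a, a ∈ P ↔ a * f ∈ J := by
    intro a
    rw [hf, Submodule.mem_colon_singleton, Submodule.mem_bot]
    change Ideal.Quotient.mk J (a * f) = 0 ↔ _
    rw [Ideal.Quotient.eq_zero_iff_mem]
  refine ⟨f, fun hfJ => h.isPrime.ne_top ?_, key⟩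
  rw [Ideal.eq_top_iff_one, key]; simpa using hfJ

theorem exists_ass_of_mul {J : Ideal W} {g : W} (hg : g ∉ J) : 
    ∃ P : Ideal W, IsAssociatedPrime P (W ⧸ J) ∧ ∀ a, a * g ∈ J → a ∈ P := by
  obtain ⟨P, hP, hle⟩ := exists_le_isAssociatedPrime_of_isNoetherianRing (R := W) (M := W ⧸ J)
    (Ideal.Quotient.mk J g) (by rwa [Ne, Ideal.Quotient.eq_zero_iff_mem])
  refine ⟨P, hP, fun a ha => hle ?_⟩
  rw [Submodule.mem_colon_singleton, Submodule.mem_bot]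
  change Ideal.Quotient.mk J (a * g) = 0
  rwa [Ideal.Quotient.eq_zero_iff_mem]

theorem dep_le_dim_ass (d : ℕ) : ∀ (J : Ideal W), Dep (IsLocalRing.maximalIdeal W) d (W ⧸ J) → 
    ∀ P : Ideal W, IsAssociatedPrime P (W ⧸ J) → (d : WithBot ℕ∞) ≤ ringKrullDim (W ⧸ P) := by
  induction d with
  | zero =>
    intro J _ P hP
    have := hP.isPrime
    have : Nontrivial (W ⧸ P) := Ideal.Quotient.nontrivial_iff.2 hP.isPrime.ne_top
    simpa using ringKrullDim_nonneg_of_nontrivial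
  | succ d ih =>
    intro J hJ P hP
    obtain ⟨hPp, f, hfJ, hPf⟩ := mem_ass_quot hP
    have hJt : J ≠ ⊤ := by rintro rfl; exact hfJ trivial
    obtain ⟨x, hx, hreg⟩ := exists_nzd_of_dep hJt hJ
    have hdown := dep_quot_down hreg hJ
    have hxP : x ∉ P := fun h => hfJ (hreg f ((hPf x).1 h))
    let N : Ideal W := J.colon (P : Set W)
    have hN : ∀ g, g ∈ N ↔ ∀ a ∈ P, a * g ∈ J := by
      intro g
      simp only [N, Submodule.mem_colon, smul_eq_mul, SetLike.mem_coe]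
      exact forall₂_congr fun a _ => by rw [mul_comm]
    have hex : ∃ g ∈ N, g ∉ J ⊔ Ideal.span {x} := by
      by_contra! hcon
      have hNle : N ≤ J ⊔ (IsLocalRing.maximalIdeal W) • N := by
        intro g hg
        obtain ⟨i, hi, y, hy, rfl⟩ := Submodule.mem_sup.1 (hcon g hg)
        obtain ⟨h, rfl⟩ := Ideal.mem_span_singleton.1 hy
        refine Submodule.add_mem_sup hi (Submodule.smul_mem_smul hx ?_)
        rw [hN] at hg ⊢
        intro a ha
        apply hreg
        have h1 := J.sub_mem (hg a ha) (J.mul_mem_left a hi)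
        have h2 : a * (i + x * h) - a * i = x * (a * h) := by ring
        rwa [h2] at h1
      have hNJ : N ≤ J := Submodule.le_of_le_smul_of_le_jacobson_bot (IsNoetherian.noetherian N) 
        (IsLocalRing.maximalIdeal_le_jacobson _) hNle
      exact hfJ (hNJ ((hN f).2 fun a ha => (hPf a).1 ha))
    obtain ⟨g, hgN, hg⟩ := hex
    obtain ⟨Q, hQ, hQa⟩ := exists_ass_of_mul hg
    have hPQ : P ≤ Q := fun a ha => hQa a (Ideal.mem_sup_left ((hN g).1 hgN a ha))
    have hxQ : x ∈ Q := hQa x (Ideal.mem_sup_right (Ideal.mem_span_singleton.2 ⟨g, rfl⟩))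
    have h1 := ih _ hdown Q hQ
    have h2 := ringKrullDim_succ_le_of_surjective (Ideal.Quotient.factor hPQ) 
      (Ideal.Quotient.factor_surjective hPQ) (r := Ideal.Quotient.mk P x) 
      (mem_nonZeroDivisors_of_ne_zero (by rwa [Ne, Ideal.Quotient.eq_zero_iff_mem])) 
      (by rw [Ideal.Quotient.factor_mk, Ideal.Quotient.eq_zero_iff_mem]; exact hxQ)
    refine le_trans ?_ h2
    push_cast
    gcongr

theorem dim_quot_le_aux {S : Type*} [CommRing S] (J : Ideal S) (z : S) (I' : Ideal (S ⧸ J))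
    (hI : Ideal.Quotient.mk J z ∈ I') :
    ringKrullDim ((S ⧸ J) ⧸ I') ≤ ringKrullDim (S ⧸ (J ⊔ Ideal.span {z})) := by
  have h : ∀ a ∈ J ⊔ Ideal.span {z}, (Ideal.Quotient.mk I').comp (Ideal.Quotient.mk J) a = 0 := by
    intro a ha
    obtain ⟨i, hi, y, hy, rfl⟩ := Submodule.mem_sup.1 ha
    obtain ⟨h, rfl⟩ := Ideal.mem_span_singleton.1 hy
    rw [RingHom.comp_apply, map_add, Ideal.Quotient.eq_zero_iff_mem.2 hi, zero_add, 
      Ideal.Quotient.eq_zero_iff_mem, map_mul]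
    exact Ideal.mul_mem_right _ _ hI
  refine ringKrullDim_le_of_surjective (Ideal.Quotient.lift _ _ h) ?_
  intro y
  obtain ⟨y, rfl⟩ := Ideal.Quotient.mk_surjective y
  obtain ⟨y, rfl⟩ := Ideal.Quotient.mk_surjective y
  exact ⟨Ideal.Quotient.mk _ y, by rw [Ideal.Quotient.lift_mk]; rfl⟩

theorem dim_quot_le_succ (J : Ideal W) {z : W} (hz : z ∈ IsLocalRing.maximalIdeal W) :
    ringKrullDim (W ⧸ J) ≤ ringKrullDim (W ⧸ (J ⊔ Ideal.span {z})) + 1 := by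
  have hs : (({Ideal.Quotient.mk J z} : Finset (W ⧸ J)) : Set (W ⧸ J)) ⊆ 
      (Ring.jacobson (W ⧸ J) : Set (W ⧸ J)) := by
    simp only [Finset.coe_singleton, Set.singleton_subset_iff, SetLike.mem_coe]
    rcases subsingleton_or_nontrivial (W ⧸ J) with h | h
    · rw [Subsingleton.elim (Ideal.Quotient.mk J z) 0]; exact Ideal.zero_mem _
    · have : IsLocalRing (W ⧸ J) := 
        IsLocalRing.of_surjective' (Ideal.Quotient.mk J) Ideal.Quotient.mk_surjective
      rw [IsLocalRing.ringJacobson_eq_maximalIdeal]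
      have : IsLocalHom (Ideal.Quotient.mk J) := 
        IsLocalHom.of_surjective (Ideal.Quotient.mk J) Ideal.Quotient.mk_surjective
      exact (IsLocalRing.mem_maximalIdeal _).2 fun hu => hz (isUnit_of_map_unit _ _ hu)
  have h1 := ringKrullDim_le_ringKrullDim_quotient_add_card (R := W ⧸ J) _ hs
  rw [Finset.card_singleton, Nat.cast_one] at h1
  exact h1.trans (add_le_add_left (dim_quot_le_aux J z _ (Ideal.subset_span (by simp))) _)

theorem dep_spec (d : ℕ) (zs : List W) : ∀ (J : Ideal W), 
    (∀ z ∈ zs, z ∈ IsLocalRing.maximalIdeal W) → 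
    Dep (IsLocalRing.maximalIdeal W) (d + zs.length) (W ⧸ J) → 
    ringKrullDim (W ⧸ (J ⊔ Ideal.ofList zs)) ≤ d → 
    Dep (IsLocalRing.maximalIdeal W) d (W ⧸ (J ⊔ Ideal.ofList zs)) := by
  have hdim : ∀ (zs : List W) (J : Ideal W), (∀ z ∈ zs, z ∈ IsLocalRing.maximalIdeal W) → 
      ringKrullDim (W ⧸ J) ≤ ringKrullDim (W ⧸ (J ⊔ Ideal.ofList zs)) + zs.length := by
    intro zs
    induction zs with
    | nil => intro J _; rw [Ideal.ofList_nil, sup_bot_eq]; simp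
    | cons z zs ih =>
      intro J hz
      have h1 := ih (J ⊔ Ideal.span {z}) fun y hy => hz y (by simp [hy])
      rw [Ideal.ofList_cons, ← sup_assoc]
      refine (dim_quot_le_succ J (hz z (by simp))).trans ?_
      rw [List.length_cons]
      push_cast
      rw [← add_assoc]
      gcongr
  induction zs with
  | nil => intro J _ h _; rw [Ideal.ofList_nil, sup_bot_eq]; exact h
  | cons z zs ih =>
    intro J hz hJ hd
    rw [Ideal.ofList_cons, ← sup_assoc] at hd ⊢
    have hz' : ∀ y ∈ zs, y ∈ IsLocalRing.maximalIdeal W := fun y hy => hz y (by simp [hy])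
    refine ih _ hz' ?_ hd
    rw [List.length_cons, ← add_assoc] at hJ
    refine dep_quot_down ?_ hJ
    intro f hf
    by_contra hfJ
    obtain ⟨P, hP, hPa⟩ := exists_ass_of_mul hfJ
    have h1 := dep_le_dim_ass _ J hJ P hP
    have hJP : J ⊔ Ideal.span {z} ≤ P := by
      refine sup_le (fun a ha => hPa a (J.mul_mem_right _ ha)) ?_
      rw [Ideal.span_singleton_le_iff_mem]; exact hPa z hf
    have h2 := ringKrullDim_le_of_surjective _ (Ideal.Quotient.factor_surjective hJP)
    have h3 := hdim zs (J ⊔ Ideal.span {z}) hz'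
    have h4 : (((d + zs.length + 1 : ℕ) : ℕ∞) : WithBot ℕ∞) ≤ ((d + zs.length : ℕ) : ℕ∞) := by
      refine (h1.trans (h2.trans (h3.trans (add_le_add_left hd _)))).trans (le_of_eq ?_)
      push_cast; rfl
    norm_cast at h4
    omega
end local_
end DetCM

namespace DetCM
open MvPolynomial RingTheory.Sequence
universe u

theorem reg_iff {W B : Type*} [CommRing W] [CommRing B] (π : W →+* B) 
    (hπ : Function.Surjective π) (J : Ideal W) (hJ : RingHom.ker π = J) (ws : List W) :
    IsRegular (W ⧸ J) ws ↔ IsRegular B (ws.map π) := by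
  subst hJ
  let e := (RingHom.quotientKerEquivOfSurjective hπ).toAddEquiv
  refine e.isRegular_congr ?_
  rw [List.forall₂_map_right_iff, List.forall₂_same]
  intro r _ x
  obtain ⟨x, rfl⟩ := Ideal.Quotient.mk_surjective x
  exact map_mul π r x

theorem wreg_loc {R W : Type u} [CommRing R] [CommRing W] [Algebra R W]
    (𝔐 : Ideal R) [𝔐.IsPrime] [IsLocalization.AtPrime W 𝔐] (J : Ideal R)
    (rs : List R) (hr : IsWeaklyRegular (R ⧸ J) rs) :
    IsWeaklyRegular (W ⧸ J.map (algebraMap R W)) (rs.map (algebraMap R W)) := by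
  have h := hr.of_isLocalizedModule W 𝔐.primeCompl 
    (Submodule.toLocalizedQuotient' W 𝔐.primeCompl (Algebra.linearMap R W) J)
  rwa [Ideal.localized'_eq_map] at h

/-- localisation of depth -/
theorem dep_loc {R W : Type u} [CommRing R] [CommRing W] [Algebra R W] [IsNoetherianRing R]
    (𝔐 : Ideal R) [𝔐.IsPrime] [IsLocalization.AtPrime W 𝔐] [IsLocalRing W] (J : Ideal R) (hJ : J ≤ 𝔐)
    (d : ℕ) (h : Dep 𝔐 d (R ⧸ J)) :
    Dep (IsLocalRing.maximalIdeal W) d (W ⧸ J.map (algebraMap R W)) := by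
  have : IsNoetherianRing W := IsLocalization.isNoetherianRing 𝔐.primeCompl W inferInstance
  obtain ⟨rs, hl, hm, hr⟩ := exists_regular_of_dep (smul_top_lt _ J 
    (Ideal.IsPrime.ne_top inferInstance) hJ) h
  have hne : J.map (algebraMap R W) ≤ IsLocalRing.maximalIdeal W := by
    rw [Ideal.map_le_iff_le_comap]
    intro x hx
    rw [Ideal.mem_comap, IsLocalization.AtPrime.to_map_mem_maximal_iff W 𝔐]
    exact hJ hx
  have hnt : Nontrivial (W ⧸ J.map (algebraMap R W)) := Ideal.Quotient.nontrivial_iff.2 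
    (ne_top_of_le_ne_top (IsLocalRing.maximalIdeal.isMaximal W).ne_top hne)
  have hmem : ∀ r ∈ rs.map (algebraMap R W), r ∈ IsLocalRing.maximalIdeal W := by
    intro y hy
    obtain ⟨z, hz, rfl⟩ := List.mem_map.1 hy
    rw [IsLocalization.AtPrime.to_map_mem_maximal_iff W 𝔐]
    exact hm z hz
  have hw := wreg_loc (W := W) 𝔐 J rs hr.toIsWeaklyRegular
  have hlt := smul_top_lt _ _ (IsLocalRing.maximalIdeal.isMaximal W).ne_top hne
  have hfin := dep_of_regular hlt _ hmem 
    ((IsLocalRing.isRegular_iff_isWeaklyRegular_of_subset_maximalIdeal hmem).2 hw)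
  have hl' : (rs.map (algebraMap R W)).length = d := by rw [List.length_map, hl]
  exact hfin.mono hl'.ge
end DetCM

namespace DetCM
open MvPolynomial RingTheory.Sequence
universe u

theorem sub_C_eval_mem {A : Type*} [CommRing A] {σ : Type*} (f : σ → A) (Z : Ideal (MvPolynomial σ A))
    (hZ : ∀ p, X p - C (f p) ∈ Z) (r : MvPolynomial σ A) : r - C (eval f r) ∈ Z := by
  have h : Ideal.Quotient.mk Z = ((Ideal.Quotient.mk Z).comp C).comp (eval f) := by
    apply MvPolynomial.ringHom_ext
    · intro a; simp
    · intro i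
      simp only [RingHom.comp_apply, eval_X]
      exact (Ideal.Quotient.mk_eq_mk_iff_sub_mem _ _).2 (hZ i)
  exact (Ideal.Quotient.mk_eq_mk_iff_sub_mem _ _).1 (congrArg (fun g => g r) h)

theorem eval_sub_constantCoeff_mem {A : Type*} [CommRing A] {σ : Type*} (f : σ → A) (Z : Ideal A)
    (hZ : ∀ p, f p ∈ Z) (r : MvPolynomial σ A) : eval f r - constantCoeff r ∈ Z := by
  have h : (Ideal.Quotient.mk Z).comp (eval f) = (Ideal.Quotient.mk Z).comp constantCoeff := by
    apply MvPolynomial.ringHom_ext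
    · intro a; simp
    · intro i
      simpa [RingHom.comp_apply, eval_X] using Ideal.Quotient.eq_zero_iff_mem.2 (hZ i)
  exact (Ideal.Quotient.mk_eq_mk_iff_sub_mem _ _).1 (congrArg (fun g => g r) h)

theorem spec_local_aux {A : Type u} [CommRing A] [IsLocalRing A] [IsNoetherianRing A]
    {σ : Type} [Fintype σ] (f : σ → A) (hf : ∀ p, f p ∈ IsLocalRing.maximalIdeal A)
    (𝔐 : Ideal (MvPolynomial σ A)) 
    (h𝔐 : 𝔐 = (IsLocalRing.maximalIdeal A).comap constantCoeff)
    (hprime : 𝔐.IsPrime) (W : Type u) [CommRing W] [Algebra (MvPolynomial σ A) W] 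
    [IsLocalization.AtPrime W 𝔐] [IsLocalRing W] [IsNoetherianRing W]
    (J : Ideal (MvPolynomial σ A)) (hJ : J ≤ 𝔐) (d : ℕ) (I : Ideal A) (J' : Ideal W)
    (hI : I = J.map (eval f)) (hJ' : J' = J.map (algebraMap _ W))
    (hdW : Dep (IsLocalRing.maximalIdeal W) (d + Fintype.card σ) (W ⧸ J'))
    (hdim : ringKrullDim (A ⧸ I) ≤ d) :
    ∃ ws : List A, ws.length = d ∧ (∀ w ∈ ws, w ∈ IsLocalRing.maximalIdeal A) ∧ 
      IsRegular (A ⧸ I) (ws.map (Ideal.Quotient.mk I)) := by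
  have hev : ∀ r, r ∈ 𝔐 ↔ eval f r ∈ IsLocalRing.maximalIdeal A := by
    intro r
    rw [h𝔐, Ideal.mem_comap]
    have := eval_sub_constantCoeff_mem f _ hf r
    constructor
    · intro h; simpa using Ideal.add_mem _ this h
    · intro h; simpa using Ideal.sub_mem _ h this
  have hu : ∀ y : 𝔐.primeCompl, IsUnit (eval f (y : MvPolynomial σ A)) := by
    intro y
    by_contra h
    exact y.2 ((hev _).2 ((IsLocalRing.mem_maximalIdeal _).2 h))
  let π : W →+* A := IsLocalization.lift (M := 𝔐.primeCompl) hu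
  have hπ : ∀ r, π (algebraMap _ W r) = eval f r := fun r => IsLocalization.lift_eq hu r
  have hπs : Function.Surjective π := fun a => ⟨algebraMap _ W (C a), by rw [hπ, eval_C]⟩
  let zs : List W := (Finset.univ : Finset σ).toList.map fun p => algebraMap _ W (X p - C (f p))
  have hzl : zs.length = Fintype.card σ := by simp [zs]
  have hzm : ∀ z ∈ zs, z ∈ IsLocalRing.maximalIdeal W := by
    intro z hz
    obtain ⟨p, _, rfl⟩ := List.mem_map.1 hz
    rw [IsLocalization.AtPrime.to_map_mem_maximal_iff W 𝔐, hev]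
    simp
  have hkerle : ∀ r, eval f r ∈ I → algebraMap _ W r ∈ J' ⊔ Ideal.ofList zs := by
    intro r hr
    obtain ⟨j, hj, hjr⟩ := (Ideal.mem_map_iff_of_surjective (eval f) 
      (fun a => ⟨C a, eval_C a⟩)).1 (hI ▸ hr)
    have h1 := sub_C_eval_mem f ((J' ⊔ Ideal.ofList zs).comap (algebraMap _ W)) (fun p => 
      Ideal.mem_sup_right (Ideal.subset_span (List.mem_map.2 ⟨p, by simp, rfl⟩))) (r - j)
    rw [map_sub, hjr, sub_self, map_zero, sub_zero, Ideal.mem_comap, map_sub] at h1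
    have h2 : algebraMap _ W j ∈ J' ⊔ Ideal.ofList zs := 
      Ideal.mem_sup_left (hJ' ▸ Ideal.mem_map_of_mem _ hj)
    simpa using Ideal.add_mem _ h1 h2
  have hker : RingHom.ker ((Ideal.Quotient.mk I).comp π) = J' ⊔ Ideal.ofList zs := by
    apply le_antisymm
    · intro w hw
      rw [RingHom.mem_ker, RingHom.comp_apply, Ideal.Quotient.eq_zero_iff_mem] at hw
      obtain ⟨r, y, rfl⟩ := IsLocalization.exists_mk'_eq 𝔐.primeCompl w
      have h1 : algebraMap _ W r ∈ J' ⊔ Ideal.ofList zs := by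
        apply hkerle
        rw [← hπ, ← IsLocalization.mk'_spec W r y, map_mul]
        exact Ideal.mul_mem_right _ _ hw
      rw [IsLocalization.mk'_eq_mul_mk'_one]
      exact Ideal.mul_mem_right _ _ h1
    · refine sup_le ?_ ?_
      · rw [hJ', Ideal.map_le_iff_le_comap]
        intro j hj
        rw [Ideal.mem_comap, RingHom.mem_ker, RingHom.comp_apply, Ideal.Quotient.eq_zero_iff_mem, hπ]
        rw [hI]; exact Ideal.mem_map_of_mem _ hj
      · rw [Ideal.ofList, Ideal.span_le]
        intro z hz
        obtain ⟨p, _, rfl⟩ := List.mem_map.1 hz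
        rw [SetLike.mem_coe, RingHom.mem_ker, RingHom.comp_apply, hπ]
        simp
  have hsurj : Function.Surjective ((Ideal.Quotient.mk I).comp π) := 
    Ideal.Quotient.mk_surjective.comp hπs
  have hdimW : ringKrullDim (W ⧸ (J' ⊔ Ideal.ofList zs)) ≤ d := by
    refine le_trans (le_of_eq ?_) hdim
    exact ringKrullDim_eq_of_ringEquiv ((Ideal.quotEquivOfEq hker.symm).trans 
      (RingHom.quotientKerEquivOfSurjective hsurj))
  have hdW' : Dep (IsLocalRing.maximalIdeal W) (d + zs.length) (W ⧸ J') := 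
    hdW.mono (le_of_eq (congrArg (d + ·) hzl))
  clear_value zs
  have hfin := dep_spec d zs J' hzm hdW' hdimW
  have hle : J' ⊔ Ideal.ofList zs ≤ IsLocalRing.maximalIdeal W := by
    refine sup_le ?_ ?_
    · rw [hJ', Ideal.map_le_iff_le_comap]
      intro j hj
      rw [Ideal.mem_comap, IsLocalization.AtPrime.to_map_mem_maximal_iff W 𝔐]
      exact hJ hj
    · rw [Ideal.ofList, Ideal.span_le]; exact hzm
  have hlt := smul_top_lt _ _ (IsLocalRing.maximalIdeal.isMaximal W).ne_top hle
  have hreg := exists_regular_of_dep hlt hfin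
  obtain ⟨ws, hwl, hwm, hwr⟩ := hreg
  refine ⟨ws.map π, by rw [List.length_map, hwl], ?_, ?_⟩
  · intro a ha
    obtain ⟨w, hw, rfl⟩ := List.mem_map.1 ha
    have : IsLocalHom π := IsLocalHom.of_surjective π hπs
    exact (IsLocalRing.mem_maximalIdeal _).2 fun hu' => hwm w hw (isUnit_of_map_unit _ _ hu')
  · rw [List.map_map]
    exact (reg_iff _ hsurj _ hker ws).1 hwr

theorem spec_local {A : Type u} [CommRing A] [IsLocalRing A] [IsNoetherianRing A]
    {σ : Type} [Fintype σ] (f : σ → A) (hf : ∀ p, f p ∈ IsLocalRing.maximalIdeal A)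
    (𝔐 : Ideal (MvPolynomial σ A)) 
    (h𝔐 : 𝔐 = (IsLocalRing.maximalIdeal A).comap constantCoeff)
    (J : Ideal (MvPolynomial σ A)) (hJ : J ≤ 𝔐) (d : ℕ) 
    (hdep : Dep 𝔐 (d + Fintype.card σ) (MvPolynomial σ A ⧸ J)) (I : Ideal A)
    (hI : I = J.map (eval f)) (hdim : ringKrullDim (A ⧸ I) ≤ d) :
    ∃ ws : List A, ws.length = d ∧ (∀ w ∈ ws, w ∈ IsLocalRing.maximalIdeal A) ∧ 
      IsRegular (A ⧸ I) (ws.map (Ideal.Quotient.mk I)) := by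
  have hprime : 𝔐.IsPrime := by rw [h𝔐]; infer_instance
  have hNW : IsNoetherianRing (Localization.AtPrime 𝔐) := 
    IsLocalization.isNoetherianRing 𝔐.primeCompl _ inferInstance
  exact spec_local_aux f hf 𝔐 h𝔐 hprime (Localization.AtPrime 𝔐) J hJ d I _ hI rfl 
    (dep_loc 𝔐 J hJ _ hdep) hdim

end DetCM

namespace DetCM
open MvPolynomial RingTheory.Sequence
universe u

theorem detIdeal_map {A B : Type*} [CommRing A] [CommRing B] (φ : A →+* B) {m n : ℕ} (t : ℕ)
    (M : Matrix (Fin m) (Fin n) A) : (detIdeal t M).map φ = detIdeal t (M.map φ) := by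
  rw [detIdeal, Ideal.map_span, detIdeal]
  congr 1
  ext x
  constructor
  · rintro ⟨_, ⟨f, g, rfl⟩, rfl⟩
    exact ⟨f, g, by rw [RingHom.map_det]; rfl⟩
  · rintro ⟨f, g, rfl⟩
    exact ⟨_, ⟨f, g, rfl⟩, by rw [RingHom.map_det]; rfl⟩

theorem detIdeal_le {A : Type*} [CommRing A] {m n t : ℕ} (ht : 1 ≤ t) 
    (M : Matrix (Fin m) (Fin n) A) (Z : Ideal A) (hM : ∀ i j, M i j ∈ Z) : detIdeal t M ≤ Z := by
  rw [detIdeal, Ideal.span_le]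
  rintro _ ⟨f, g, rfl⟩
  obtain ⟨t, rfl⟩ := Nat.exists_eq_succ_of_ne_zero (by omega : t ≠ 0)
  rw [SetLike.mem_coe, Matrix.det_succ_row_zero]
  refine Ideal.sum_mem _ fun j _ => Ideal.mul_mem_right _ _ (Ideal.mul_mem_left _ _ ?_)
  exact hM _ _

theorem det_local {A : Type u} [CommRing A] [IsDomain A] [IsLocalRing A] [IsNoetherianRing A]
    {K : Type*} [Field K] [Infinite K] [Algebra K A] {m n t : ℕ} (ht : 1 ≤ t) (htn : t ≤ n) 
    (htm : t ≤ m) (M : Matrix (Fin m) (Fin n) A) 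
    (hM : ∀ i j, M i j ∈ IsLocalRing.maximalIdeal A)
    (rs : List A) (hrs : ∀ r ∈ rs, r ∈ IsLocalRing.maximalIdeal A) (hreg : IsRegular A rs) (d : ℕ)
    (hd : d + (m - t + 1) * (n - t + 1) = rs.length)
    (hdim : ringKrullDim (A ⧸ detIdeal t M) ≤ d) :
    ∃ ws : List A, ws.length = d ∧ (∀ w ∈ ws, w ∈ IsLocalRing.maximalIdeal A) ∧ 
      IsRegular (A ⧸ detIdeal t M) (ws.map (Ideal.Quotient.mk (detIdeal t M))) := by
  obtain ⟨𝔐, h𝔐⟩ : ∃ 𝔐 : Ideal (MvPolynomial (Fin m × Fin n) A), 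
    𝔐 = (IsLocalRing.maximalIdeal A).comap constantCoeff := ⟨_, rfl⟩
  have hprime : 𝔐.IsPrime := by rw [h𝔐]; infer_instance
  have hX : ∀ p, X p ∈ 𝔐 := by intro p; rw [h𝔐, Ideal.mem_comap]; simp
  have hcs : Function.Surjective (constantCoeff (σ := Fin m × Fin n) (R := A)) := 
    fun a => ⟨C a, constantCoeff_C _ a⟩
  have hk : RingHom.ker (constantCoeff (σ := Fin m × Fin n) (R := A)) ≤ 𝔐 := by
    intro x hx
    rw [h𝔐, Ideal.mem_comap, hx]; exact Ideal.zero_mem _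
  have hlt := smul_top_lt 𝔐 _ hprime.ne_top hk
  have hmap : (rs.map (C (σ := Fin m × Fin n))).map 
      (constantCoeff (σ := Fin m × Fin n) (R := A)) = rs := by
    rw [List.map_map]
    conv_rhs => rw [← List.map_id rs]
    refine List.map_congr_left fun a _ => constantCoeff_C _ a
  have hreg' := (reg_iff (constantCoeff (σ := Fin m × Fin n) (R := A)) hcs _ rfl (rs.map C)).2 
    (by rw [hmap]; exact hreg)
  have hmem : ∀ r ∈ rs.map (C (σ := Fin m × Fin n)), r ∈ 𝔐 := by
    intro r hr
    obtain ⟨a, ha, rfl⟩ := List.mem_map.1 hr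
    rw [h𝔐, Ideal.mem_comap, constantCoeff_C]; exact hrs a ha
  have he := dep_of_regular hlt _ hmem hreg'
  obtain ⟨d', hd', hdep⟩ := detIdeal_gen_dep (K := K) ht htn htm 𝔐 hX _ he
  have hJ : detIdeal t (genM A m n) ≤ 𝔐 := detIdeal_le ht _ _ fun i j => hX _
  refine spec_local (fun p => M p.1 p.2) (fun p => hM _ _) 𝔐 h𝔐 (detIdeal t (genM A m n)) hJ d 
    (hdep.mono ?_) (detIdeal t M) ?_ hdim
  · rw [List.length_map, Fintype.card_prod, Fintype.card_fin, Fintype.card_fin]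
    omega
  · rw [detIdeal_map]
    congr 1
    ext i j
    simp [genM]
end DetCM

namespace DetCM
open MvPolynomial RingTheory.Sequence
universe u

theorem schur0 {A : Type*} [CommRing A] {k : ℕ} (Q : Matrix (Fin (k+1)) (Fin (k+1)) A) (v : A) 
    (huv : Q 0 0 * v = 1) :
    Q.det = Q 0 0 * (Matrix.of fun i j : Fin k => 
      Q i.succ j.succ - Q i.succ 0 * v * Q 0 j.succ).det := by
  let Q' : Matrix (Fin (k+1)) (Fin (k+1)) A := 
    fun i j => Q i j - (if i = 0 then 0 else Q i 0 * v) * Q 0 j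
  have h1 : Q.det = Q'.det := by
    refine Matrix.det_eq_of_forall_row_eq_smul_add_const 
      (fun i => if i = 0 then 0 else Q i 0 * v) 0 (by simp) ?_
    intro i j
    simp [Q']
  rw [h1, Matrix.det_succ_column_zero, Fin.sum_univ_succ]
  have h2 : ∀ i : Fin k, Q' i.succ 0 = 0 := by
    intro i
    simp only [Q', Fin.succ_ne_zero, if_false]
    linear_combination (- Q i.succ 0) * huv
  simp only [h2, mul_zero, zero_mul, Finset.sum_const_zero, add_zero]
  have h3 : Q' 0 0 = Q 0 0 := by simp [Q']
  rw [h3]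
  simp only [Fin.val_zero, pow_zero, one_mul]
  congr 2

theorem det_add_rank_one_mem {A : Type*} [CommRing A] {t : ℕ} 
    (N : Matrix (Fin (t+1)) (Fin (t+1)) A) (c r : Fin (t+1) → A) (J : Ideal A)
    (hdet : N.det ∈ J) 
    (hJ : ∀ (f g : Fin t → Fin (t+1)), (N.submatrix f g).det ∈ J) :
    (Matrix.of fun i j => N i j + c i * r j).det ∈ J := by
  let Q : Matrix (Fin (t+2)) (Fin (t+2)) A := Matrix.of 
    (Fin.cons (Fin.cons 1 (fun j => - r j)) (fun i => Fin.cons (c i) (N i)))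
  have h := schur0 Q 1 (by simp [Q])
  have h2 : (Matrix.of fun i j => N i j + c i * r j) = (Matrix.of fun i j : Fin (t+1) => 
      Q i.succ j.succ - Q i.succ 0 * 1 * Q 0 j.succ) := by
    ext i j; simp [Q]
  have h3 : Q 0 0 = 1 := by simp [Q]
  rw [h3, one_mul] at h
  rw [h2, ← h, Matrix.det_succ_row_zero]
  refine Ideal.sum_mem _ fun j _ => Ideal.mul_mem_left _ _ ?_
  refine Fin.cases ?_ (fun j => ?_) j
  · convert hdet using 2
    ext a b
    simp [Q]
  · rw [Matrix.det_succ_column_zero]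
    refine Ideal.sum_mem _ fun i _ => Ideal.mul_mem_left _ _ ?_
    convert hJ i.succAbove j.succAbove using 2
    ext a b
    simp [Q]

/-- Schur complement -/
def schur {A : Type*} [CommRing A] {m n : ℕ} (M : Matrix (Fin (m+1)) (Fin (n+1)) A) (v : A) : 
    Matrix (Fin m) (Fin n) A :=
  Matrix.of fun i j => M i.succ j.succ - M i.succ 0 * v * M 0 j.succ

theorem detIdeal_schur {A : Type*} [CommRing A] {m n t : ℕ} (M : Matrix (Fin (m+1)) (Fin (n+1)) A)
    (v : A) (huv : M 0 0 * v = 1) (ht : 1 ≤ t) : detIdeal (t + 1) M = detIdeal t (schur M v) := by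
  apply le_antisymm
  · rw [detIdeal, Ideal.span_le]
    rintro _ ⟨f, g, rfl⟩
    let N : Matrix (Fin (m+1)) (Fin (n+1)) A := 
      Matrix.of fun i j => M i j - M i 0 * v * M 0 j
    have hN : ∀ (f : Fin t → Fin (m+1)) (g : Fin t → Fin (n+1)), 
        (N.submatrix f g).det ∈ detIdeal t (schur M v) := by
      intro f g
      by_cases hf : ∃ i, f i = 0
      · obtain ⟨i, hi⟩ := hf
        rw [Matrix.det_eq_zero_of_row_eq_zero i]
        · exact Ideal.zero_mem _
        · intro j
          simp only [N, Matrix.submatrix_apply, Matrix.of_apply, hi]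
          linear_combination (- M 0 (g j)) * huv
      by_cases hg : ∃ i, g i = 0
      · obtain ⟨i, hi⟩ := hg
        rw [Matrix.det_eq_zero_of_column_eq_zero i]
        · exact Ideal.zero_mem _
        · intro j
          simp only [N, Matrix.submatrix_apply, Matrix.of_apply, hi]
          linear_combination (- M (f j) 0) * huv
      push Not at hf hg
      refine Ideal.subset_span ⟨fun i => (f i).pred (hf i), fun i => (g i).pred (hg i), ?_⟩
      congr 1
      ext i j
      simp [N, schur]
    have h1 := det_add_rank_one_mem (N.submatrix f g) (fun i => M (f i) 0) (fun j => v * M 0 (g j)) 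
      (detIdeal t (schur M v)) 
      (laplace_mem N _ (fun _ => True) t (fun f g _ => hN f g) (t+1) (by omega) f g 
        (fun _ => trivial)) (fun f' g' => hN _ _)
    have h2 : M.submatrix f g = Matrix.of fun i j => 
        N.submatrix f g i j + M (f i) 0 * (v * M 0 (g j)) := by
      ext i j; simp only [N, Matrix.submatrix_apply, Matrix.of_apply]; ring
    rw [h2]; exact h1
  · rw [detIdeal, Ideal.span_le]
    rintro _ ⟨f, g, rfl⟩
    let F : Fin (t+1) → Fin (m+1) := Fin.cons 0 (fun i => (f i).succ)
    let G : Fin (t+1) → Fin (n+1) := Fin.cons 0 (fun i => (g i).succ)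
    have h := schur0 (M.submatrix F G) v (by simpa [F, G] using huv)
    have h2 : (schur M v).submatrix f g = Matrix.of fun i j : Fin t => 
      (M.submatrix F G) i.succ j.succ - (M.submatrix F G) i.succ 0 * v * (M.submatrix F G) 0 j.succ := by
      ext i j; simp [F, G, schur]
    have h3 : ((schur M v).submatrix f g).det = v * (M.submatrix F G).det := by
      rw [h2, h, ← mul_assoc]
      have : v * (M.submatrix F G) 0 0 = 1 := by rw [mul_comm]; simpa [F, G] using huv
      rw [this, one_mul]
    rw [SetLike.mem_coe, h3]
    exact Ideal.mul_mem_left _ _ (Ideal.subset_span ⟨F, G, rfl⟩)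

theorem detIdeal_perm {A : Type*} [CommRing A] {m n t : ℕ} (M : Matrix (Fin m) (Fin n) A)
    (e₁ : Equiv.Perm (Fin m)) (e₂ : Equiv.Perm (Fin n)) : 
    detIdeal t (M.submatrix e₁ e₂) = detIdeal t M := by
  apply le_antisymm
  · rw [detIdeal, Ideal.span_le]
    rintro _ ⟨f, g, rfl⟩
    exact Ideal.subset_span ⟨e₁ ∘ f, e₂ ∘ g, rfl⟩
  · rw [detIdeal, Ideal.span_le]
    rintro _ ⟨f, g, rfl⟩
    refine Ideal.subset_span ⟨e₁.symm ∘ f, e₂.symm ∘ g, ?_⟩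
    congr 1
    ext i j; simp

theorem det_local' {A : Type u} [CommRing A] [IsDomain A] [IsLocalRing A] [IsNoetherianRing A]
    {K : Type*} [Field K] [Infinite K] [Algebra K A] (t : ℕ) : ∀ {m n : ℕ} (ht : 1 ≤ t) (htn : t ≤ n) 
    (htm : t ≤ m) (M : Matrix (Fin m) (Fin n) A) 
    (rs : List A) (hrs : ∀ r ∈ rs, r ∈ IsLocalRing.maximalIdeal A) (hreg : IsRegular A rs) (d : ℕ)
    (hd : d + (m - t + 1) * (n - t + 1) = rs.length) (hne : detIdeal t M ≠ ⊤)
    (hdim : ringKrullDim (A ⧸ detIdeal t M) ≤ d),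
    ∃ ws : List A, ws.length = d ∧ (∀ w ∈ ws, w ∈ IsLocalRing.maximalIdeal A) ∧ 
      IsRegular (A ⧸ detIdeal t M) (ws.map (Ideal.Quotient.mk (detIdeal t M))) := by
  induction t with
  | zero => intro m n ht; omega
  | succ t ih =>
    intro m n ht htn htm M rs hrs hreg d hd hne hdim
    by_cases hM : ∀ i j, M i j ∈ IsLocalRing.maximalIdeal A
    · exact det_local (K := K) ht htn htm M hM rs hrs hreg d hd hdim
    push Not at hM
    obtain ⟨i, j, hij⟩ := hM
    obtain ⟨m, rfl⟩ := Nat.exists_eq_succ_of_ne_zero (by omega : m ≠ 0)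
    obtain ⟨n, rfl⟩ := Nat.exists_eq_succ_of_ne_zero (by omega : n ≠ 0)
    rw [IsLocalRing.mem_maximalIdeal, mem_nonunits_iff, not_not] at hij
    rcases Nat.eq_zero_or_pos t with rfl | htp
    · have hmem : M i j ∈ detIdeal (0+1) M := by
        refine Ideal.subset_span ⟨fun _ => i, fun _ => j, ?_⟩
        simp
      exact absurd (Ideal.eq_top_of_isUnit_mem _ hmem hij) hne
    obtain ⟨v, hv⟩ := hij.exists_right_inv
    have key : detIdeal (t+1) M = 
        detIdeal t (schur (M.submatrix (Equiv.swap 0 i) (Equiv.swap 0 j)) v) := by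
      rw [← detIdeal_schur _ v (by simpa using hv) htp, detIdeal_perm]
    rw [key] at hne hdim ⊢
    refine ih htp (by omega) (by omega) _ rs hrs hreg d ?_ hne hdim
    rw [← hd]
    congr 3 <;> omega
end DetCM

namespace DetCM
open MvPolynomial RingTheory.Sequence
universe u

theorem mem_iff_of_map_equiv {R T : Type*} [CommRing R] [CommRing T] (e : R ≃+* T) (I : Ideal R) (J : Ideal T)
    (h : I.map (e : R →+* T) = J) (x : R) : x ∈ I ↔ e x ∈ J := by
  rw [← h]
  constructor
  · intro hx; exact Ideal.mem_map_of_mem (e : R →+* T) hx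
  · intro hx
    obtain ⟨y, hy, hyx⟩ := (Ideal.mem_map_iff_of_surjective (e : R →+* T) e.surjective).1 hx
    have : y = x := e.injective hyx
    rwa [← this]

theorem monic_nzd {K : Type*} [Field K] {n : ℕ} (k : Fin (n+1)) (q : Polynomial K) (hq : q.Monic)
    (G : Set (MvPolynomial (Fin (n+1)) K)) 
    (hG : ∀ g ∈ G, ∃ (j : Fin (n+1)) (p : Polynomial K), j ≠ k ∧ g = Polynomial.aeval (X j) p)
    (f : MvPolynomial (Fin (n+1)) K) (hf : Polynomial.aeval (X k) q * f ∈ Ideal.span G) : 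
    f ∈ Ideal.span G := by
  obtain ⟨e, hek, hej⟩ : ∃ e : MvPolynomial (Fin (n+1)) K ≃ₐ[K] Polynomial (MvPolynomial (Fin n) K),
      e (X k) = Polynomial.X ∧ ∀ j : Fin n, e (X (k.succAbove j)) = Polynomial.C (X j) := 
    ⟨(renameEquiv K (finSuccEquiv' k)).trans (optionEquivLeft K (Fin n)), 
      by simp [optionEquivLeft_X_none], fun j => by simp [optionEquivLeft_X_some]⟩
  let G0 : Set (MvPolynomial (Fin n) K) := {b | Polynomial.C b ∈ e '' G}
  have hmap : (Ideal.span G).map (e : MvPolynomial (Fin (n+1)) K →+* _) = 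
      (Ideal.span G0).map Polynomial.C := by
    rw [Ideal.map_span, Ideal.map_span]
    congr 1
    ext x
    constructor
    · rintro ⟨g, hg, rfl⟩
      obtain ⟨j, p, hj, rfl⟩ := hG g hg
      obtain ⟨j, rfl⟩ := Fin.exists_succAbove_eq hj
      have hC : e (Polynomial.aeval (X (k.succAbove j)) p) = 
          Polynomial.C (Polynomial.aeval (X j : MvPolynomial (Fin n) K) p) := by
        rw [← Polynomial.aeval_algHom_apply e, hej]
        exact Polynomial.aeval_algHom_apply 
          (Polynomial.CAlgHom (R := K) (A := MvPolynomial (Fin n) K)) (X j) p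
      exact ⟨_, ⟨_, hg, hC⟩, hC.symm⟩
    · rintro ⟨b, ⟨g, hg, hgb⟩, rfl⟩
      exact ⟨g, hg, hgb⟩
  have hmem : ∀ x, x ∈ Ideal.span G ↔ e x ∈ (Ideal.span G0).map Polynomial.C := by
    intro x
    exact mem_iff_of_map_equiv e.toRingEquiv _ _ hmap x
  rw [hmem] at hf ⊢
  have hq' : e (Polynomial.aeval (X k) q) = q.map (algebraMap K (MvPolynomial (Fin n) K)) := by
    rw [← Polynomial.aeval_algHom_apply e, hek]
    rw [Polynomial.aeval_X_left_eq_map]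
  rw [map_mul, hq'] at hf
  have hker : ∀ y : Polynomial (MvPolynomial (Fin n) K), y ∈ (Ideal.span G0).map Polynomial.C ↔ 
      y.map (Ideal.Quotient.mk (Ideal.span G0)) = 0 := by
    intro y
    rw [Ideal.mem_map_C_iff, Polynomial.ext_iff]
    simp [Ideal.Quotient.eq_zero_iff_mem]
  rw [hker] at hf ⊢
  rw [Polynomial.map_mul] at hf
  exact (((hq.map _).map _).mul_right_eq_zero_iff).1 hf

theorem exists_regular_max {K : Type*} [Field K] {s : ℕ} (𝔪 : Ideal (MvPolynomial (Fin s) K)) 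
    [h𝔪 : 𝔪.IsMaximal] : ∃ rs : List (MvPolynomial (Fin s) K), rs.length = s ∧ (∀ r ∈ rs, r ∈ 𝔪) ∧ 
      IsWeaklyRegular (MvPolynomial (Fin s) K) rs := by
  letI : Field (MvPolynomial (Fin s) K ⧸ 𝔪) := Ideal.Quotient.field 𝔪
  have hinteg := MvPolynomial.comp_C_integral_of_surjective_of_isJacobsonRing (R := K)
    (Ideal.Quotient.mk 𝔪) Ideal.Quotient.mk_surjective
  choose q hqm hq0 using fun k : Fin s => hinteg (Ideal.Quotient.mk 𝔪 (X k))
  refine ⟨List.ofFn fun k => Polynomial.aeval (X k) (q k), by simp, ?_, ?_⟩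
  · intro r hr
    obtain ⟨k, rfl⟩ := (List.mem_ofFn' _ _).1 hr
    simp only
    rw [← Ideal.Quotient.eq_zero_iff_mem, Polynomial.aeval_def, Polynomial.hom_eval₂]
    exact hq0 k
  · rw [isWeaklyRegular_iff_Fin]
    intro i
    obtain ⟨i, hi⟩ := i
    have his : i < s := by simpa using hi
    obtain ⟨n, rfl⟩ := Nat.exists_eq_succ_of_ne_zero (by omega : s ≠ 0)
    simp only [Fin.getElem_fin, List.getElem_ofFn]
    rw [isSMulRegular_iff_right_eq_zero_of_smul]
    intro x hx
    obtain ⟨f, rfl⟩ := Submodule.Quotient.mk_surjective _ x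
    rw [← Submodule.Quotient.mk_smul, Submodule.Quotient.mk_eq_zero] at hx
    rw [Submodule.Quotient.mk_eq_zero]
    rw [smul_eq_mul, smul_eq_mul, Ideal.mul_top] at hx
    rw [smul_eq_mul, Ideal.mul_top]
    refine monic_nzd ⟨i, his⟩ (q ⟨i, his⟩) (hqm _) _ ?_ f hx
    intro g hg
    obtain ⟨j, hj, rfl⟩ := List.mem_iff_getElem.1 hg
    simp only [List.length_take, List.length_ofFn] at hj
    refine ⟨⟨j, by omega⟩, q ⟨j, by omega⟩, ?_, ?_⟩
    · simp only [ne_eq, Fin.mk.injEq]; omega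
    · simp only [List.getElem_take, List.getElem_ofFn]
end DetCM

namespace DetCM
open MvPolynomial RingTheory.Sequence
universe u

theorem loc_quot_equiv {R W B : Type u} [CommRing R] [CommRing W] [Algebra R W] (I : Ideal R)
    (p : Ideal (R ⧸ I)) [p.IsPrime] (𝔪 : Ideal R) [𝔪.IsPrime] (h𝔪 : 𝔪 = p.comap (Ideal.Quotient.mk I))
    [IsLocalization.AtPrime W 𝔪] [CommRing B] [Algebra (R ⧸ I) B] [IsLocalization.AtPrime B p] : 
    Nonempty (W ⧸ I.map (algebraMap R W) ≃+* B) := by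
  have h1 : IsLocalization (Algebra.algebraMapSubmonoid (R ⧸ I) 𝔪.primeCompl) 
    (W ⧸ I.map (algebraMap R W)) := inferInstance
  have h2 : Algebra.algebraMapSubmonoid (R ⧸ I) 𝔪.primeCompl = p.primeCompl := by
    subst h𝔪
    exact Submonoid.map_comap_eq_of_surjective Ideal.Quotient.mk_surjective p.primeCompl
  rw [h2] at h1
  exact ⟨(IsLocalization.algEquiv p.primeCompl (W ⧸ I.map (algebraMap R W)) B).toRingEquiv⟩

theorem localDepth_le {B : Type u} [CommRing B] [IsLocalRing B] [IsNoetherianRing B] : 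
    (localDepth B : WithBot ℕ∞) ≤ ringKrullDim B := by
  have key : ∀ rs : List B, (∀ r ∈ rs, r ∈ IsLocalRing.maximalIdeal B) → IsRegular B rs → 
      ((rs.length : ℕ∞) : WithBot ℕ∞) ≤ ringKrullDim B := by
    intro rs h hr
    have h3 := ringKrullDim_add_length_eq_ringKrullDim_of_isRegular rs hr
    rw [← h3]
    have : Nontrivial (B ⧸ Ideal.ofList rs) := by
      refine Ideal.Quotient.nontrivial_iff.2 ?_
      intro htop
      have h2 : Ideal.ofList rs ≤ IsLocalRing.maximalIdeal B := Ideal.span_le.2 h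
      rw [htop] at h2
      exact (IsLocalRing.maximalIdeal.isMaximal B).ne_top (top_le_iff.1 h2)
    have : (0 : WithBot ℕ∞) ≤ ringKrullDim (B ⧸ Ideal.ofList rs) := ringKrullDim_nonneg_of_nontrivial
    exact le_add_of_nonneg_left this
  have hne : ringKrullDim B ≠ ⊥ := ringKrullDim_ne_bot
  obtain ⟨D, hD⟩ := WithBot.ne_bot_iff_exists.1 hne
  rw [← hD] at key ⊢
  norm_cast
  refine iSup_le fun rs => iSup_le fun h => iSup_le fun hr => ?_
  exact_mod_cast key rs h hr

theorem localDepth_eq {B : Type u} [CommRing B] [IsLocalRing B] [IsNoetherianRing B] (d : ℕ) 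
    (hd : ringKrullDim B ≤ d) (ws : List B) (hws : ws.length = d) 
    (hm : ∀ w ∈ ws, w ∈ IsLocalRing.maximalIdeal B) (hr : IsRegular B ws) : 
    (localDepth B : WithBot ℕ∞) = ringKrullDim B := by
  refine le_antisymm localDepth_le (hd.trans ?_)
  have : (d : ℕ∞) ≤ localDepth B := by
    rw [← hws]
    exact le_iSup_of_le ws (le_iSup_of_le hm (le_iSup_of_le hr le_rfl))
  exact_mod_cast this

theorem local_cm {K : Type u} [Field K] [Infinite K] {W B : Type u} [CommRing W] [IsDomain W] [IsLocalRing W]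
    [IsNoetherianRing W] [Algebra K W] [CommRing B] [IsLocalRing B] 
    {m n t : ℕ} (ht : 1 ≤ t) (htn : t ≤ n) (htm : t ≤ m) (M : Matrix (Fin m) (Fin n) W)
    (rs : List W) (hrs : ∀ r ∈ rs, r ∈ IsLocalRing.maximalIdeal W) (hreg : IsRegular W rs) (d : ℕ)
    (hd : d + (m - t + 1) * (n - t + 1) = rs.length) (e : W ⧸ detIdeal t M ≃+* B) 
    (hdim : ringKrullDim B ≤ d) : (localDepth B : WithBot ℕ∞) = ringKrullDim B := by
  have hne : detIdeal t M ≠ ⊤ := by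
    intro h
    have : Subsingleton (W ⧸ detIdeal t M) := Ideal.Quotient.subsingleton_iff.2 h
    have := e.symm.toEquiv.subsingleton
    exact not_subsingleton B this
  obtain ⟨ws, hl, hm, hr⟩ := det_local' (K := K) t ht htn htm M rs hrs hreg d hd hne 
    (by rwa [ringKrullDim_eq_of_ringEquiv e])
  have : IsNoetherianRing B := isNoetherianRing_of_ringEquiv _ e
  have hs : Function.Surjective (e.toRingHom.comp (Ideal.Quotient.mk (detIdeal t M))) := 
    e.surjective.comp Ideal.Quotient.mk_surjective
  refine localDepth_eq d hdim (ws.map (e.toRingHom.comp (Ideal.Quotient.mk (detIdeal t M)))) (by simpa) ?_ ?_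
  · intro w hw1
    obtain ⟨w, hw, rfl⟩ := List.mem_map.1 hw1
    have := IsLocalHom.of_surjective _ hs
    rw [IsLocalRing.mem_maximalIdeal, mem_nonunits_iff]
    intro hu
    exact hm w hw (isUnit_of_map_unit _ _ hu)
  · have h1 : IsRegular (W ⧸ detIdeal t M) ws := (reg_iff (Ideal.Quotient.mk (detIdeal t M)) Ideal.Quotient.mk_surjective
      _ Ideal.mk_ker ws).2 hr
    refine (reg_iff _ hs (detIdeal t M) ?_ ws).1 h1
    ext x
    simp [RingHom.mem_ker, Ideal.Quotient.eq_zero_iff_mem]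

theorem cm_of_dim {K : Type u} [Field K] [Infinite K] {s m n t : ℕ} (ht : 1 ≤ t) (htn : t ≤ n) (htm : t ≤ m)
    (M : Matrix (Fin m) (Fin n) (MvPolynomial (Fin s) K)) (d : ℕ) 
    (hd : d + (m - t + 1) * (n - t + 1) = s) 
    (hdim : ringKrullDim (MvPolynomial (Fin s) K ⧸ detIdeal t M) ≤ d) : 
    IsCohenMacaulayRing (MvPolynomial (Fin s) K ⧸ detIdeal t M) := by
  intro p hp
  have hpp : p.IsPrime := hp.isPrime
  obtain ⟨𝔪, h𝔪⟩ : ∃ 𝔪 : Ideal (MvPolynomial (Fin s) K), 𝔪 = p.comap (Ideal.Quotient.mk _) := ⟨_, rfl⟩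
  have hmax : 𝔪.IsMaximal := by 
    rw [h𝔪]; exact Ideal.comap_isMaximal_of_surjective _ Ideal.Quotient.mk_surjective
  have hmp : 𝔪.IsPrime := hmax.isPrime
  obtain ⟨rs, hl, hm, hr⟩ := exists_regular_max 𝔪
  have hr' := hr.isRegular_of_isLocalization_of_mem (Localization.AtPrime 𝔪) 𝔪 hm
  obtain ⟨e⟩ := loc_quot_equiv (W := Localization.AtPrime 𝔪) (B := Localization.AtPrime p) 
    (detIdeal t M) p 𝔪 h𝔪
  rw [detIdeal_map] at e
  have : IsNoetherianRing (Localization.AtPrime 𝔪) := IsLocalization.isNoetherianRing 𝔪.primeCompl _ inferInstance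
  have : IsDomain (Localization.AtPrime 𝔪) := 
    IsLocalization.isDomain_of_le_nonZeroDivisors (M := 𝔪.primeCompl) _ 𝔪.primeCompl_le_nonZeroDivisors
  refine local_cm (K := K) ht htn htm _ _ ?_ hr' d (by simpa [hl] using hd) e ?_
  · intro r hr1
    obtain ⟨r, hr2, rfl⟩ := List.mem_map.1 hr1
    exact (IsLocalization.AtPrime.to_map_mem_maximal_iff _ 𝔪 r).2 (hm r hr2)
  · refine le_trans ?_ hdim
    rw [IsLocalization.AtPrime.ringKrullDim_eq_height p]
    exact Ideal.height_le_ringKrullDim_of_isPrime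
end DetCM

namespace DetCM
open MvPolynomial RingTheory.Sequence
universe u

theorem trdeg_bound {K : Type u} [Field K] {R : Type u} [CommRing R] [IsDomain R] [Algebra K R] {s d : ℕ}
    (x : Fin s → R) (hx : Function.Surjective (aeval (R := K) x))
    (h : ∀ c : Fin (d+1) → Fin s, Function.Injective c → ∃ p : MvPolynomial (Fin (d+1)) K, p ≠ 0 ∧ 
      aeval (x ∘ c) p = 0) : Algebra.trdeg K R ≤ d := by
  have hadj : Algebra.adjoin K (Set.range x) = ⊤ := by
    rw [Algebra.adjoin_range_eq_range_aeval, AlgHom.range_eq_top]; exact hx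
  have halg : Algebra.IsAlgebraic (Algebra.adjoin K (Set.range x)) R := by
    constructor
    intro y
    have hy : y ∈ Algebra.adjoin K (Set.range x) := by rw [hadj]; trivial
    exact isAlgebraic_algebraMap (⟨y, hy⟩ : Algebra.adjoin K (Set.range x))
  obtain ⟨u, hu, hb⟩ := exists_isTranscendenceBasis_subset (R := K) (Set.range x)
  rw [← hb.cardinalMk_eq_trdeg]
  by_contra! hlt
  have h1 : ((d+1 : ℕ) : Cardinal.{u}) ≤ Cardinal.mk u := by
    exact_mod_cast Cardinal.natCast_add_one_le_iff.2 hlt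
  have h2 : Cardinal.lift.{u} (Cardinal.mk (Fin (d+1))) ≤ Cardinal.lift.{0} (Cardinal.mk u) := by
    simpa using h1
  obtain ⟨g⟩ := Cardinal.lift_mk_le'.1 h2
  choose c hc using fun i => hu (g i).2
  have hcinj : Function.Injective c := by
    intro i j hij
    apply g.injective
    apply Subtype.ext
    rw [← hc, ← hc, hij]
  obtain ⟨p, hp, hp0⟩ := h c hcinj
  have hind := hb.1.comp g g.injective
  have : (x ∘ c) = (Subtype.val ∘ g) := funext hc
  rw [this] at hp0
  exact hp ((injective_iff_map_eq_zero _).1 hind p hp0)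

theorem mkₐ_eq_aeval' {K : Type u} [Field K] {s : ℕ} (I : Ideal (MvPolynomial (Fin s) K)) : 
    Ideal.Quotient.mkₐ K I = aeval (fun i => Ideal.Quotient.mkₐ K I (X i)) := by
  ext i; simp

theorem dim_aux {K : Type u} [Field K] {R : Type u} [CommRing R] [Algebra K R] {s d r : ℕ} 
    (x : Fin s → R) (hx : Function.Surjective (aeval (R := K) x))
    (h : ∀ c : Fin (d+1) → Fin s, Function.Injective c → ∃ p : MvPolynomial (Fin (d+1)) K, p ≠ 0 ∧ 
      aeval (x ∘ c) p = 0) (g : MvPolynomial (Fin r) K →ₐ[K] R) (hg : Function.Injective g) : r ≤ d := by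
  obtain ⟨P, hP, -, hPS⟩ := Ideal.exists_le_prime_disjoint (⊥ : Ideal R) 
      ((nonZeroDivisors (MvPolynomial (Fin r) K)).map g) (by
    rw [Set.disjoint_left]
    rintro _ rfl ⟨y, hy, hy0⟩
    have hy1 : y = 0 := hg (by simpa using hy0)
    exact nonZeroDivisors.ne_zero hy hy1)
  have h1 : Function.Injective ((Ideal.Quotient.mkₐ K P).comp g) := by
    rw [injective_iff_map_eq_zero]
    intro y hy
    by_contra hne
    have : g y ∈ P := Ideal.Quotient.eq_zero_iff_mem.1 hy
    exact Set.disjoint_left.1 hPS this ⟨y, mem_nonZeroDivisors_of_ne_zero hne, rfl⟩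
  have h2 := trdeg_le_of_injective _ h1
  rw [MvPolynomial.trdeg_of_isDomain] at h2
  have h3 : Algebra.trdeg K (R ⧸ P) ≤ d := by
    have hφ : aeval (fun i => Ideal.Quotient.mkₐ K P (x i)) = (Ideal.Quotient.mkₐ K P).comp (aeval x) := by
      ext i; simp
    refine trdeg_bound (fun i => Ideal.Quotient.mkₐ K P (x i)) ?_ ?_
    · rw [hφ]; exact (Ideal.Quotient.mkₐ_surjective K P).comp hx
    · intro c hc
      obtain ⟨p, hp, hp0⟩ := h c hc
      refine ⟨p, hp, ?_⟩
      have : aeval ((fun i => Ideal.Quotient.mkₐ K P (x i)) ∘ c) p = Ideal.Quotient.mkₐ K P (aeval (x ∘ c) p) := by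
        rw [← aeval_rename, hφ, AlgHom.comp_apply, aeval_rename]
      rw [this, hp0, map_zero]
  have h4 := h2.trans h3
  simpa using h4

theorem dim_bound {K : Type u} [Field K] {s d : ℕ} (I : Ideal (MvPolynomial (Fin s) K)) 
    (h : ∀ c : Fin (d+1) → Fin s, Function.Injective c → ∃ p : MvPolynomial (Fin (d+1)) K, p ≠ 0 ∧ 
      rename c p ∈ I) : ringKrullDim (MvPolynomial (Fin s) K ⧸ I) ≤ d := by
  by_cases hI : I = ⊤
  · have : Subsingleton (MvPolynomial (Fin s) K ⧸ I) := Ideal.Quotient.subsingleton_iff.2 hI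
    rw [ringKrullDim_eq_bot_of_subsingleton]; exact bot_le
  obtain ⟨r, -, g, hg, hinteg⟩ := exists_integral_inj_algHom_of_quotient I hI
  have hr : ringKrullDim (MvPolynomial (Fin s) K ⧸ I) ≤ r := by
    let : Algebra (MvPolynomial (Fin r) K) (MvPolynomial (Fin s) K ⧸ I) := g.toRingHom.toAlgebra
    have : Algebra.IsIntegral (MvPolynomial (Fin r) K) (MvPolynomial (Fin s) K ⧸ I) := ⟨hinteg⟩
    have h1 : ringKrullDim (MvPolynomial (Fin s) K ⧸ I) ≤ ringKrullDim (MvPolynomial (Fin r) K) := 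
      Order.krullDim_le_of_strictMono (PrimeSpectrum.comap (algebraMap _ _)) 
        (fun P Q hPQ => Ideal.IsIntegral.comap_lt_comap (I := P.asIdeal) (J := Q.asIdeal) hPQ)
    refine h1.trans ?_
    rw [MvPolynomial.ringKrullDim_of_isNoetherianRing]
    simp
  refine hr.trans ?_
  suffices r ≤ d by exact_mod_cast this
  refine dim_aux (fun i => Ideal.Quotient.mkₐ K I (X i)) ?_ ?_ g hg
  · rw [← mkₐ_eq_aeval']; exact Ideal.Quotient.mkₐ_surjective K I
  · intro c hc
    obtain ⟨p, hp, hp0⟩ := h c hc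
    refine ⟨p, hp, ?_⟩
    have h5 : aeval ((fun i => Ideal.Quotient.mkₐ K I (X i)) ∘ c) p = Ideal.Quotient.mkₐ K I (rename c p) := by
      rw [mkₐ_eq_aeval' I, aeval_rename, ← mkₐ_eq_aeval' I]
    rw [h5]
    exact Ideal.Quotient.eq_zero_iff_mem.2 hp0
end DetCM

namespace DetCM
open MvPolynomial RingTheory.Sequence
universe u

theorem rank_fact {F : Type*} [Field F] {m n t : ℕ} (ht : 1 ≤ t) (Y : Matrix (Fin m) (Fin n) F)
    (hY : ∀ (f : Fin t → Fin m) (g : Fin t → Fin n), (Y.submatrix f g).det = 0) : 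
    ∃ (r : ℕ) (f : Fin r → Fin m) (g : Fin r → Fin n), r < t ∧ (Y.submatrix f g).det ≠ 0 ∧
      Y = Y.submatrix id g * ((Y.submatrix f g)⁻¹ * Y.submatrix f id) := by
  obtain ⟨t, rfl⟩ := Nat.exists_eq_succ_of_ne_zero (by omega : t ≠ 0)
  have h1 : Module.finrank F (colSpan Y n) ≤ t := finrank_le_of_minor fun f g _ => hY f g
  have h0 : colSpan Y n = Submodule.span F (Set.range Y.col) := by
    unfold colSpan
    congr 1
    ext v; simp
  rw [h0] at h1
  obtain ⟨b, hb1, hb2, hb3⟩ := Submodule.exists_fun_fin_finrank_span_eq F (Set.range Y.col)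
  generalize hr : Module.finrank F (Submodule.span F (Set.range Y.col)) = r at *
  choose g hg using hb1
  have h4 : (Y.submatrix id g).col = b := by
    ext i k
    exact congrFun (hg i) k
  obtain ⟨f, hf⟩ := exists_minor_of_rank (Y.submatrix id g) (by rw [h4]; exact hb3)
  have hf' : (Y.submatrix f g).det ≠ 0 := by simpa using hf
  refine ⟨r, f, g, by omega, hf', ?_⟩
  have hC : ∃ C : Matrix (Fin r) (Fin n) F, Y = Y.submatrix id g * C := by
    have : ∀ j, ∃ c : Fin r → F, ∑ k, c k • b k = Y.col j := by
      intro j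
      have : Y.col j ∈ Submodule.span F (Set.range b) := by
        rw [hb2]; exact Submodule.subset_span ⟨j, rfl⟩
      exact (Submodule.mem_span_range_iff_exists_fun F).1 this
    choose c hc using this
    refine ⟨Matrix.of fun k j => c j k, ?_⟩
    ext i j
    have := congrFun (hc j) i
    simp only [Finset.sum_apply, Pi.smul_apply, smul_eq_mul] at this
    rw [Matrix.mul_apply]
    rw [← Matrix.col_apply Y, ← this]
    refine Finset.sum_congr rfl fun k _ => ?_
    rw [← h4]; simp [mul_comm]
  obtain ⟨C, hC⟩ := hC
  have h6 : Y.submatrix f id = Y.submatrix f g * C := by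
    conv_lhs => rw [hC]
    ext i j; simp [Matrix.mul_apply]
  have h7 : C = (Y.submatrix f g)⁻¹ * Y.submatrix f id := by
    rw [h6, ← Matrix.mul_assoc, Matrix.nonsing_inv_mul _ (isUnit_iff_ne_zero.2 hf'), Matrix.one_mul]
  rw [← h7]; exact hC

theorem inv_mem {K Ω : Type*} [Field K] [Field Ω] [Algebra K Ω] (E : IntermediateField K Ω) {r : ℕ} 
    (V : Matrix (Fin r) (Fin r) Ω) (hV : ∀ i j, V i j ∈ E) (i j) : V⁻¹ i j ∈ E := by
  obtain ⟨V', rfl⟩ : ∃ V' : Matrix (Fin r) (Fin r) E, V'.map (algebraMap E Ω) = V := 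
    ⟨Matrix.of fun i j => ⟨V i j, hV i j⟩, by ext i j; rfl⟩
  have : (V'.map (algebraMap E Ω))⁻¹ = (V'⁻¹).map (algebraMap E Ω) := by
    rw [Matrix.inv_def, Matrix.inv_def]
    ext i j
    simp only [Matrix.smul_apply, Matrix.map_apply, smul_eq_mul, map_mul, Ring.inverse_eq_inv', map_inv₀]
    have h1 := RingHom.map_det (algebraMap E Ω) V'
    have h2 := RingHom.map_adjugate (algebraMap E Ω) V'
    simp only [RingHom.mapMatrix_apply] at h1 h2
    rw [h1, ← h2]; rfl
  rw [this]
  exact (V'⁻¹ i j).2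

theorem isAlg_of_adjoin {K Ω : Type*} [Field K] [Field Ω] [Algebra K Ω] (Z : Set Ω) 
    (h : IntermediateField.adjoin K Z = ⊤) : Algebra.IsAlgebraic (Algebra.adjoin K Z) Ω := by
  constructor
  intro y
  have hy : y ∈ IntermediateField.adjoin K Z := by rw [h]; trivial
  obtain ⟨r, hr, s, hs, rfl⟩ := (IntermediateField.mem_adjoin_iff_div).1 hy
  rw [div_eq_mul_inv]
  exact (isAlgebraic_algebraMap (⟨r, hr⟩ : Algebra.adjoin K Z)).mul 
    (isAlgebraic_algebraMap (⟨s, hs⟩ : Algebra.adjoin K Z)).inv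

theorem mk_range_le_card {J : Type} [Fintype J] {Ω : Type u} (z : J → Ω) : 
    Cardinal.mk (Set.range z) ≤ (Fintype.card J : Cardinal.{u}) := by
  have h2 := Cardinal.mk_range_le_lift (f := z)
  rw [Cardinal.mk_fintype J] at h2
  simpa only [Cardinal.lift_natCast, Cardinal.lift_id, Cardinal.lift_uzero] using h2

theorem trdeg_ub {K Ω : Type u} [Field K] [Field Ω] [Algebra K Ω] {m n s t N : ℕ} (ht : 1 ≤ t) (htn : t ≤ n)
    (htm : t ≤ m) (a : Fin m × Fin n × Fin s → Ω) (x : Fin s → Ω) (A : Matrix (Fin m) (Fin n) (MvPolynomial (Fin s) K))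
    (E : (E : IntermediateField K Ω) → (∀ p, a p ∈ E) → (∀ i, x i ∈ E) → E = ⊤) 
    (k0 : Fin s) (hk0 : x k0 ≠ 0) (Y : Matrix (Fin m) (Fin n) Ω) 
    (hYdef : ∀ i j, Y i j = aeval x (A i j) + ∑ k, a (i, j, k) * x k ^ N)
    (hY : ∀ (f : Fin t → Fin m) (g : Fin t → Fin n), (Y.submatrix f g).det = 0) : 
    ∃ q : ℕ, Algebra.trdeg K Ω ≤ q ∧ q + (m - t + 1) * (n - t + 1) ≤ m * n * s + s := by
  obtain ⟨r, f, g, hrt, hdet, hfac⟩ := rank_fact ht Y hY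
  have hfi : Function.Injective f := by
    intro i j hij
    by_contra hne
    exact hdet (Matrix.det_zero_of_row_eq hne (by ext k; simp [hij]))
  have hgi : Function.Injective g := by
    intro i j hij
    by_contra hne
    exact hdet (Matrix.det_zero_of_column_eq hne (by intro k; simp [hij]))
  let Rf := Finset.univ.image f
  let Rg := Finset.univ.image g
  let G : Finset (Fin m × Fin n) := (Rfᶜ ×ˢ Rgᶜ)ᶜ
  let z : (Fin m × Fin n × {k : Fin s // k ≠ k0}) ⊕ Fin s ⊕ G → Ω := 
    Sum.elim (fun p => a (p.1, p.2.1, p.2.2.1)) (Sum.elim x (fun p => Y p.1.1 p.1.2))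
  obtain ⟨F, hF⟩ : ∃ F, F = IntermediateField.adjoin K (Set.range z) := ⟨_, rfl⟩
  have hz : ∀ w, z w ∈ F := fun w => by
    rw [hF]; exact IntermediateField.subset_adjoin _ _ ⟨w, rfl⟩
  have hx : ∀ i, x i ∈ F := fun i => hz (Sum.inr (Sum.inl i))
  have ha' : ∀ i j k, k ≠ k0 → a (i, j, k) ∈ F := fun i j k hk => hz (Sum.inl (i, j, ⟨k, hk⟩))
  have hYG : ∀ i j, (i, j) ∈ G → Y i j ∈ F := fun i j h => hz (Sum.inr (Sum.inr ⟨(i, j), h⟩))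
  have hYf : ∀ k j, Y (f k) j ∈ F := fun k j => hYG _ _ (by simp [G, Rf])
  have hYg : ∀ i k, Y i (g k) ∈ F := fun i k => hYG _ _ (by simp [G, Rg])
  have hYa : ∀ i j, Y i j ∈ F := by
    intro i j
    rw [hfac, Matrix.mul_apply]
    refine sum_mem fun k _ => mul_mem (hYg i k) ?_
    rw [Matrix.mul_apply]
    refine sum_mem fun l _ => mul_mem (inv_mem F _ (fun i j => hYf _ _) _ _) (hYf _ _)
  have hpoly : ∀ p : MvPolynomial (Fin s) K, aeval x p ∈ F := by
    intro p
    have h1 : aeval x p ∈ Algebra.adjoin K (Set.range x) := by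
      rw [Algebra.adjoin_range_eq_range_aeval]; exact ⟨p, rfl⟩
    have h2 : Algebra.adjoin K (Set.range x) ≤ F.toSubalgebra := by
      refine Algebra.adjoin_le ?_
      rintro _ ⟨i, rfl⟩; exact hx i
    exact h2 h1
  have ha : ∀ p, a p ∈ F := by
    rintro ⟨i, j, k⟩
    by_cases hk : k = k0
    · subst hk
      have h1 := hYdef i j
      rw [← Finset.add_sum_erase _ _ (Finset.mem_univ k)] at h1
      have h2 : a (i, j, k) = (Y i j - aeval x (A i j) - 
          ∑ l ∈ Finset.univ.erase k, a (i, j, l) * x l ^ N) / x k ^ N := by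
        rw [eq_div_iff (pow_ne_zero _ hk0), h1]; ring
      rw [h2]
      refine div_mem (sub_mem (sub_mem (hYa i j) (hpoly _)) (sum_mem fun l hl => ?_)) (pow_mem (hx k) _)
      exact mul_mem (ha' _ _ _ (Finset.ne_of_mem_erase hl)) (pow_mem (hx l) _)
    · exact ha' i j k hk
  have htop := E F ha hx
  rw [hF] at htop
  have halg := isAlg_of_adjoin _ htop
  have h1 := Algebra.IsAlgebraic.trdeg_le_cardinalMk K (Set.range z)
  refine ⟨_, h1.trans (mk_range_le_card z), ?_⟩
  have hcG : G.card = m * n - (m - r) * (n - r) := by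
    simp only [G, Rf, Rg]
    rw [Finset.card_compl, Finset.card_product, Finset.card_compl, Finset.card_compl, 
      Finset.card_image_of_injective _ hfi, Finset.card_image_of_injective _ hgi]
    simp
  simp only [Fintype.card_sum, Fintype.card_prod, Fintype.card_fin, Fintype.card_coe, hcG, 
    Fintype.card_subtype_compl, Fintype.card_unique, ne_eq]
  have h3 : (m - t + 1) * (n - t + 1) ≤ (m - r) * (n - r) := 
    Nat.mul_le_mul (by omega) (by omega)
  have h4 : (m - r) * (n - r) ≤ m * n := Nat.mul_le_mul (by omega) (by omega)
  have hs : 1 ≤ s := k0.pos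
  obtain ⟨s, rfl⟩ := Nat.exists_eq_succ_of_ne_zero (by omega : s ≠ 0)
  have h5 : m * n * (s+1) = m * (n * s) + m * n := by ring
  simp only [Nat.succ_eq_add_one, Nat.add_sub_cancel]
  rw [h5]
  omega
end DetCM

namespace DetCM
open MvPolynomial RingTheory.Sequence
universe u

theorem exists_point {K R : Type u} [Field K] [CommRing R] [Algebra K R] (I : Ideal R) (S : Submonoid R)
    (hd : Disjoint (I : Set R) S) : ∃ (Ω : Type u) (_ : Field Ω) (_ : Algebra K Ω) (ψ : R →ₐ[K] Ω), 
      (∀ y ∈ I, ψ y = 0) ∧ (∀ y ∈ S, ψ y ≠ 0) ∧ ∀ w, ∃ u v, w = ψ u / ψ v := by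
  obtain ⟨Q, hQ, hIQ, hQS⟩ := Ideal.exists_le_prime_disjoint I S hd
  let ψ : R →ₐ[K] FractionRing (R ⧸ Q) := 
    (IsScalarTower.toAlgHom K (R ⧸ Q) (FractionRing (R ⧸ Q))).comp (Ideal.Quotient.mkₐ K Q)
  have hψ : ∀ y, ψ y = 0 ↔ y ∈ Q := by
    intro y
    change algebraMap (R ⧸ Q) (FractionRing (R ⧸ Q)) (Ideal.Quotient.mk Q y) = 0 ↔ _
    rw [← Ideal.Quotient.eq_zero_iff_mem, IsFractionRing.to_map_eq_zero_iff]
  refine ⟨FractionRing (R ⧸ Q), inferInstance, inferInstance, ψ, ?_, ?_, ?_⟩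
  · intro y hy; rw [hψ]; exact hIQ hy
  · intro y hy h; rw [hψ] at h; exact Set.disjoint_left.1 hQS h hy
  · intro w
    obtain ⟨u, v, -, rfl⟩ := IsFractionRing.div_surjective (A := R ⧸ Q) w
    obtain ⟨u, rfl⟩ := Ideal.Quotient.mk_surjective u
    obtain ⟨v, rfl⟩ := Ideal.Quotient.mk_surjective v
    exact ⟨u, v, rfl⟩

noncomputable def Mgen {K : Type u} [Field K] {m n s : ℕ} (N : ℕ) (A : Matrix (Fin m) (Fin n) (MvPolynomial (Fin s) K)) :
    Matrix (Fin m) (Fin n) (MvPolynomial (Fin s) (MvPolynomial (Fin m × Fin n × Fin s) K)) :=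
  Matrix.of fun i j => map C (A i j) + ∑ k, C (X (i, j, k)) * X k ^ N

theorem elim_exists {K : Type u} [Field K] {m n s t d : ℕ} (N : ℕ) 
    (A : Matrix (Fin m) (Fin n) (MvPolynomial (Fin s) K)) (ht : 1 ≤ t) (htn : t ≤ n) (htm : t ≤ m)
    (hd : d + (m - t + 1) * (n - t + 1) = s) (c : Fin (d+1) → Fin s) (hc : Function.Injective c) : 
    ∃ p : MvPolynomial (Fin (d+1)) (MvPolynomial (Fin m × Fin n × Fin s) K), p ≠ 0 ∧ 
      rename c p ∈ detIdeal t (Mgen N A) := by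
  by_contra! hcon
  have hrinj : Function.Injective (rename (R := MvPolynomial (Fin m × Fin n × Fin s) K) c) := 
    rename_injective c hc
  obtain ⟨Ω, _, _, ψ, hI, hS, hfr⟩ := exists_point (K := K) (detIdeal t (Mgen N A))
    ((nonZeroDivisors (MvPolynomial (Fin (d+1)) (MvPolynomial (Fin m × Fin n × Fin s) K))).map 
      (rename c)) (by
    rw [Set.disjoint_left]
    rintro _ h ⟨y, hy, rfl⟩
    exact hcon y (nonZeroDivisors.ne_zero hy) h)
  have hne : ∀ p, p ≠ 0 → ψ (rename c p) ≠ 0 := fun p hp => 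
    hS _ ⟨p, mem_nonZeroDivisors_of_ne_zero hp, rfl⟩
  have hlow : ((d + 1 + m * n * s : ℕ) : Cardinal.{u}) ≤ Algebra.trdeg K Ω := by
    let θ : MvPolynomial (Fin (d+1) ⊕ (Fin m × Fin n × Fin s)) K →ₐ[K] Ω := 
      (ψ.comp ((rename c).restrictScalars K)).comp 
        (sumAlgEquiv K (Fin (d+1)) (Fin m × Fin n × Fin s)).toAlgHom
    have hθ : Function.Injective θ := by
      rw [injective_iff_map_eq_zero]
      intro y hy
      by_contra hy0
      exact hne (sumAlgEquiv K (Fin (d+1)) (Fin m × Fin n × Fin s) y) (by simpa using hy0) hy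
    have h2 := trdeg_le_of_injective θ hθ
    rw [MvPolynomial.trdeg_of_isDomain] at h2
    refine le_trans (le_of_eq ?_) h2
    rw [Cardinal.mk_fintype]
    simp [mul_assoc]
  have hψ : ∀ u, ψ (map C u) = aeval (fun i => ψ (X i)) u := by
    intro u
    induction u using MvPolynomial.induction_on with
    | C a => 
      rw [map_C, aeval_C]
      exact ψ.commutes a
    | add p q hp hq => simp only [map_add, hp, hq]
    | mul_X p i hp => simp only [map_mul, hp, map_X, aeval_X]
  obtain ⟨q, hq1, hq2⟩ := trdeg_ub (N := N) ht htn htm (fun p => ψ (C (X p))) (fun i => ψ (X i)) A (by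
      intro E ha hx
      have hC : ∀ p, ψ (C p) ∈ E := by
        intro p
        induction p using MvPolynomial.induction_on with
        | C b =>
          have : ψ (C (C b)) = algebraMap K Ω b := ψ.commutes b
          rw [this]; exact E.algebraMap_mem b
        | add p q hp hq => rw [C_add, map_add]; exact add_mem hp hq
        | mul_X p i hp => rw [C_mul, map_mul]; exact mul_mem hp (ha i)
      have hall : ∀ p, ψ p ∈ E := by
        intro p
        induction p using MvPolynomial.induction_on with
        | C b => exact hC b
        | add p q hp hq => rw [map_add]; exact add_mem hp hq
        | mul_X p i hp => rw [map_mul]; exact mul_mem hp (hx i)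
      rw [eq_top_iff]
      intro w _
      obtain ⟨u, v, rfl⟩ := hfr w
      exact div_mem (hall u) (hall v))
    (c 0) (by have := hne (X 0) (X_ne_zero 0); rwa [rename_X] at this) 
    ((Mgen N A).map ψ) (by
      intro i j
      simp only [Mgen, Matrix.map_apply, Matrix.of_apply, map_add, map_sum, map_mul, map_pow, hψ]) (by
      intro f g
      have h1 := hI ((Mgen N A).submatrix f g).det (Ideal.subset_span ⟨f, g, rfl⟩)
      have h2 := RingHom.map_det (ψ : _ →+* Ω) ((Mgen N A).submatrix f g)
      rw [← h1]
      exact h2.symm)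
  have := hlow.trans hq1
  have h3 : d + 1 + m * n * s ≤ q := by exact_mod_cast this
  omega

theorem Mgen_spec {K : Type u} [Field K] {m n s : ℕ} (N : ℕ) (A : Matrix (Fin m) (Fin n) (MvPolynomial (Fin s) K))
    (a : Fin m × Fin n × Fin s → K) : (Mgen N A).map (map (eval a)) = A + Matrix.of fun i j => 
      ∑ k : Fin s, C (a (i, j, k)) * X k ^ N := by
  ext1 i j
  have h : (eval a).comp (C : K →+* MvPolynomial (Fin m × Fin n × Fin s) K) = RingHom.id K := by 
    ext; simp
  simp only [Mgen, Matrix.map_apply, Matrix.of_apply, Matrix.add_apply, map_add, map_sum, map_mul, map_pow, map_map, h, 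
    map_id, map_C, map_X, eval_X]

theorem exists_poly {K : Type u} [Field K] {m n s : ℕ} (N : ℕ) 
    (A : Matrix (Fin m) (Fin n) (MvPolynomial (Fin s) K)) (hnm : n ≤ m) (t : ℕ) : 
    ∃ G : MvPolynomial (Fin m × Fin n × Fin s) K, G ≠ 0 ∧ ∀ a, eval a G ≠ 0 → 1 ≤ t → t ≤ n → 
      (m - t + 1) * (n - t + 1) < s → ringKrullDim (MvPolynomial (Fin s) K ⧸ detIdeal t (A + Matrix.of fun i j =>
        ∑ k : Fin s, C (a (i, j, k)) * X k ^ N)) ≤ (s - (m - t + 1) * (n - t + 1) : ℕ) := by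
  by_cases hyp : 1 ≤ t ∧ t ≤ n ∧ (m - t + 1) * (n - t + 1) < s
  swap
  · refine ⟨1, one_ne_zero, fun a _ h1 h2 h3 => absurd ⟨h1, h2, h3⟩ hyp⟩
  obtain ⟨h1, h2, h3⟩ := hyp
  obtain ⟨d, hd⟩ : ∃ d, d = s - (m - t + 1) * (n - t + 1) := ⟨_, rfl⟩
  have key : ∀ c : Fin (d+1) → Fin s, ∃ G : MvPolynomial (Fin m × Fin n × Fin s) K, G ≠ 0 ∧ 
      (Function.Injective c → ∀ a, eval a G ≠ 0 → ∃ p : MvPolynomial (Fin (d+1)) K, p ≠ 0 ∧ 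
        rename c p ∈ detIdeal t (A + Matrix.of fun i j => ∑ k : Fin s, C (a (i, j, k)) * X k ^ N)) := by
    intro c
    by_cases hc : Function.Injective c
    swap
    · exact ⟨1, one_ne_zero, fun h => absurd h hc⟩
    obtain ⟨p, hp, hpI⟩ := elim_exists N A h1 h2 (h2.trans hnm) (by omega) c hc
    obtain ⟨e, he⟩ := ne_zero_iff.1 hp
    refine ⟨coeff e p, he, fun _ a ha => ⟨map (eval a) p, ?_, ?_⟩⟩
    · intro h0
      apply ha
      rw [← coeff_map, h0, coeff_zero]
    · rw [← Mgen_spec, ← detIdeal_map, ← map_rename]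
      exact Ideal.mem_map_of_mem _ hpI
  choose G hG hG2 using key
  refine ⟨∏ c, G c, Finset.prod_ne_zero_iff.2 fun c _ => hG c, ?_⟩
  intro a ha _ _ _
  rw [← hd]
  refine dim_bound _ fun c hc => hG2 c hc a ?_
  rw [map_prod, Finset.prod_ne_zero_iff] at ha
  exact ha c (Finset.mem_univ c)

end DetCM

/-- For an `m × n` matrix `A` over `K[x_1,…,x_s]` (`n ≤ m`) with entries in
`⟨x_1,…,x_s⟩`, and the generic perturbation `B_a` with entries `∑_k a_{ijk} x_k^N`,
for generic `a` and every `t ∈ {1,…,n}` with `(m−t+1)(n−t+1) < s` the quotient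
`K[x_1,…,x_s]/I_t(A + B_a)` is Cohen–Macaulay. -/
theorem cohenMacaulay_detIdeal_generic_perturbation
    {K : Type*} [Field K] [Infinite K] {s m n : ℕ}
    (hs : 0 < s) (hm : 0 < m) (hn : 0 < n) (hnm : n ≤ m) (N : ℕ) (hN : 1 ≤ N)
    (A : Matrix (Fin m) (Fin n) (MvPolynomial (Fin s) K))
    (hA : ∀ i j, A i j ∈ Ideal.span (Set.range (MvPolynomial.X : Fin s → MvPolynomial (Fin s) K))) :
    ∃ U : Set (Fin m × Fin n × Fin s → K), ZariskiOpen U ∧ U.Nonempty ∧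
      ∀ a ∈ U, ∀ t : ℕ, 1 ≤ t → t ≤ n → (m - t + 1) * (n - t + 1) < s →
        IsCohenMacaulayRing (MvPolynomial (Fin s) K ⧸ detIdeal t (A + Matrix.of fun i j =>
          ∑ k : Fin s, MvPolynomial.C (a (i, j, k)) * MvPolynomial.X k ^ N)) := by
  choose G hG hG2 using DetCM.exists_poly (m := m) (n := n) N A hnm
  have hne : (∏ t ∈ Finset.range (n+1), G t) ≠ 0 := Finset.prod_ne_zero_iff.2 fun t _ => hG t
  refine ⟨{a | MvPolynomial.eval a (∏ t ∈ Finset.range (n+1), G t) ≠ 0}, 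
    ⟨{∏ t ∈ Finset.range (n+1), G t}, by ext a; simp⟩, ?_, ?_⟩
  · by_contra hemp
    apply hne
    apply MvPolynomial.funext
    intro a
    by_contra h
    exact hemp ⟨a, by simpa using h⟩
  · intro a ha t h1 h2 h3
    rw [Set.mem_setOf_eq, map_prod, Finset.prod_ne_zero_iff] at ha
    exact DetCM.cm_of_dim h1 h2 (h2.trans hnm) _ _ (by omega) 
      (hG2 t a (ha t (Finset.mem_range.2 (by omega))) h1 h2 h3)
end
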